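/- arXiv:1412.0531 — 3 statements merged into one kernel-verified Lean document; each statement's English description precedes it below -/
import Mathlib

section
/- Let f : ℝ³ → ℝ be smooth. Then there exists k₀ > 0 such that for every k ≥ k₀ there is a closed magnetic geodesic with energy k on the round sphere S², i.e. there exist T > 0 and a nonconstant smooth T-periodic curve γ : ℝ → ℝ³ with ‖γ(s)‖ = 1, γ''(s) = −‖γ'(s)‖² γ(s) + f(γ(s)) (γ(s) × γ'(s)), and ½‖γ'(s)‖² = k for all s ∈ ℝ. -/
open MeasureTheory
open scoped RealInnerProductSpace

/-- The cross product on ℝ³ (identified with `EuclideanSpace ℝ (Fin 3)`). -/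
noncomputable def cross3 (a b : EuclideanSpace ℝ (Fin 3)) : EuclideanSpace ℝ (Fin 3) :=
  (EuclideanSpace.equiv (Fin 3) ℝ).symm
    ![a 1 * b 2 - a 2 * b 1, a 2 * b 0 - a 0 * b 2, a 0 * b 1 - a 1 * b 0]

lemma mg_topological (N S : ℂ → ℂ) (hN : Continuous N) (hS : Continuous S)
    (hN0 : ∀ z, N z ≠ 0) (hS0 : ∀ z, S z ≠ 0)
    (h : ∀ θ : ℝ, S (Complex.exp (-(θ * Complex.I))) =
      - Complex.exp (-(2 * θ * Complex.I)) * N (Complex.exp (θ * Complex.I))) : False := by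
  have key : ∀ g : ℂ → ℂ, Continuous g → (∀ z, g z ≠ 0) →
      ∃ l : ℂ → ℂ, Continuous l ∧ ∀ z, Complex.exp (l z) = g z := by
    intro g hg hg0
    obtain ⟨l, hl⟩ := (Complex.isCoveringMapOn_exp.existsUnique_continuousMap_lifts
      (A := ℂ) ⟨g, hg⟩ (a₀ := 0) (Complex.exp_log (hg0 0)) (fun x => hg0 x)).exists
    exact ⟨l, l.continuous, fun z => congrFun hl.2 z⟩
  obtain ⟨n, hn, hn'⟩ := key N hN hN0
  obtain ⟨s, hs, hs'⟩ := key S hS hS0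
  let F : ℝ → ℂ := fun θ => s (Complex.exp (-(θ * Complex.I))) - n (Complex.exp (θ * Complex.I))
    + 2 * θ * Complex.I - Real.pi * Complex.I
  have hF : ∀ θ, Complex.exp (F θ) = 1 := by
    intro θ
    simp only [F]
    rw [Complex.exp_sub, Complex.exp_add, Complex.exp_sub, hs', hn', h, Complex.exp_pi_mul_I,
      Complex.exp_neg]
    have := hN0 (Complex.exp (θ * Complex.I))
    have := Complex.exp_ne_zero (2 * θ * Complex.I)
    field_simp
  have hFc : Continuous fun θ => (F θ).im := by
    simp only [F]
    fun_prop
  have h2 : (F (2 * Real.pi)).im = (F 0).im + 4 * Real.pi := by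
    simp only [F]
    have e1 : Complex.exp (((2 * Real.pi : ℝ) : ℂ) * Complex.I) = 1 := by
      push_cast; exact Complex.exp_two_pi_mul_I
    rw [Complex.exp_neg, e1]
    simp
    ring
  have hpi := Real.pi_pos
  have hmem : (F 0).im + Real.pi ∈ Set.Icc ((F 0).im) ((F (2 * Real.pi)).im) := by
    rw [h2]; constructor <;> linarith
  obtain ⟨θ, -, hθ⟩ := intermediate_value_Icc (by positivity) hFc.continuousOn hmem
  obtain ⟨m, hm⟩ := Complex.exp_eq_one_iff.1 (hF θ)
  obtain ⟨m0, hm0⟩ := Complex.exp_eq_one_iff.1 (hF 0)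
  simp only at hθ
  rw [hm, hm0] at hθ
  simp at hθ
  have : ((2 * m : ℤ) : ℝ) = ((2 * m0 + 1 : ℤ) : ℝ) := by
    push_cast
    have : Real.pi * (2 * m) = Real.pi * (2 * m0 + 1) := by linarith
    exact mul_left_cancel₀ hpi.ne' this
  have := Int.cast_injective this
  omega

open scoped BoundedContinuousFunction

noncomputable def mgK (t : ℝ) : ℝ × ℝ :=
  ((Real.pi - t) * Real.sin t / (2 * Real.pi),
    ((Real.pi - t) * Real.cos t - Real.sin t) / (2 * Real.pi))

lemma mgK_continuous : Continuous mgK := by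
  unfold mgK; fun_prop

lemma mgK_norm {t : ℝ} (h : t ∈ Set.uIoc 0 (2 * Real.pi)) : ‖mgK t‖ ≤ 1 := by
  have hpi := Real.pi_gt_three
  rw [Set.uIoc_of_le (by positivity)] at h
  have h1 : |Real.pi - t| ≤ Real.pi := by
    rw [abs_le]; constructor <;> linarith [h.1, h.2]
  have hs := Real.abs_sin_le_one t
  have hc := Real.abs_cos_le_one t
  have a1 : |(Real.pi - t) * Real.sin t| ≤ Real.pi := by
    rw [abs_mul]; nlinarith [abs_nonneg (Real.pi - t), abs_nonneg (Real.sin t)]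
  have a2 : |(Real.pi - t) * Real.cos t| ≤ Real.pi := by
    rw [abs_mul]; nlinarith [abs_nonneg (Real.pi - t), abs_nonneg (Real.cos t)]
  have a3 : |(Real.pi - t) * Real.cos t - Real.sin t| ≤ Real.pi + 1 :=
    (abs_sub _ _).trans (by linarith)
  rw [Prod.norm_def, max_le_iff]
  simp only [mgK, Real.norm_eq_abs, abs_div, abs_of_pos (show 0 < 2 * Real.pi by linarith)]
  constructor <;> rw [div_le_one (by linarith)] <;> linarith

/-- convolution estimate -/
lemma mg_conv_norm (g : ℝ → ℝ) (M : ℝ) (hM : ∀ s, |g s| ≤ M) (θ : ℝ) :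
    ‖∫ t in (0:ℝ)..(2 * Real.pi), g (θ - t) • mgK t‖ ≤ M * (2 * Real.pi) := by
  have := intervalIntegral.norm_integral_le_of_norm_le_const (a := 0) (b := 2 * Real.pi)
    (f := fun t => g (θ - t) • mgK t) (C := M) (by
      intro t ht
      rw [norm_smul]
      have := mgK_norm ht
      have := hM (θ - t)
      rw [Real.norm_eq_abs]
      nlinarith [abs_nonneg (g (θ - t)), norm_nonneg (mgK t)])
  rwa [sub_zero, abs_of_pos (by positivity)] at this

lemma mg_conv_cont (H : ℝ → ℝ × ℝ → ℝ) (hH : Continuous (Function.uncurry H))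
    {U : ℝ → ℝ × ℝ} (hU : Continuous U) (ε : ℝ) : Continuous
    (fun θ => ε • ∫ t in (0:ℝ)..(2 * Real.pi), H (θ - t) (U (θ - t)) • mgK t) := by
  have hK := mgK_continuous
  have h1 : Continuous (Function.uncurry
      (fun θ t : ℝ => H (θ - t) (U (θ - t)) • mgK t)) := by
    have h0 : Continuous (fun p : ℝ × ℝ => H (p.1 - p.2) (U (p.1 - p.2))) :=
      hH.comp (f := fun p : ℝ × ℝ => (p.1 - p.2, U (p.1 - p.2))) (by fun_prop)
    have h3 : Continuous (fun p : ℝ × ℝ => mgK p.2) := hK.comp continuous_snd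
    exact h0.smul h3
  have h2 := intervalIntegral.continuous_parametric_intervalIntegral_of_continuous'
    (μ := MeasureTheory.volume) h1 0 (2 * Real.pi)
  exact h2.const_smul ε

section
variable {Y : Type*} (G : Y → ℝ → ℝ × ℝ → ℝ) (M : ℝ)
  (hM : ∀ y θ w, |G y θ w| ≤ M) (hc : ∀ y, Continuous (Function.uncurry (G y))) (ε : ℝ)

noncomputable def mgPsi (y : Y) (U : ℝ →ᵇ ℝ × ℝ) : ℝ →ᵇ ℝ × ℝ :=
  BoundedContinuousFunction.ofNormedAddCommGroup
    (fun θ => ε • ∫ t in (0:ℝ)..(2 * Real.pi), G y (θ - t) (U (θ - t)) • mgK t)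
    (mg_conv_cont (G y) (hc y) U.continuous ε)
    (|ε| * (M * (2 * Real.pi)))
    (by
      intro θ
      rw [norm_smul, Real.norm_eq_abs]
      gcongr
      exact mg_conv_norm (fun s => G y s (U s)) M (fun s => hM _ _ _) θ)

lemma mgPsi_apply (y : Y) (U : ℝ →ᵇ ℝ × ℝ) (θ : ℝ) : mgPsi G M hM hc ε y U θ =
    ε • ∫ t in (0:ℝ)..(2 * Real.pi), G y (θ - t) (U (θ - t)) • mgK t := rfl

lemma mgPsi_dist (y y' : Y) (U U' : ℝ →ᵇ ℝ × ℝ) (C : ℝ) (hC0 : 0 ≤ C)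
    (hC : ∀ s, |G y s (U s) - G y' s (U' s)| ≤ C) :
    dist (mgPsi G M hM hc ε y U) (mgPsi G M hM hc ε y' U') ≤ |ε| * (C * (2 * Real.pi)) := by
  rw [BoundedContinuousFunction.dist_le (by positivity)]
  intro θ
  rw [dist_eq_norm, mgPsi_apply, mgPsi_apply, ← smul_sub, norm_smul, Real.norm_eq_abs]
  gcongr
  have hi : ∀ (y : Y) (U : ℝ →ᵇ ℝ × ℝ), IntervalIntegrable
      (fun t => G y (θ - t) (U (θ - t)) • mgK t) MeasureTheory.volume 0 (2 * Real.pi) := by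
    intro y U
    apply Continuous.intervalIntegrable
    have h0 : Continuous (fun t : ℝ => G y (θ - t) (U (θ - t))) :=
      (hc y).comp (f := fun t : ℝ => (θ - t, U (θ - t))) (by fun_prop)
    exact h0.smul mgK_continuous
  rw [← intervalIntegral.integral_sub (hi _ _) (hi _ _)]
  simp_rw [← sub_smul]
  exact mg_conv_norm (fun s => G y s (U s) - G y' s (U' s)) C hC θ
end

lemma mg_LS {Y : Type*} [MetricSpace Y] (G : Y → ℝ → ℝ × ℝ → ℝ) (M : ℝ)
    (hM : ∀ y θ w, |G y θ w| ≤ M) (hc : ∀ y, Continuous (Function.uncurry (G y))) (ε : ℝ)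
    (L : ℝ) (hL : 0 ≤ L)
    (hLw : ∀ y θ w w', |G y θ w - G y θ w'| ≤ L * dist w w')
    (hLy : ∀ y y' θ w, |G y θ w - G y' θ w| ≤ L * dist y y')
    (hε : |ε| * (L * (2 * Real.pi)) ≤ 1 / 2) :
    ∃ U : Y → (ℝ →ᵇ ℝ × ℝ),
      (∀ y θ, U y θ = ε • ∫ t in (0:ℝ)..(2 * Real.pi), G y (θ - t) (U y (θ - t)) • mgK t) ∧
      (∀ y (V : ℝ →ᵇ ℝ × ℝ), (∀ θ, V θ =
        ε • ∫ t in (0:ℝ)..(2 * Real.pi), G y (θ - t) (V (θ - t)) • mgK t) → V = U y) ∧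
      Continuous U := by
  have hcon : ∀ y, ContractingWith (1 / 2) (mgPsi G M hM hc ε y) := by
    intro y
    refine ⟨by norm_num, LipschitzWith.of_dist_le_mul ?_⟩
    intro U V
    refine (mgPsi_dist G M hM hc ε y y U V (L * dist U V) (by positivity) ?_).trans ?_
    · intro s
      refine (hLw _ _ _ _).trans ?_
      gcongr
      exact BoundedContinuousFunction.dist_coe_le_dist s
    · push_cast
      calc _ = (|ε| * (L * (2 * Real.pi))) * dist U V := by ring
        _ ≤ _ := by gcongr
  refine ⟨fun y => ContractingWith.fixedPoint _ (hcon y), ?_, ?_, ?_⟩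
  · intro y θ
    have := (hcon y).fixedPoint_isFixedPt
    exact (congrArg (fun V : ℝ →ᵇ ℝ × ℝ => V θ) this.eq).symm
  · intro y V hV
    apply (hcon y).fixedPoint_unique
    ext1 θ
    rw [mgPsi_apply, ← hV]
  · refine (LipschitzWith.of_dist_le_mul (K := 1) ?_).continuous
    intro y y'
    refine ((hcon y).fixedPoint_lipschitz_in_map (hcon y') (C := 1 / 2 * dist y y') ?_).trans ?_
    · intro z
      refine (mgPsi_dist G M hM hc ε y y' z z (L * dist y y') (by positivity) ?_).trans ?_
      · intro s
        exact hLy _ _ _ _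
      · calc _ = (|ε| * (L * (2 * Real.pi))) * dist y y' := by ring
          _ ≤ _ := by gcongr
    · push_cast
      apply le_of_eq; ring

lemma mg_deriv (g : ℝ → ℝ) (hg : Continuous g) (hp : Function.Periodic g (2 * Real.pi))
    (hC : ∫ t in (0:ℝ)..(2 * Real.pi), Real.cos t * g t = 0)
    (hS : ∫ t in (0:ℝ)..(2 * Real.pi), Real.sin t * g t = 0) (ε : ℝ) (U : ℝ → ℝ × ℝ)
    (hU : ∀ θ, U θ = ε • ∫ t in (0:ℝ)..(2 * Real.pi), g (θ - t) • mgK t) (θ : ℝ) :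
    HasDerivAt (fun θ => (U θ).1) (U θ).2 θ ∧
    HasDerivAt (fun θ => (U θ).2) (-(U θ).1 + ε * g θ) θ := by
  have hpi := Real.pi_pos
  -- moving-window integrals
  have win : ∀ q : ℝ → ℝ, Continuous q → ∀ θ,
      HasDerivAt (fun θ => ∫ s in (θ - 2 * Real.pi)..θ, q s) (q θ - q (θ - 2 * Real.pi)) θ := by
    intro q hq θ
    have h1 : HasDerivAt (fun θ => ∫ s in (0:ℝ)..θ, q s) (q θ) θ :=
      hq.integral_hasStrictDerivAt 0 θ |>.hasDerivAt
    have h2 : HasDerivAt (fun θ => ∫ s in (0:ℝ)..(θ - 2 * Real.pi), q s)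
        (q (θ - 2 * Real.pi)) θ := by
      have := (hq.integral_hasStrictDerivAt 0 (θ - 2 * Real.pi)).hasDerivAt
      exact this.comp_sub_const θ (2 * Real.pi)
    convert! h1.sub h2 using 1
    ext x
    simp only [Pi.sub_apply]
    rw [intervalIntegral.integral_interval_sub_left] <;> exact hq.intervalIntegrable _ _
  have hper : ∀ x, g (x - 2 * Real.pi) = g x := fun x => hp.sub_eq x
  have wc : ∀ θ, ∫ s in (θ - 2 * Real.pi)..θ, Real.cos s * g s = 0 := by
    intro θ
    have hq : Function.Periodic (fun s => Real.cos s * g s) (2 * Real.pi) := by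
      intro s; simp [hp s]
    have := hq.intervalIntegral_add_eq (θ - 2 * Real.pi) 0
    rw [sub_add_cancel, zero_add, hC] at this
    exact this
  have ws : ∀ θ, ∫ s in (θ - 2 * Real.pi)..θ, Real.sin s * g s = 0 := by
    intro θ
    have hq : Function.Periodic (fun s => Real.sin s * g s) (2 * Real.pi) := by
      intro s; simp [hp s]
    have := hq.intervalIntegral_add_eq (θ - 2 * Real.pi) 0
    rw [sub_add_cancel, zero_add, hS] at this
    exact this
  set C1 : ℝ → ℝ := fun θ => ∫ s in (θ - 2 * Real.pi)..θ, s * Real.cos s * g s with hC1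
  set S1 : ℝ → ℝ := fun θ => ∫ s in (θ - 2 * Real.pi)..θ, s * Real.sin s * g s with hS1
  have dC1 : ∀ θ, HasDerivAt C1 (2 * Real.pi * Real.cos θ * g θ) θ := by
    intro θ
    convert win (fun s => s * Real.cos s * g s) (by fun_prop) θ using 1
    simp only [Real.cos_sub_two_pi, hper]; ring
  have dS1 : ∀ θ, HasDerivAt S1 (2 * Real.pi * Real.sin θ * g θ) θ := by
    intro θ
    convert win (fun s => s * Real.sin s * g s) (by fun_prop) θ using 1
    simp only [Real.sin_sub_two_pi, hper]; ring
  have i1 : ∀ a b, IntervalIntegrable (fun s => Real.cos s * g s) MeasureTheory.volume a b :=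
    fun a b => Continuous.intervalIntegrable (by fun_prop) a b
  have i2 : ∀ a b, IntervalIntegrable (fun s => Real.sin s * g s) MeasureTheory.volume a b :=
    fun a b => Continuous.intervalIntegrable (by fun_prop) a b
  have i3 : ∀ a b, IntervalIntegrable (fun s => s * Real.cos s * g s) MeasureTheory.volume a b :=
    fun a b => Continuous.intervalIntegrable (by fun_prop) a b
  have i4 : ∀ a b, IntervalIntegrable (fun s => s * Real.sin s * g s) MeasureTheory.volume a b :=
    fun a b => Continuous.intervalIntegrable (by fun_prop) a b
  have lin : ∀ (θ a b c d : ℝ), ∫ s in (θ - 2 * Real.pi)..θ, (a * (Real.cos s * g s) +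
      b * (Real.sin s * g s) + c * (s * Real.cos s * g s) + d * (s * Real.sin s * g s)) =
      c * C1 θ + d * S1 θ := by
    intro θ a b c d
    rw [intervalIntegral.integral_add
        ((((i1 _ _).const_mul a).add ((i2 _ _).const_mul b)).add ((i3 _ _).const_mul c))
        ((i4 _ _).const_mul d),
      intervalIntegral.integral_add
        (((i1 _ _).const_mul a).add ((i2 _ _).const_mul b)) ((i3 _ _).const_mul c),
      intervalIntegral.integral_add ((i1 _ _).const_mul a) ((i2 _ _).const_mul b)]
    simp only [intervalIntegral.integral_const_mul, wc, ws, hC1, hS1]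
    ring
  have hIntg : ∀ θ, IntervalIntegrable (fun t => g (θ - t) • mgK t)
      MeasureTheory.volume 0 (2 * Real.pi) := by
    intro θ
    have := mgK_continuous
    exact Continuous.intervalIntegrable (by fun_prop) _ _
  have e1 : ∀ θ, (U θ).1 = ε / (2 * Real.pi) * (Real.sin θ * C1 θ - Real.cos θ * S1 θ) := by
    intro θ
    have h1 := (ContinuousLinearMap.fst ℝ ℝ ℝ).intervalIntegral_comp_comm (hIntg θ)
    have h2 := intervalIntegral.integral_comp_sub_left (a := 0) (b := 2 * Real.pi)
      (fun s => g s * ((Real.pi - (θ - s)) * Real.sin (θ - s) / (2 * Real.pi))) θ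
    have h3 := lin θ ((Real.pi - θ) * Real.sin θ / (2 * Real.pi))
      (-(Real.pi - θ) * Real.cos θ / (2 * Real.pi)) (Real.sin θ / (2 * Real.pi))
      (-Real.cos θ / (2 * Real.pi))
    simp only [sub_sub_cancel, sub_zero] at h2
    rw [hU, Prod.smul_fst, smul_eq_mul]
    simp only [ContinuousLinearMap.coe_fst', Prod.smul_fst, mgK, smul_eq_mul] at h1
    rw [show (∫ t in (0:ℝ)..(2 * Real.pi), g (θ - t) • mgK t).1 = _ from h1.symm, h2]
    trans ε * (Real.sin θ / (2 * Real.pi) * C1 θ + -Real.cos θ / (2 * Real.pi) * S1 θ)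
    · rw [← h3]
      congr 2
      ext s
      rw [Real.sin_sub]
      ring
    · ring
  have e2 : ∀ θ, (U θ).2 = ε / (2 * Real.pi) * (Real.cos θ * C1 θ + Real.sin θ * S1 θ) := by
    intro θ
    have h1 := (ContinuousLinearMap.snd ℝ ℝ ℝ).intervalIntegral_comp_comm (hIntg θ)
    have h2 := intervalIntegral.integral_comp_sub_left (a := 0) (b := 2 * Real.pi)
      (fun s => g s * (((Real.pi - (θ - s)) * Real.cos (θ - s) - Real.sin (θ - s))
        / (2 * Real.pi))) θ
    have h3 := lin θ (((Real.pi - θ) * Real.cos θ - Real.sin θ) / (2 * Real.pi))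
      (((Real.pi - θ) * Real.sin θ + Real.cos θ) / (2 * Real.pi)) (Real.cos θ / (2 * Real.pi))
      (Real.sin θ / (2 * Real.pi))
    simp only [sub_sub_cancel, sub_zero] at h2
    rw [hU, Prod.smul_snd, smul_eq_mul]
    simp only [ContinuousLinearMap.coe_snd', Prod.smul_snd, mgK, smul_eq_mul] at h1
    rw [show (∫ t in (0:ℝ)..(2 * Real.pi), g (θ - t) • mgK t).2 = _ from h1.symm, h2]
    trans ε * (Real.cos θ / (2 * Real.pi) * C1 θ + Real.sin θ / (2 * Real.pi) * S1 θ)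
    · rw [← h3]
      congr 2
      ext s
      rw [Real.sin_sub, Real.cos_sub]
      ring
    · ring
  constructor
  · rw [funext e1, e2]
    convert! (((Real.hasDerivAt_sin θ).mul (dC1 θ)).sub
      ((Real.hasDerivAt_cos θ).mul (dS1 θ))).const_mul (ε / (2 * Real.pi)) using 1
    ring
  · rw [funext e2, e1]
    convert! (((Real.hasDerivAt_cos θ).mul (dC1 θ)).add
      ((Real.hasDerivAt_sin θ).mul (dS1 θ))).const_mul (ε / (2 * Real.pi)) using 1
    have := Real.sin_sq_add_cos_sq θ
    field_simp
    linear_combination (-2 * ε * Real.pi * g θ) * this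

structure MgFrame (e1 e2 e3 : EuclideanSpace ℝ (Fin 3)) : Prop where
  n1 : ‖e1‖ = 1
  n2 : ‖e2‖ = 1
  n3 : ‖e3‖ = 1
  i12 : ⟪e1, e2⟫ = 0
  i23 : ⟪e2, e3⟫ = 0
  i13 : ⟪e1, e3⟫ = 0
  c12 : cross3 e1 e2 = e3
  c23 : cross3 e2 e3 = e1
  c31 : cross3 e3 e1 = e2

lemma MgFrame.norm_sq {e1 e2 e3 : EuclideanSpace ℝ (Fin 3)} (h : MgFrame e1 e2 e3) (a b c : ℝ) :
    ‖a • e1 + b • e2 + c • e3‖ ^ 2 = a ^ 2 + b ^ 2 + c ^ 2 := by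
  have h1 := h.i12
  have h2 := h.i13
  have h3 := h.i23
  have h1' : ⟪e2, e1⟫ = 0 := by rw [real_inner_comm]; exact h1
  have h2' : ⟪e3, e1⟫ = 0 := by rw [real_inner_comm]; exact h2
  have h3' : ⟪e3, e2⟫ = 0 := by rw [real_inner_comm]; exact h3
  rw [← real_inner_self_eq_norm_sq]
  simp only [inner_add_left, inner_add_right, inner_smul_left, inner_smul_right, h1, h2, h3, h1',
    h2', h3', real_inner_self_eq_norm_sq, h.n1, h.n2, h.n3]
  simp
  ring

lemma MgFrame.cross {e1 e2 e3 : EuclideanSpace ℝ (Fin 3)} (h : MgFrame e1 e2 e3)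
    (a b c a' b' c' : ℝ) :
    cross3 (a • e1 + b • e2 + c • e3) (a' • e1 + b' • e2 + c' • e3) =
      (b * c' - c * b') • e1 + (c * a' - a * c') • e2 + (a * b' - b * a') • e3 := by
  have key : cross3 (a • e1 + b • e2 + c • e3) (a' • e1 + b' • e2 + c' • e3) =
      (b * c' - c * b') • cross3 e2 e3 + (c * a' - a * c') • cross3 e3 e1
        + (a * b' - b * a') • cross3 e1 e2 := by
    ext i
    fin_cases i <;> simp [cross3] <;> ring
  rw [key, h.c12, h.c23, h.c31]

lemma mg_smooth (f : EuclideanSpace ℝ (Fin 3) → ℝ) (hf : ContDiff ℝ (⊤ : ℕ∞) f)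
    (γ η : ℝ → EuclideanSpace ℝ (Fin 3)) (h1 : ∀ s, HasDerivAt γ (η s) s)
    (h2 : ∀ s, HasDerivAt η ((-(‖η s‖ ^ 2)) • γ s + f (γ s) • cross3 (γ s) (η s)) s) :
    ContDiff ℝ (⊤ : ℕ∞) γ := by
  have key : ∀ n : ℕ, ContDiff ℝ n γ ∧ ContDiff ℝ n η := by
    intro n
    induction n with
    | zero =>
      constructor
      · exact contDiff_zero.2 (continuous_iff_continuousAt.2 fun s => (h1 s).continuousAt)
      · exact contDiff_zero.2 (continuous_iff_continuousAt.2 fun s => (h2 s).continuousAt)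
    | succ n ih =>
      obtain ⟨i1, i2⟩ := ih
      have hfn : ContDiff ℝ n f := hf.of_le (by exact_mod_cast le_top)
      constructor
      · push_cast
        rw [contDiff_succ_iff_deriv]
        refine ⟨fun s => (h1 s).differentiableAt, by simp, ?_⟩
        rwa [show deriv γ = η from funext fun s => (h1 s).deriv]
      · push_cast
        rw [contDiff_succ_iff_deriv]
        refine ⟨fun s => (h2 s).differentiableAt, by simp, ?_⟩
        rw [show deriv η = _ from funext fun s => (h2 s).deriv]
        have c1 : ∀ i, ContDiff ℝ n (fun s => γ s i) := fun i => by fun_prop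
        have c2 : ∀ i, ContDiff ℝ n (fun s => η s i) := fun i => by fun_prop
        have hc : ContDiff ℝ n (fun s => cross3 (γ s) (η s)) := by
          unfold cross3
          refine (EuclideanSpace.equiv (Fin 3) ℝ).symm.contDiff.comp ?_
          rw [contDiff_pi]
          intro i
          fin_cases i <;> simp <;> fun_prop
        have hn : ContDiff ℝ n (fun s => ‖η s‖ ^ 2) := i2.norm_sq ℝ
        exact (hn.neg.smul i1).add ((hfn.comp i1).smul hc)
  rw [contDiff_infty]
  exact fun n => (key n).1

lemma mg_scalar (u p X X1 v w : ℝ → ℝ) (θ δ h κ : ℝ)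
    (hv0 : ∀ θ, 0 < v θ) (hw0 : ∀ θ, 0 < w θ)
    (hv2 : ∀ θ, v θ ^ 2 = 1 + u θ ^ 2) (hw2 : ∀ θ, w θ ^ 2 = 1 + u θ ^ 2 + p θ ^ 2)
    (hv : HasDerivAt v (u θ * p θ / v θ) θ) (hw : HasDerivAt w (p θ * h / w θ) θ)
    (hu : HasDerivAt u (p θ) θ) (hp : HasDerivAt p (- u θ + h) θ)
    (hX : HasDerivAt X (X1 θ) θ) (hX1 : HasDerivAt X1 (- X θ + δ * h) θ)
    (hh : h = κ * (w θ / v θ) ^ 3) :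
    HasDerivAt (fun θ => X θ / v θ)
      (w θ / v θ ^ 2 * ((v θ ^ 2 * X1 θ - u θ * p θ * X θ) / (v θ * w θ))) θ ∧
    HasDerivAt (fun θ => (v θ ^ 2 * X1 θ - u θ * p θ * X θ) / (v θ * w θ))
      (w θ / v θ ^ 2 * (- (X θ / v θ) +
        κ * ((δ * w θ ^ 2 - u θ * X θ - p θ * X1 θ) / w θ))) θ := by
  have hv' := (hv0 θ).ne'
  have hw' := (hw0 θ).ne'
  have a := hv2 θ
  have b := hw2 θ
  constructor
  · convert! hX.div hv hv' using 1
    field_simp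
  · convert! (((hv.pow 2).mul hX1).sub ((hu.mul hp).mul hX)).div (hv.mul hw)
      (mul_ne_zero hv' hw') using 1
    have hκ : κ = h * v θ ^ 3 / w θ ^ 3 := by rw [hh]; field_simp
    rw [hκ]
    simp only [Pi.mul_apply, Pi.pow_apply, Pi.sub_apply]
    clear hκ hh
    generalize v θ = v at *
    generalize w θ = w at *
    generalize u θ = u at *
    generalize p θ = p at *
    field_simp

    simp

    grind


lemma mg_reparam (ρ : ℝ → ℝ) (hρ : Continuous ρ) (m : ℝ) (hm : 0 < m) (hlow : ∀ θ, m ≤ ρ θ)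
    (hper : Function.Periodic ρ (2 * Real.pi)) :
    ∃ (T : ℝ) (Φ : ℝ → ℝ), 0 < T ∧ (∀ s, HasDerivAt Φ (ρ (Φ s))⁻¹ s) ∧
      ∀ s, Φ (s + T) = Φ s + 2 * Real.pi := by
  set S : ℝ → ℝ := fun θ => ∫ t in (0:ℝ)..θ, ρ t with hS
  have hd : ∀ θ, HasDerivAt S (ρ θ) θ := fun θ => (hρ.integral_hasStrictDerivAt 0 θ).hasDerivAt
  have hpos : ∀ θ, 0 < ρ θ := fun θ => hm.trans_le (hlow θ)
  have hmono : StrictMono S := strictMono_of_hasDerivAt_pos hd hpos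
  have hcont : Continuous S := continuous_iff_continuousAt.2 fun θ => (hd θ).continuousAt
  have hmono2 : Monotone (fun θ => S θ - m * θ) := by
    have hd2 : ∀ θ, HasDerivAt (fun θ => S θ - m * θ) (ρ θ - m * 1) θ := fun θ =>
      (hd θ).sub ((hasDerivAt_id θ).const_mul m)
    apply monotone_of_deriv_nonneg (fun θ => (hd2 θ).differentiableAt)
    intro θ
    rw [(hd2 θ).deriv]
    linarith [hlow θ]
  have hS0 : S 0 = 0 := by simp [hS]
  have htop : Filter.Tendsto S Filter.atTop Filter.atTop := by
    refine Filter.tendsto_atTop_mono' _ ?_ (Filter.tendsto_id.const_mul_atTop hm)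
    filter_upwards [Filter.eventually_ge_atTop 0] with θ hθ
    have := hmono2 hθ
    simp only [hS0] at this
    simp only [id]
    linarith
  have hbot : Filter.Tendsto S Filter.atBot Filter.atBot := by
    refine Filter.tendsto_atBot_mono' _ ?_ (Filter.tendsto_id.const_mul_atBot hm)
    filter_upwards [Filter.eventually_le_atBot 0] with θ hθ
    have := hmono2 hθ
    simp only [hS0] at this
    simp only [id]
    linarith
  have hsurj : Function.Surjective S := hcont.surjective htop hbot
  let e := hmono.orderIsoOfSurjective S hsurj
  have he : ∀ s, S (e.symm s) = s := fun s => e.apply_symm_apply s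
  refine ⟨S (2 * Real.pi), fun s => e.symm s, ?_, ?_, ?_⟩
  · rw [← hS0]; exact hmono (by positivity)
  · intro s
    apply HasDerivAt.of_local_left_inverse (f := S)
    · exact e.symm.continuous.continuousAt
    · exact hd _
    · exact (hpos _).ne'
    · exact Filter.Eventually.of_forall he
  · intro s
    apply hmono.injective
    simp only
    rw [he]
    have h1 : S (e.symm s + 2 * Real.pi) = S (e.symm s) + S (2 * Real.pi) := by
      simp only [hS]
      have h2 := hper.intervalIntegral_add_eq (e.symm s) 0
      rw [zero_add] at h2
      rw [← h2, intervalIntegral.integral_add_adjacent_intervals] <;>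
        exact hρ.intervalIntegrable _ _
    rw [h1, he]

lemma mg_geom (f : EuclideanSpace ℝ (Fin 3) → ℝ) (hf : ContDiff ℝ (⊤ : ℕ∞) f)
    (e1 e2 e3 : EuclideanSpace ℝ (Fin 3)) (hF : MgFrame e1 e2 e3) (ε k : ℝ) (hε : 0 < ε)
    (hk : ε ^ 2 * (2 * k) = 1) (u p : ℝ → ℝ) (hu : ∀ θ, HasDerivAt u (p θ) θ)
    (hp : ∀ θ, HasDerivAt p (- u θ + ε *
      (f ((√(1 + u θ ^ 2))⁻¹ • (Real.cos θ • e1 + Real.sin θ • e2 + u θ • e3)) *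
        (√(1 + u θ ^ 2 + p θ ^ 2) / √(1 + u θ ^ 2)) ^ 3)) θ)
    (hub : ∀ θ, |u θ| ≤ 1)
    (pu : Function.Periodic u (2 * Real.pi)) (pp : Function.Periodic p (2 * Real.pi)) :
    ∃ T : ℝ, 0 < T ∧
      ∃ γ : ℝ → EuclideanSpace ℝ (Fin 3),
        ContDiff ℝ (⊤ : ℕ∞) γ ∧ Function.Periodic γ T ∧
        (∃ s₁ s₂ : ℝ, γ s₁ ≠ γ s₂) ∧
        ∀ s : ℝ,
          ‖γ s‖ = 1 ∧
          deriv (deriv γ) s =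
            (-(‖deriv γ s‖ ^ 2)) • γ s + f (γ s) • cross3 (γ s) (deriv γ s) ∧
          (1 / 2) * ‖deriv γ s‖ ^ 2 = k := by
  set v : ℝ → ℝ := fun θ => √(1 + u θ ^ 2) with hvdef
  set w : ℝ → ℝ := fun θ => √(1 + u θ ^ 2 + p θ ^ 2) with hwdef
  have hv0 : ∀ θ, 0 < v θ := fun θ => Real.sqrt_pos.2 (by positivity)
  have hw0 : ∀ θ, 0 < w θ := fun θ => Real.sqrt_pos.2 (by positivity)
  have hv2 : ∀ θ, v θ ^ 2 = 1 + u θ ^ 2 := fun θ => Real.sq_sqrt (by positivity)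
  have hw2 : ∀ θ, w θ ^ 2 = 1 + u θ ^ 2 + p θ ^ 2 := fun θ => Real.sq_sqrt (by positivity)
  set c : ℝ → EuclideanSpace ℝ (Fin 3) := fun θ =>
    (v θ)⁻¹ • (Real.cos θ • e1 + Real.sin θ • e2 + u θ • e3) with hcdef
  set h : ℝ → ℝ := fun θ => ε * (f (c θ) * (w θ / v θ) ^ 3) with hhdef
  replace hp : ∀ θ, HasDerivAt p (- u θ + h θ) θ := hp
  have hv : ∀ θ, HasDerivAt v (u θ * p θ / v θ) θ := by
    intro θ
    have := (((hu θ).pow 2).const_add 1).sqrt (by simp only [Pi.pow_apply]; positivity)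
    convert! this using 1
    simp only [hvdef, Pi.pow_apply]
    field_simp
    simp
    ring
  have hw : ∀ θ, HasDerivAt w (p θ * h θ / w θ) θ := by
    intro θ
    have := ((((hu θ).pow 2).const_add 1).add ((hp θ).pow 2)).sqrt
      (by simp only [Pi.pow_apply, Pi.add_apply]; positivity)
    convert! this using 1
    simp only [hwdef, Pi.pow_apply, Pi.add_apply]
    field_simp
    simp
    ring
  have sc := fun (X X1 : ℝ → ℝ) (δ θ : ℝ) (hX : HasDerivAt X (X1 θ) θ)
    (hX1 : HasDerivAt X1 (- X θ + δ * h θ) θ) =>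
    mg_scalar u p X X1 v w θ δ (h θ) (ε * f (c θ)) hv0 hw0 hv2 hw2 (hv θ) (hw θ) (hu θ) (hp θ)
      hX hX1 (by simp only [hhdef]; ring)
  have s1 := fun θ => sc Real.cos (fun θ => - Real.sin θ) 0 θ (Real.hasDerivAt_cos θ)
    (by rw [zero_mul, add_zero]; exact (Real.hasDerivAt_sin θ).neg)
  have s2 := fun θ => sc Real.sin Real.cos 0 θ (Real.hasDerivAt_sin θ)
    (by simpa using (Real.hasDerivAt_cos θ))
  have s3 := fun θ => sc u p 1 θ (hu θ) (by simpa using hp θ)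
  clear sc
  have hcs : ∀ θ, c θ = (Real.cos θ / v θ) • e1 + (Real.sin θ / v θ) • e2 + (u θ / v θ) • e3 := by
    intro θ
    simp only [hcdef, smul_add, smul_smul]
    simp only [div_eq_inv_mul]
  set τ1 : ℝ → ℝ := fun θ => (v θ ^ 2 * (- Real.sin θ) - u θ * p θ * Real.cos θ) / (v θ * w θ)
    with hτ1
  set τ2 : ℝ → ℝ := fun θ => (v θ ^ 2 * Real.cos θ - u θ * p θ * Real.sin θ) / (v θ * w θ)
    with hτ2
  set τ3 : ℝ → ℝ := fun θ => (v θ ^ 2 * p θ - u θ * p θ * u θ) / (v θ * w θ) with hτ3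
  set τ : ℝ → EuclideanSpace ℝ (Fin 3) := fun θ => τ1 θ • e1 + τ2 θ • e2 + τ3 θ • e3 with hτ
  have hρ0 : ∀ θ, w θ / v θ ^ 2 ≠ 0 := fun θ => (div_pos (hw0 θ) (pow_pos (hv0 θ) 2)).ne'
  have dc : ∀ θ, HasDerivAt c ((w θ / v θ ^ 2) • τ θ) θ := by
    intro θ
    rw [funext hcs]
    convert! (((s1 θ).1.smul_const e1).add ((s2 θ).1.smul_const e2)).add
      ((s3 θ).1.smul_const e3) using 1
    simp only [hτ, smul_add, smul_smul, hτ1, hτ2, hτ3]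
  have hcn : ∀ θ, ‖c θ‖ ^ 2 = 1 := by
    intro θ
    rw [hcs, hF.norm_sq]
    have := hv2 θ
    have := (hv0 θ).ne'
    have := Real.sin_sq_add_cos_sq θ
    field_simp
    linarith
  have hτn : ∀ θ, ‖τ θ‖ ^ 2 = 1 := by
    intro θ
    simp only [hτ]
    rw [hF.norm_sq]
    simp only [hτ1, hτ2, hτ3]
    have h1 := hv2 θ
    have h2 := hw2 θ
    have h3 := (hv0 θ).ne'
    have h4 := (hw0 θ).ne'
    have h5 := Real.sin_sq_add_cos_sq θ
    field_simp
    generalize Real.sin θ = sn at *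
    generalize Real.cos θ = cn at *
    generalize v θ = v at *
    generalize w θ = w at *
    generalize u θ = u at *
    generalize p θ = p at *
    clear * - h1 h2 h5
    grind
  have hcross : ∀ θ, cross3 (c θ) (τ θ) =
      ((0 * w θ ^ 2 - u θ * Real.cos θ - p θ * (-Real.sin θ)) / w θ) • e1 +
      ((0 * w θ ^ 2 - u θ * Real.sin θ - p θ * Real.cos θ) / w θ) • e2 +
      ((1 * w θ ^ 2 - u θ * u θ - p θ * p θ) / w θ) • e3 := by
    intro θ
    rw [hcs]
    simp only [hτ]
    rw [hF.cross]
    simp only [hτ1, hτ2, hτ3]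
    have h1 := hv2 θ
    have h2 := hw2 θ
    have h3 := (hv0 θ).ne'
    have h4 := (hw0 θ).ne'
    have h5 := Real.sin_sq_add_cos_sq θ
    congr 3
    · field_simp
      ring
    · field_simp
      ring
    · field_simp
      linear_combination (v θ ^ 2) * h5 - (v θ ^ 2) * h2
  have dτ : ∀ θ, HasDerivAt τ
      ((w θ / v θ ^ 2) • (- c θ + (ε * f (c θ)) • cross3 (c θ) (τ θ))) θ := by
    intro θ
    convert! (((s1 θ).2.smul_const e1).add ((s2 θ).2.smul_const e2)).add
      ((s3 θ).2.smul_const e3) using 1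
    rw [hcross]
    generalize f (c θ) = q
    rw [hcs θ]
    module
  have cv : Continuous v := continuous_iff_continuousAt.2 fun θ => (hv θ).continuousAt
  have cw : Continuous w := continuous_iff_continuousAt.2 fun θ => (hw θ).continuousAt
  have pv : Function.Periodic v (2 * Real.pi) := fun θ => by simp only [hvdef, pu θ]
  have pw : Function.Periodic w (2 * Real.pi) := fun θ => by simp only [hwdef, pu θ, pp θ]
  obtain ⟨T, Φ, hT, hΦ, hΦT⟩ := mg_reparam (fun θ => ε * (w θ / v θ ^ 2))
    (by
      have : ∀ θ, v θ ^ 2 ≠ 0 := fun θ => (pow_pos (hv0 θ) 2).ne'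
      fun_prop (disch := assumption))
    (ε / 2) (by positivity)
    (by
      intro θ
      have h1 := hv2 θ
      have h2 := hw2 θ
      have h3 : u θ ^ 2 ≤ 1 := by
        have := hub θ
        rw [← sq_abs]
        nlinarith [abs_nonneg (u θ)]
      have h4 : 1 ≤ w θ := by nlinarith [hw0 θ, sq_nonneg (u θ), sq_nonneg (p θ)]
      have h5 : 1 / 2 ≤ w θ / v θ ^ 2 := by
        rw [h1, div_le_div_iff₀ (by norm_num) (by positivity)]
        linarith
      calc ε / 2 = ε * (1 / 2) := by ring
        _ ≤ _ := by gcongr)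
    (fun θ => by simp only [pv θ, pw θ])
  have hεne := hε.ne'
  set γ : ℝ → EuclideanSpace ℝ (Fin 3) := fun s => c (Φ s) with hγ
  set η : ℝ → EuclideanSpace ℝ (Fin 3) := fun s => ε⁻¹ • τ (Φ s) with hη
  have hηn : ∀ s, ‖η s‖ ^ 2 = 2 * k := by
    intro s
    simp only [hη, norm_smul, mul_pow, hτn, norm_inv, Real.norm_eq_abs, inv_pow, sq_abs]
    field_simp
    linarith
  have d1 : ∀ s, HasDerivAt γ (η s) s := by
    intro s
    have := (dc (Φ s)).scomp s (hΦ s)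
    convert! this using 1
    simp only [hη, smul_smul]
    congr 1
    have := hρ0 (Φ s)
    rw [mul_inv, mul_assoc, inv_mul_cancel₀ this, mul_one]
  have cross_smul : ∀ (r : ℝ) (a b : EuclideanSpace ℝ (Fin 3)),
      cross3 a (r • b) = r • cross3 a b := by
    intro r a b
    ext i
    fin_cases i <;> simp [cross3] <;> ring
  have d2 : ∀ s, HasDerivAt η ((-(‖η s‖ ^ 2)) • γ s + f (γ s) • cross3 (γ s) (η s)) s := by
    intro s
    have := ((dτ (Φ s)).scomp s (hΦ s)).const_smul ε⁻¹
    convert! this using 1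
    rw [hηn]
    simp only [hγ, hη, cross_smul]
    have h1 := hρ0 (Φ s)
    have h2 : 2 * k = ε⁻¹ * ε⁻¹ := by
      field_simp
      linarith
    rw [smul_smul (ε * _)⁻¹, mul_inv, mul_assoc, inv_mul_cancel₀ h1, mul_one, h2]
    simp only [smul_add, smul_smul]
    congr 1
    · module
    · congr 1
      field_simp
  have eγ : deriv γ = η := funext fun s => (d1 s).deriv
  have eη : deriv η = _ := funext fun s => (d2 s).deriv
  have hk0 : 0 < k := by
    by_contra hcon
    nlinarith [sq_nonneg ε]
  refine ⟨T, hT, γ, mg_smooth f hf γ η d1 d2, ?_, ?_, ?_⟩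
  · intro s
    simp only [hγ, hΦT, hcdef, Real.cos_add_two_pi, Real.sin_add_two_pi, pu (Φ s), pv (Φ s)]
  · by_contra hcon
    push Not at hcon
    have h1 : HasDerivAt γ 0 0 := by
      rw [show γ = fun _ => γ 0 from funext fun s => hcon s 0]
      exact hasDerivAt_const _ _
    have h2 := h1.unique (d1 0)
    have h3 := hηn 0
    rw [← h2] at h3
    simp at h3
    linarith
  · intro s
    rw [eγ, eη]
    refine ⟨?_, rfl, ?_⟩
    · have := hcn (Φ s)
      exact (pow_eq_one_iff_of_nonneg (norm_nonneg _) two_ne_zero).1 this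
    · rw [hηn]; ring


noncomputable def mgN1 (x y : ℝ) : EuclideanSpace ℝ (Fin 3) :=
  !₂[1 - 2 * x ^ 2 / (1 + x ^ 2 + y ^ 2), -2 * x * y / (1 + x ^ 2 + y ^ 2),
    -2 * x / (1 + x ^ 2 + y ^ 2)]
noncomputable def mgN2 (x y : ℝ) : EuclideanSpace ℝ (Fin 3) :=
  !₂[-2 * x * y / (1 + x ^ 2 + y ^ 2), 1 - 2 * y ^ 2 / (1 + x ^ 2 + y ^ 2),
    -2 * y / (1 + x ^ 2 + y ^ 2)]
noncomputable def mgN3 (x y : ℝ) : EuclideanSpace ℝ (Fin 3) :=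
  !₂[2 * x / (1 + x ^ 2 + y ^ 2), 2 * y / (1 + x ^ 2 + y ^ 2),
    (1 - x ^ 2 - y ^ 2) / (1 + x ^ 2 + y ^ 2)]
/-- half-turn about the first axis -/
noncomputable def mgFlip (a : EuclideanSpace ℝ (Fin 3)) : EuclideanSpace ℝ (Fin 3) :=
  !₂[a 0, - a 1, - a 2]

lemma mgFrame_N (x y : ℝ) : MgFrame (mgN1 x y) (mgN2 x y) (mgN3 x y) := by
  have hD : (1 + x ^ 2 + y ^ 2) ≠ 0 := by positivity
  constructor
  · rw [EuclideanSpace.norm_eq, Real.sqrt_eq_one]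
    simp [Fin.sum_univ_three, mgN1]; field_simp; ring
  · rw [EuclideanSpace.norm_eq, Real.sqrt_eq_one]
    simp [Fin.sum_univ_three, mgN2]; field_simp; ring
  · rw [EuclideanSpace.norm_eq, Real.sqrt_eq_one]
    simp [Fin.sum_univ_three, mgN3]; field_simp; ring
  · rw [PiLp.inner_apply]; simp [Fin.sum_univ_three, mgN1, mgN2]; field_simp; ring
  · rw [PiLp.inner_apply]; simp [Fin.sum_univ_three, mgN2, mgN3]; field_simp; ring
  · rw [PiLp.inner_apply]; simp [Fin.sum_univ_three, mgN1, mgN3]; field_simp; ring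
  · ext i; fin_cases i <;> simp [cross3, mgN1, mgN2, mgN3] <;> field_simp <;> ring
  · ext i; fin_cases i <;> simp [cross3, mgN1, mgN2, mgN3] <;> field_simp <;> ring
  · ext i; fin_cases i <;> simp [cross3, mgN1, mgN2, mgN3] <;> field_simp <;> ring

lemma mgFlip_norm (a : EuclideanSpace ℝ (Fin 3)) : ‖mgFlip a‖ = ‖a‖ := by
  simp [EuclideanSpace.norm_eq, Fin.sum_univ_three, mgFlip]

lemma mgFlip_inner (a b : EuclideanSpace ℝ (Fin 3)) : ⟪mgFlip a, mgFlip b⟫ = ⟪a, b⟫ := by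
  simp [PiLp.inner_apply, Fin.sum_univ_three, mgFlip]

lemma mgFlip_cross (a b : EuclideanSpace ℝ (Fin 3)) :
    cross3 (mgFlip a) (mgFlip b) = mgFlip (cross3 a b) := by
  ext i; fin_cases i <;> simp [cross3, mgFlip] <;> ring

lemma MgFrame.flip {e1 e2 e3 : EuclideanSpace ℝ (Fin 3)} (h : MgFrame e1 e2 e3) :
    MgFrame (mgFlip e1) (mgFlip e2) (mgFlip e3) := by
  obtain ⟨h1, h2, h3, h4, h5, h6, h7, h8, h9⟩ := h
  constructor <;> simp only [mgFlip_norm, mgFlip_inner, mgFlip_cross, h1, h2, h3, h4, h5, h6, h7,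
    h8, h9]

lemma mgN_cont : Continuous (fun z : ℂ => mgN1 z.re z.im) ∧
    Continuous (fun z : ℂ => mgN2 z.re z.im) ∧ Continuous (fun z : ℂ => mgN3 z.re z.im) := by
  have hD : ∀ z : ℂ, (1 + z.re ^ 2 + z.im ^ 2) ≠ 0 := fun z => by positivity
  refine ⟨?_, ?_, ?_⟩ <;>
  · simp only [mgN1, mgN2, mgN3]
    refine (PiLp.continuous_toLp 2 _).comp (continuous_pi fun i => ?_)
    fin_cases i <;> simp <;> fun_prop (disch := assumption)

lemma mgFlip_cont : Continuous mgFlip := by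
  unfold mgFlip
  refine (PiLp.continuous_toLp 2 _).comp (continuous_pi fun i => ?_)
  fin_cases i <;> simp <;> fun_prop

lemma mg_rot (θ : ℝ) :
    mgFlip (mgN1 (Real.cos θ) (-Real.sin θ)) =
      Real.cos (2 * θ + Real.pi) • mgN1 (Real.cos θ) (Real.sin θ) +
      Real.sin (2 * θ + Real.pi) • mgN2 (Real.cos θ) (Real.sin θ) ∧
    mgFlip (mgN2 (Real.cos θ) (-Real.sin θ)) =
      (-Real.sin (2 * θ + Real.pi)) • mgN1 (Real.cos θ) (Real.sin θ) +
      Real.cos (2 * θ + Real.pi) • mgN2 (Real.cos θ) (Real.sin θ) ∧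
    mgFlip (mgN3 (Real.cos θ) (-Real.sin θ)) = mgN3 (Real.cos θ) (Real.sin θ) := by
  have h := Real.sin_sq_add_cos_sq θ
  have hD : 1 + Real.cos θ ^ 2 + Real.sin θ ^ 2 = 2 := by linarith
  rw [Real.cos_add_pi, Real.sin_add_pi, Real.cos_two_mul, Real.sin_two_mul]
  simp only [mgN1, mgN2, mgN3, neg_sq, hD]
  generalize Real.cos θ = x at *
  generalize Real.sin θ = y at *
  refine ⟨?_, ?_, ?_⟩ <;> ext i <;> fin_cases i <;> simp [mgFlip] <;> grind

noncomputable def mgCl (x : ℝ) : ℝ := max (-1) (min x 1)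

lemma mgCl_abs (x : ℝ) : |mgCl x| ≤ 1 := by
  unfold mgCl
  rw [abs_le]
  exact ⟨le_max_left _ _, max_le (by norm_num) (min_le_right _ _)⟩

lemma mgCl_eq {x : ℝ} (h : |x| ≤ 1) : mgCl x = x := by
  rw [abs_le] at h
  unfold mgCl
  rw [min_eq_left h.2, max_eq_right h.1]

lemma mgCl_lip (x y : ℝ) : |mgCl x - mgCl y| ≤ |x - y| := by
  unfold mgCl
  refine (abs_max_sub_max_le_max _ _ _ _).trans ?_
  rw [sub_self, abs_zero]
  refine max_le (abs_nonneg _) ((abs_min_sub_min_le_max _ _ _ _).trans ?_)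
  simp

lemma mgCl_cont : Continuous mgCl := by unfold mgCl; fun_prop

/-- The curvature nonlinearity. -/
noncomputable def mgGam (f : EuclideanSpace ℝ (Fin 3) → ℝ)
    (q : (EuclideanSpace ℝ (Fin 3) × EuclideanSpace ℝ (Fin 3) × EuclideanSpace ℝ (Fin 3)) ×
      ℝ × ℝ × ℝ × ℝ) : ℝ :=
  f ((√(1 + q.2.2.2.1 ^ 2))⁻¹ • (q.2.1 • q.1.1 + q.2.2.1 • q.1.2.1 + q.2.2.2.1 • q.1.2.2)) *
    (√(1 + q.2.2.2.1 ^ 2 + q.2.2.2.2 ^ 2) / √(1 + q.2.2.2.1 ^ 2)) ^ 3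

lemma mgGam_contDiff (f : EuclideanSpace ℝ (Fin 3) → ℝ) (hf : ContDiff ℝ (⊤ : ℕ∞) f) :
    ContDiff ℝ 1 (mgGam f) := by
  have hf1 : ContDiff ℝ 1 f := hf.of_le (by exact_mod_cast le_top)
  unfold mgGam
  have h1 : ContDiff ℝ 1 (fun q : (EuclideanSpace ℝ (Fin 3) × EuclideanSpace ℝ (Fin 3) ×
      EuclideanSpace ℝ (Fin 3)) × ℝ × ℝ × ℝ × ℝ => √(1 + q.2.2.2.1 ^ 2)) :=
    ContDiff.sqrt (by fun_prop) (fun q => by positivity)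
  have h2 : ContDiff ℝ 1 (fun q : (EuclideanSpace ℝ (Fin 3) × EuclideanSpace ℝ (Fin 3) ×
      EuclideanSpace ℝ (Fin 3)) × ℝ × ℝ × ℝ × ℝ => √(1 + q.2.2.2.1 ^ 2 + q.2.2.2.2 ^ 2)) :=
    ContDiff.sqrt (by fun_prop) (fun q => by positivity)
  have h3 : ∀ q : (EuclideanSpace ℝ (Fin 3) × EuclideanSpace ℝ (Fin 3) ×
      EuclideanSpace ℝ (Fin 3)) × ℝ × ℝ × ℝ × ℝ, √(1 + q.2.2.2.1 ^ 2) ≠ 0 :=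
    fun q => (Real.sqrt_pos.2 (by positivity)).ne'
  exact (hf1.comp ((h1.inv h3).smul (by fun_prop))).mul ((h2.div h1 h3).pow 3)


/-- Equivariance of the fixed point family. -/
lemma mg_equivariance {Y : Type*} (G : Y → ℝ → ℝ × ℝ → ℝ) (ε : ℝ)
    (U : Y → (BoundedContinuousFunction ℝ (ℝ × ℝ)))
    (hfix : ∀ y θ, U y θ = ε • ∫ t in (0:ℝ)..(2 * Real.pi), G y (θ - t) (U y (θ - t)) • mgK t)
    (huniq : ∀ y (V : BoundedContinuousFunction ℝ (ℝ × ℝ)), (∀ θ, V θ =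
        ε • ∫ t in (0:ℝ)..(2 * Real.pi), G y (θ - t) (V (θ - t)) • mgK t) → V = U y)
    (A B : Y) (φ : ℝ) (hAB : ∀ θ w, G B θ w = G A (θ + φ) w) (θ : ℝ) :
    U B θ = U A (θ + φ) := by
  have h := huniq B ((U A).compContinuous ⟨fun θ => θ + φ, by fun_prop⟩) (by
    intro θ
    simp only [BoundedContinuousFunction.compContinuous_apply, ContinuousMap.coe_mk]
    rw [hfix A (θ + φ)]
    congr 2
    ext1 t
    rw [hAB, show θ + φ - t = θ - t + φ by ring])
  rw [← h]
  rfl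

lemma mg_fourier_shift (g : ℝ → ℝ) (hp : Function.Periodic g (2 * Real.pi)) (φ : ℝ) :
    ∫ s in (0:ℝ)..(2 * Real.pi), (g (s + φ) : ℂ) * Complex.exp (s * Complex.I) =
    Complex.exp (-(φ * Complex.I)) *
      ∫ s in (0:ℝ)..(2 * Real.pi), (g s : ℂ) * Complex.exp (s * Complex.I) := by
  have h1 : Function.Periodic (fun s : ℝ => (g s : ℂ) * Complex.exp (s * Complex.I))
      (2 * Real.pi) := by
    intro s
    simp only [hp s]
    congr 1
    push_cast
    rw [add_mul, Complex.exp_add, Complex.exp_two_pi_mul_I, mul_one]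
  have h2 := intervalIntegral.integral_comp_add_right (a := 0) (b := 2 * Real.pi)
    (fun s : ℝ => (g s : ℂ) * Complex.exp (s * Complex.I)) φ
  have h3 := h1.intervalIntegral_add_eq φ 0
  rw [zero_add] at h3
  rw [zero_add, add_comm (2 * Real.pi) φ, h3] at h2
  rw [← h2, ← intervalIntegral.integral_const_mul]
  congr 1
  ext s
  push_cast
  rw [add_mul, Complex.exp_add, Complex.exp_neg]
  have := Complex.exp_ne_zero (φ * Complex.I)
  field_simp

lemma mg_fourier_re_im (g : ℝ → ℝ) (hg : Continuous g)
    (h : ∫ s in (0:ℝ)..(2 * Real.pi), (g s : ℂ) * Complex.exp (s * Complex.I) = 0) :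
    ∫ t in (0:ℝ)..(2 * Real.pi), Real.cos t * g t = 0 ∧
    ∫ t in (0:ℝ)..(2 * Real.pi), Real.sin t * g t = 0 := by
  have hi : IntervalIntegrable (fun s : ℝ => (g s : ℂ) * Complex.exp (s * Complex.I))
      MeasureTheory.volume 0 (2 * Real.pi) := Continuous.intervalIntegrable (by fun_prop) _ _
  have h1 := Complex.reCLM.intervalIntegral_comp_comm hi
  have h2 := Complex.imCLM.intervalIntegral_comp_comm hi
  rw [h] at h1 h2
  simp only [Complex.reCLM_apply, Complex.imCLM_apply, Complex.re_ofReal_mul,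
    Complex.im_ofReal_mul, Complex.exp_ofReal_mul_I_re, Complex.exp_ofReal_mul_I_im,
    Complex.zero_re, Complex.zero_im] at h1 h2
  refine ⟨?_, ?_⟩
  · rw [← h1]; congr 1; ext t; ring
  · rw [← h2]; congr 1; ext t; ring

abbrev MgTriple : Type :=
  EuclideanSpace ℝ (Fin 3) × EuclideanSpace ℝ (Fin 3) × EuclideanSpace ℝ (Fin 3)

abbrev MgY : Type := {A : MgTriple // ‖A‖ ≤ 1}

lemma MgFrame.norm_le {e1 e2 e3 : EuclideanSpace ℝ (Fin 3)} (h : MgFrame e1 e2 e3) :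
    ‖((e1, e2, e3) : MgTriple)‖ ≤ 1 := by
  simp [Prod.norm_def, h.n1, h.n2, h.n3]

lemma mg_main (f : EuclideanSpace ℝ (Fin 3) → ℝ) (hf : ContDiff ℝ (⊤ : ℕ∞) f) :
    ∃ B : ℝ, 0 < B ∧ ∀ ε : ℝ, 0 < ε → ε * B ≤ 1 →
      ∃ (e1 e2 e3 : EuclideanSpace ℝ (Fin 3)) (u p : ℝ → ℝ), MgFrame e1 e2 e3 ∧
      (∀ θ, HasDerivAt u (p θ) θ) ∧
      (∀ θ, HasDerivAt p (- u θ + ε *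
      (f ((√(1 + u θ ^ 2))⁻¹ • (Real.cos θ • e1 + Real.sin θ • e2 + u θ • e3)) *
        (√(1 + u θ ^ 2 + p θ ^ 2) / √(1 + u θ ^ 2)) ^ 3)) θ) ∧
      (∀ θ, |u θ| ≤ 1) ∧
      Function.Periodic u (2 * Real.pi) ∧ Function.Periodic p (2 * Real.pi) := by
  have hcd := mgGam_contDiff f hf
  have hΓ : Continuous (mgGam f) := hcd.continuous
  have hcomp : IsCompact (Metric.closedBall (0 : MgTriple × ℝ × ℝ × ℝ × ℝ) 1) :=
    isCompact_closedBall _ _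
  obtain ⟨L, hL⟩ := hcd.contDiffOn.exists_lipschitzOnWith one_ne_zero
    (convex_closedBall (0 : MgTriple × ℝ × ℝ × ℝ × ℝ) 1) hcomp
  obtain ⟨M, hM⟩ := hcomp.exists_bound_of_continuousOn hΓ.continuousOn
  let arg : MgY → ℝ → ℝ × ℝ → MgTriple × ℝ × ℝ × ℝ × ℝ := fun A θ w =>
    (A.1, Real.cos θ, Real.sin θ, mgCl w.1, mgCl w.2)
  have harg : ∀ A θ w, arg A θ w ∈ Metric.closedBall (0 : MgTriple × ℝ × ℝ × ℝ × ℝ) 1 := by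
    intro A θ w
    rw [mem_closedBall_zero_iff]
    simp only [arg, norm_prod_le_iff, Real.norm_eq_abs]
    have := norm_prod_le_iff.1 A.2
    exact ⟨⟨this.1, norm_prod_le_iff.1 this.2⟩, Real.abs_cos_le_one _, Real.abs_sin_le_one _, mgCl_abs _, mgCl_abs _⟩
  let G : MgY → ℝ → ℝ × ℝ → ℝ := fun A θ w => mgGam f (arg A θ w)
  have hGM : ∀ A θ w, |G A θ w| ≤ M := fun A θ w => hM _ (harg A θ w)
  have hM0 : 0 ≤ M := (norm_nonneg _).trans (hM 0 (by simp))
  have hGc : Continuous (fun q : MgY × ℝ × ℝ × ℝ => G q.1 q.2.1 q.2.2) := by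
    have := mgCl_cont
    refine hΓ.comp ?_
    simp only [arg]
    fun_prop
  have hGc' : ∀ A, Continuous (Function.uncurry (G A)) := fun A =>
    hGc.comp (f := fun q : ℝ × ℝ × ℝ => ((A, q) : MgY × ℝ × ℝ × ℝ)) (by fun_prop)
  have hGL : ∀ A A' θ w w', |G A θ w - G A' θ w'| ≤ L * dist (arg A θ w) (arg A' θ w') :=
    fun A A' θ w w' => hL.dist_le_mul _ (harg _ _ _) _ (harg _ _ _)
  have hLw : ∀ A θ w w', |G A θ w - G A θ w'| ≤ L * dist w w' := by
    intro A θ w w'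
    refine (hGL _ _ _ _ _).trans ?_
    gcongr
    simp only [arg, Prod.dist_eq, dist_self, Real.dist_eq]
    have h1 := mgCl_lip w.1 w'.1
    have h2 := mgCl_lip w.2 w'.2
    simp only [max_le_iff]
    have h0 : 0 ≤ max |w.1 - w'.1| |w.2 - w'.2| := le_max_of_le_left (abs_nonneg _)
    exact ⟨h0, h0, h0, le_max_of_le_left h1, le_max_of_le_right h2⟩
  have hLy : ∀ A A' θ w, |G A θ w - G A' θ w| ≤ L * dist A A' := by
    intro A A' θ w
    refine (hGL _ _ _ _ _).trans ?_
    gcongr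
    rw [Subtype.dist_eq, Prod.dist_eq]
    simp [arg]
  refine ⟨2 * Real.pi * (2 * L + M) + 1, by positivity, ?_⟩
  intro ε hε hεB
  have hpi := Real.pi_pos
  have hLε : 0 ≤ ε * Real.pi * L := by positivity
  have hMε : 0 ≤ ε * Real.pi * M := by positivity
  obtain ⟨U, hfix, huniq, hUc⟩ := mg_LS G M hGM hGc' ε L L.2 hLw hLy (by
    rw [abs_of_pos hε]
    nlinarith)
  have equi := mg_equivariance G ε U hfix huniq
  have hUper : ∀ A, Function.Periodic (U A) (2 * Real.pi) := by
    intro A θ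
    refine (equi A A (2 * Real.pi) ?_ θ).symm
    intro θ w
    simp [G, arg]
  let g : MgY → ℝ → ℝ := fun A s => G A s (U A s)
  have hgc : Continuous (Function.uncurry g) := by
    refine hGc.comp (f := fun q : MgY × ℝ => (q.1, q.2, U q.1 q.2)) ?_
    have h1 : Continuous (fun q : MgY × ℝ => U q.1 q.2) :=
      (hUc.comp continuous_fst).eval continuous_snd
    fun_prop
  have hgc' : ∀ A, Continuous (g A) := fun A =>
    hgc.comp (f := fun s : ℝ => (A, s)) (by fun_prop)
  have hgper : ∀ A, Function.Periodic (g A) (2 * Real.pi) := by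
    intro A θ
    simp only [g, hUper A θ]
    simp [G, arg]
  let a : MgY → ℂ := fun A =>
    ∫ s in (0:ℝ)..(2 * Real.pi), (g A s : ℂ) * Complex.exp (s * Complex.I)
  have ha : Continuous a := by
    refine intervalIntegral.continuous_parametric_intervalIntegral_of_continuous'
      (μ := MeasureTheory.volume)
      (f := fun A (s : ℝ) => (g A s : ℂ) * Complex.exp (s * Complex.I)) ?_ 0 (2 * Real.pi)
    have h1 : Continuous (fun q : MgY × ℝ => ((g q.1 q.2 : ℝ) : ℂ)) :=
      Complex.continuous_ofReal.comp hgc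
    have h2 : Continuous (fun q : MgY × ℝ => Complex.exp (q.2 * Complex.I)) := by fun_prop
    exact h1.mul h2
  have aequi : ∀ (A B : MgY) (φ : ℝ), (∀ θ w, G B θ w = G A (θ + φ) w) →
      a B = Complex.exp (-(φ * Complex.I)) * a A := by
    intro A B φ hAB
    simp only [a]
    rw [← mg_fourier_shift (g A) (hgper A) φ]
    congr 1
    ext s
    simp only [g]
    rw [equi A B φ hAB, hAB]
  -- a frame at which the reduced vector field vanishes
  obtain ⟨e1, e2, e3, hF, hzero⟩ : ∃ (e1 e2 e3 : EuclideanSpace ℝ (Fin 3))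
      (hF : MgFrame e1 e2 e3), a ⟨(e1, e2, e3), hF.norm_le⟩ = 0 := by
    by_contra hcon
    push Not at hcon
    obtain ⟨c1, c2, c3⟩ := mgN_cont
    have cf := mgFlip_cont
    refine mg_topological
      (fun z => a ⟨(mgN1 z.re z.im, mgN2 z.re z.im, mgN3 z.re z.im),
        (mgFrame_N z.re z.im).norm_le⟩)
      (fun z => a ⟨(mgFlip (mgN1 z.re z.im), mgFlip (mgN2 z.re z.im), mgFlip (mgN3 z.re z.im)),
        (mgFrame_N z.re z.im).flip.norm_le⟩) ?_ ?_ ?_ ?_ ?_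
    · exact ha.comp (Continuous.subtype_mk (by fun_prop) _)
    · exact ha.comp (Continuous.subtype_mk (by fun_prop) _)
    · exact fun z => hcon _ _ _ (mgFrame_N z.re z.im)
    · exact fun z => hcon _ _ _ (mgFrame_N z.re z.im).flip
    · intro θ
      have r1 : (Complex.exp (-(θ * Complex.I))).re = Real.cos θ := by
        rw [← neg_mul, ← Complex.ofReal_neg, Complex.exp_ofReal_mul_I_re, Real.cos_neg]
      have r2 : (Complex.exp (-(θ * Complex.I))).im = -Real.sin θ := by
        rw [← neg_mul, ← Complex.ofReal_neg, Complex.exp_ofReal_mul_I_im, Real.sin_neg]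
      have r3 := Complex.exp_ofReal_mul_I_re θ
      have r4 := Complex.exp_ofReal_mul_I_im θ
      simp only [r1, r2, r3, r4]
      obtain ⟨k1, k2, k3⟩ := mg_rot θ
      rw [aequi ⟨(mgN1 (Real.cos θ) (Real.sin θ), mgN2 (Real.cos θ) (Real.sin θ),
        mgN3 (Real.cos θ) (Real.sin θ)), (mgFrame_N _ _).norm_le⟩ _ (2 * θ + Real.pi)]
      · congr 1
        push_cast
        rw [add_mul, neg_add, Complex.exp_add, Complex.exp_neg (Real.pi * Complex.I),
          Complex.exp_pi_mul_I]
        norm_num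
      · intro t w
        simp only [G, arg, mgGam, k1, k2, k3]
        congr 3
        rw [Real.cos_add t, Real.sin_add t]
        module
  set A : MgY := ⟨(e1, e2, e3), hF.norm_le⟩ with hA
  obtain ⟨hC, hS⟩ := mg_fourier_re_im (g A) (hgc' A) hzero
  have hd := mg_deriv (g A) (hgc' A) (hgper A) hC hS ε (U A) (hfix A)
  have hUb : ∀ θ, ‖U A θ‖ ≤ 1 := by
    intro θ
    rw [hfix A θ, norm_smul, Real.norm_eq_abs, abs_of_pos hε]
    have := mg_conv_norm (g A) M (fun s => hGM _ _ _) θ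
    calc _ ≤ ε * (M * (2 * Real.pi)) := by gcongr
      _ ≤ 1 := by nlinarith
  have hb1 : ∀ θ, |(U A θ).1| ≤ 1 := fun θ => (norm_prod_le_iff.1 (hUb θ)).1
  have hb2 : ∀ θ, |(U A θ).2| ≤ 1 := fun θ => (norm_prod_le_iff.1 (hUb θ)).2
  refine ⟨e1, e2, e3, fun θ => (U A θ).1, fun θ => (U A θ).2, hF, fun θ => (hd θ).1, ?_, hb1,
    fun θ => by simp only [hUper A θ], fun θ => by simp only [hUper A θ]⟩
  intro θ
  have h1 := (hd θ).2
  simp only [g, G, arg, mgCl_eq (hb1 θ), mgCl_eq (hb2 θ), mgGam] at h1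
  exact h1

/-- For smooth `f : ℝ³ → ℝ` there is `k₀ > 0` such that for every `k ≥ k₀`
there is a closed magnetic geodesic with energy `k` on the round `S²`. -/
theorem closed_magnetic_geodesic_on_sphere_high_energy
    (f : EuclideanSpace ℝ (Fin 3) → ℝ) (hf : ContDiff ℝ (⊤ : ℕ∞) f) :
    ∃ k₀ : ℝ, 0 < k₀ ∧
      ∀ k : ℝ, k₀ ≤ k →
        ∃ T : ℝ, 0 < T ∧
          ∃ γ : ℝ → EuclideanSpace ℝ (Fin 3),
            ContDiff ℝ (⊤ : ℕ∞) γ ∧ Function.Periodic γ T ∧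
            (∃ s₁ s₂ : ℝ, γ s₁ ≠ γ s₂) ∧
            ∀ s : ℝ,
              ‖γ s‖ = 1 ∧
              deriv (deriv γ) s =
                (-(‖deriv γ s‖ ^ 2)) • γ s + f (γ s) • cross3 (γ s) (deriv γ s) ∧
              (1 / 2) * ‖deriv γ s‖ ^ 2 = k := by
  obtain ⟨B, hB, hmain⟩ := mg_main f hf
  refine ⟨B ^ 2, by positivity, ?_⟩
  intro k hk
  have hk0 : 0 < k := lt_of_lt_of_le (by positivity) hk
  have hs : 0 < √(2 * k) := Real.sqrt_pos.2 (by positivity)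
  have hsB : B ≤ √(2 * k) := Real.le_sqrt_of_sq_le (by linarith)
  have hε : 0 < (√(2 * k))⁻¹ := inv_pos.2 hs
  obtain ⟨e1, e2, e3, u, p, hF, hu, hp, hub, pu, pp⟩ := hmain _ hε (by
    rw [inv_mul_le_one₀ hs]; exact hsB)
  refine mg_geom f hf e1 e2 e3 hF _ k hε ?_ u p hu hp hub pu pp
  rw [inv_pow, Real.sq_sqrt (by positivity), inv_mul_cancel₀ (by positivity)]
end

section
/- Let f : ℝ³ → ℝ be smooth with f(q) ≠ 0 for every q with ‖q‖ = 1. Then there exists k₀ > 0 such that for every k ∈ (0, k₀) there is a closed magnetic geodesic with energy k on the round sphere S², i.e. there exist T > 0 and a nonconstant smooth T-periodic curve γ : ℝ → ℝ³ with ‖γ(s)‖ = 1, γ''(s) = −‖γ'(s)‖² γ(s) + f(γ(s)) (γ(s) × γ'(s)), and ½‖γ'(s)‖² = k for all s ∈ ℝ. -/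
open MeasureTheory
open scoped RealInnerProductSpace

open scoped BoundedContinuousFunction in
/-- Abstract Lyapunov-Schmidt step: the fixed point of the averaged integral operator. -/
theorem ls_fixed {X : Type*} [PseudoMetricSpace X] (g : X → ℝ → ℂ → ℂ) (c B : ℝ)
    (hc0 : 0 ≤ c) (hc : 2 * Real.pi * c ≤ 1 / 2)
    (hLip : ∀ x y t z w, ‖g x t z - g y t w‖ ≤ c * (dist x y + ‖z - w‖))
    (hB : ∀ x t z, ‖g x t z‖ ≤ B)
    (hcont : ∀ x, Continuous (fun q : ℝ × ℂ => g x q.1 q.2)) :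
    ∃ Z : X → (ℝ →ᵇ ℂ),
      (∀ x θ, Z x θ = ∫ τ in (0:ℝ)..(2 * Real.pi),
        ((τ / (2 * Real.pi) : ℝ) : ℂ) * g x (θ + τ) (Z x (θ + τ))) ∧
      (∀ x (y : ℝ →ᵇ ℂ), (∀ θ, y θ = ∫ τ in (0:ℝ)..(2 * Real.pi),
        ((τ / (2 * Real.pi) : ℝ) : ℂ) * g x (θ + τ) (y (θ + τ))) → y = Z x) ∧
      (∀ x θ, ‖Z x θ‖ ≤ 2 * Real.pi * B) ∧
      (∀ x y, dist (Z x) (Z y) ≤ dist x y) := by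
  have hpi := Real.pi_pos
  have key : ∀ (h : ℝ → ℂ) (C : ℝ), (∀ τ, ‖h τ‖ ≤ C) →
      ‖∫ τ in (0:ℝ)..(2 * Real.pi), ((τ / (2 * Real.pi) : ℝ) : ℂ) * h τ‖ ≤ 2 * Real.pi * C := by
    intro h C hC
    have := intervalIntegral.norm_integral_le_of_norm_le_const (a := 0) (b := 2 * Real.pi) (C := C)
      (f := fun τ => ((τ / (2 * Real.pi) : ℝ) : ℂ) * h τ) ?_
    · rw [sub_zero, abs_of_pos (by positivity)] at this
      linarith
    · intro τ hτ
      rw [Set.uIoc_of_le (by positivity)] at hτ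
      rw [norm_mul, Complex.norm_real, Real.norm_eq_abs, abs_of_nonneg (by have := hτ.1; positivity)]
      have h1 : τ / (2 * Real.pi) ≤ 1 := by
        rw [div_le_one (by positivity)]; exact hτ.2
      have h2 := hC τ
      have h3 := norm_nonneg (h τ)
      have : τ / (2 * Real.pi) * ‖h τ‖ ≤ 1 * ‖h τ‖ := by gcongr
      linarith
  have hcy : ∀ x (y : ℝ →ᵇ ℂ), Continuous (fun t => g x t (y t)) := fun x y =>
    (hcont x).comp (continuous_id.prodMk y.continuous)
  have hii : ∀ x (y : ℝ →ᵇ ℂ) θ, IntervalIntegrable (fun τ : ℝ => ((τ / (2 * Real.pi) : ℝ) : ℂ) *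
      g x (θ + τ) (y (θ + τ))) volume 0 (2 * Real.pi) := by
    intro x y θ
    apply Continuous.intervalIntegrable
    have := (hcy x y).comp (continuous_const.add continuous_id : Continuous fun τ : ℝ => θ + τ)
    simp only [Function.comp_def, id] at this
    fun_prop
  let N : X → (ℝ →ᵇ ℂ) → (ℝ →ᵇ ℂ) := fun x y =>
    BoundedContinuousFunction.ofNormedAddCommGroup
      (fun θ => ∫ τ in (0:ℝ)..(2 * Real.pi),
        ((τ / (2 * Real.pi) : ℝ) : ℂ) * g x (θ + τ) (y (θ + τ)))
      (by
        apply intervalIntegral.continuous_parametric_intervalIntegral_of_continuous'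
        have := (hcy x y).comp (continuous_fst.add continuous_snd : Continuous fun q : ℝ × ℝ => q.1 + q.2)
        simp only [Function.comp_def] at this
        simp only [Function.uncurry_def]
        fun_prop)
      (2 * Real.pi * B)
      (fun θ => key _ _ (fun τ => hB _ _ _))
  have hN : ∀ x y θ, N x y θ = ∫ τ in (0:ℝ)..(2 * Real.pi),
        ((τ / (2 * Real.pi) : ℝ) : ℂ) * g x (θ + τ) (y (θ + τ)) := fun x y θ => rfl
  have hd : ∀ x x' y y', dist (N x y) (N x' y') ≤ 2 * Real.pi * (c * (dist x x' + dist y y')) := by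
    intro x x' y y'
    rw [BoundedContinuousFunction.dist_le (by positivity)]
    intro θ
    rw [dist_eq_norm, hN, hN, ← intervalIntegral.integral_sub (hii _ _ _) (hii _ _ _)]
    simp_rw [← mul_sub]
    apply key
    intro τ
    refine (hLip _ _ _ _ _).trans ?_
    gcongr
    rw [← dist_eq_norm]
    exact BoundedContinuousFunction.dist_coe_le_dist _
  have hK : ∀ x, ContractingWith (1/2 : NNReal) (N x) := by
    intro x
    refine ⟨by rw [← NNReal.coe_lt_coe]; norm_num, LipschitzWith.of_dist_le_mul fun y y' => ?_⟩
    have := hd x x y y'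
    rw [dist_self, zero_add] at this
    refine this.trans ?_
    push_cast
    nlinarith [dist_nonneg (x := y) (y := y')]
  refine ⟨fun x => ContractingWith.fixedPoint (N x) (hK x), ?_, ?_, ?_, ?_⟩
  · intro x θ
    rw [← hN, (hK x).fixedPoint_isFixedPt]
  · intro x y hy
    apply (hK x).fixedPoint_unique
    ext θ
    rw [hN, ← hy]
  · intro x θ
    have h1 : ContractingWith.fixedPoint (N x) (hK x) θ = N x (ContractingWith.fixedPoint (N x) (hK x)) θ := by
      rw [(hK x).fixedPoint_isFixedPt]
    rw [h1, hN]
    exact key _ _ (fun τ => hB _ _ _)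
  · intro x y
    have := (hK x).fixedPoint_lipschitz_in_map (hK y) (C := 2 * Real.pi * (c * dist x y)) (by
      intro z
      have := hd x y z z
      rwa [dist_self, add_zero] at this)
    refine this.trans ?_
    push_cast
    rw [div_le_iff₀ (by norm_num)]
    nlinarith [dist_nonneg (x := x) (y := y)]

/-- If the mean of `h` vanishes, the averaged primitive of a periodic `h` is a primitive. -/
theorem ls_deriv (h : ℝ → ℂ) (hh : Continuous h) (hp : Function.Periodic h (2 * Real.pi))
    (h0 : ∫ t in (0:ℝ)..(2 * Real.pi), h t = 0) (θ : ℝ) :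
    HasDerivAt (fun θ => ∫ τ in (0:ℝ)..(2 * Real.pi),
      ((τ / (2 * Real.pi) : ℝ) : ℂ) * h (θ + τ)) (h θ) θ := by
  have hpi := Real.pi_pos
  have hpi' : (2 * (Real.pi : ℂ)) ≠ 0 := by norm_cast; positivity
  -- rewrite
  have hI : ∀ a b, IntervalIntegrable h volume a b := fun a b => hh.intervalIntegrable a b
  have hI' : ∀ a b, IntervalIntegrable (fun t : ℝ => (t : ℂ) * h t) volume a b := fun a b =>
    Continuous.intervalIntegrable (by fun_prop) a b
  have hz : ∀ s, ∫ t in s..(s + 2 * Real.pi), h t = 0 := by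
    intro s
    rw [hp.intervalIntegral_add_eq s 0, zero_add, h0]
  have e1 : ∀ s : ℝ, ∫ τ in (0:ℝ)..(2 * Real.pi), ((τ / (2 * Real.pi) : ℝ) : ℂ) * h (s + τ)
      = (2 * (Real.pi : ℂ))⁻¹ * ((∫ t in (0:ℝ)..(s + 2 * Real.pi), (t : ℂ) * h t)
        - ∫ t in (0:ℝ)..s, (t : ℂ) * h t) := by
    intro s
    have a1 : ∀ τ : ℝ, ((τ / (2 * Real.pi) : ℝ) : ℂ) * h (s + τ) =
        (fun t : ℝ => (2 * (Real.pi : ℂ))⁻¹ * ((t : ℂ) * h t - s * h t)) (s + τ) := by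
      intro τ; push_cast; field_simp; ring
    simp_rw [a1]
    rw [intervalIntegral.integral_comp_add_left (fun t : ℝ => (2 * (Real.pi : ℂ))⁻¹ * ((t : ℂ) * h t - s * h t)),
      intervalIntegral.integral_const_mul, intervalIntegral.integral_sub (hI' _ _) ((hI _ _).const_mul _),
      intervalIntegral.integral_const_mul, add_zero, hz, mul_zero, sub_zero,
      intervalIntegral.integral_interval_sub_left (hI' _ _) (hI' _ _)]
  have e2 := funext e1
  rw [e2]
  have hc : Continuous (fun t : ℝ => (t : ℂ) * h t) := by fun_prop
  have d1 : ∀ s : ℝ, HasDerivAt (fun s : ℝ => ∫ t in (0:ℝ)..s, (t : ℂ) * h t) ((s:ℂ) * h s) s :=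
    fun s => hc.integral_hasStrictDerivAt 0 s |>.hasDerivAt
  have d2 := (d1 (θ + 2 * Real.pi)).comp_add_const θ (2 * Real.pi)
  have d3 := (d2.sub (d1 θ)).const_mul (2 * (Real.pi : ℂ))⁻¹
  refine d3.congr_deriv ?_
  rw [hp]
  push_cast
  field_simp
  ring

theorem exists_clog (g : ℂ → ℂ) (hg : Continuous g) (h0 : ∀ w, g w ≠ 0) :
    ∃ l : ℂ → ℂ, Continuous l ∧ ∀ w, Complex.exp (l w) = g w := by
  rcases Complex.isCoveringMapOn_exp.existsUnique_continuousMap_lifts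
    (⟨g, hg⟩ : C(ℂ, ℂ)) (a₀ := 0) (e₀ := Complex.log (g 0)) (Complex.exp_log (h0 0))
    (fun x => h0 x) with ⟨l, ⟨-, hl⟩, -⟩
  exact ⟨l, l.continuous, fun w => congrFun hl w⟩

/-- The hairy-ball type obstruction. -/
theorem hairy (bN bS : ℂ → ℂ) (hN : Continuous bN) (hS : Continuous bS)
    (h : ∀ s : ℝ, bN (Complex.exp (s * Complex.I)) =
      Complex.exp (s * Complex.I) ^ 2 * bS (Complex.exp (-(s * Complex.I)))) :
    (∃ w, bN w = 0) ∨ (∃ w, bS w = 0) := by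
  by_contra hcon
  push Not at hcon
  obtain ⟨l, hl, hle⟩ := exists_clog bN hN hcon.1
  obtain ⟨r, hr, hre⟩ := exists_clog bS hS hcon.2
  let D : ℝ → ℂ := fun s => l (Complex.exp (s * Complex.I)) - r (Complex.exp (-(s * Complex.I)))
    - 2 * (s * Complex.I)
  have hD : Continuous D := by fun_prop
  have hD1 : ∀ s, Complex.exp (D s) = 1 := by
    intro s
    have h1 := h s
    rw [← hle, ← hre, ← Complex.exp_nat_mul, ← Complex.exp_add] at h1
    simp only [D]
    rw [sub_sub, Complex.exp_sub, h1, div_eq_one_iff_eq (Complex.exp_ne_zero _)]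
    congr 1
    push_cast; ring
  have hintg : ∀ s, ∃ n : ℤ, (D s).im / (2 * Real.pi) = n := by
    intro s
    obtain ⟨n, hn⟩ := Complex.exp_eq_one_iff.1 (hD1 s)
    refine ⟨n, ?_⟩
    rw [hn]
    have := Real.pi_pos
    simp
  choose n hn using hintg
  have hnc : Continuous n := by
    rw [Int.isClosedEmbedding_coe_real.isEmbedding.continuous_iff]
    have : ((fun k : ℤ => (k : ℝ)) ∘ n) = fun s => (D s).im / (2 * Real.pi) := by
      funext s; simp [hn]
    rw [this]
    have := Complex.continuous_im.comp hD
    simp only [Function.comp_def] at this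
    fun_prop
  have hc := PreconnectedSpace.constant (inferInstance : PreconnectedSpace ℝ) hnc
    (x := 0) (y := 2 * Real.pi)
  have e1 : (D 0).im / (2 * Real.pi) = (D (2 * Real.pi)).im / (2 * Real.pi) := by
    rw [hn, hn, hc]
  have hpi := Real.pi_pos
  have e2 : (D 0).im = (D (2 * Real.pi)).im := by
    field_simp at e1; exact e1
  simp only [D] at e2
  push_cast at e2
  rw [Complex.exp_neg, Complex.exp_neg, Complex.exp_two_pi_mul_I] at e2
  simp at e2
  linarith

/-- The vector with coordinates `A, B, C` in the (rotated) orthonormal frame given by the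
quaternion `p`. -/
noncomputable def fvec (p : ℂ × ℂ) (A B C : ℝ) : EuclideanSpace ℝ (Fin 3) :=
  A • !₂[2 * (p.1.re * p.2.re + p.1.im * p.2.im), 2 * (p.1.re * p.2.im - p.1.im * p.2.re),
      p.1.re ^ 2 + p.1.im ^ 2 - p.2.re ^ 2 - p.2.im ^ 2] +
  B • !₂[p.1.re ^ 2 - p.1.im ^ 2 - p.2.re ^ 2 + p.2.im ^ 2,
      -2 * p.1.re * p.1.im - 2 * p.2.re * p.2.im, -2 * (p.1.re * p.2.re - p.1.im * p.2.im)] +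
  C • !₂[2 * p.1.re * p.1.im - 2 * p.2.re * p.2.im,
      p.1.re ^ 2 - p.1.im ^ 2 + p.2.re ^ 2 - p.2.im ^ 2,
      -2 * (p.1.re * p.2.im + p.1.im * p.2.re)]

/-- Squared norm on `ℂ²`. -/
def pn (p : ℂ × ℂ) : ℝ := p.1.re ^ 2 + p.1.im ^ 2 + p.2.re ^ 2 + p.2.im ^ 2

theorem fvec_norm_sq (p : ℂ × ℂ) (hp : pn p = 1) (A B C : ℝ) :
    ‖fvec p A B C‖ ^ 2 = A ^ 2 + B ^ 2 + C ^ 2 := by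
  have : ‖fvec p A B C‖ ^ 2 = (pn p) ^ 2 * (A ^ 2 + B ^ 2 + C ^ 2) := by
    rw [EuclideanSpace.norm_sq_eq, Fin.sum_univ_three]
    simp [fvec, pn]
    ring
  rw [this, hp]; ring

theorem fvec_cross (p : ℂ × ℂ) (hp : pn p = 1) (A B C A' B' C' : ℝ) :
    cross3 (fvec p A B C) (fvec p A' B' C') =
      fvec p (B * C' - C * B') (C * A' - A * C') (A * B' - B * A') := by
  have : cross3 (fvec p A B C) (fvec p A' B' C') =
      pn p • fvec p (B * C' - C * B') (C * A' - A * C') (A * B' - B * A') := by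
    ext i
    fin_cases i <;> simp [fvec, pn, cross3] <;> ring
  rw [this, hp, one_smul]

theorem fvec_smul (p : ℂ × ℂ) (r A B C : ℝ) : r • fvec p A B C = fvec p (r * A) (r * B) (r * C) := by
  simp only [fvec, smul_add, smul_smul]

theorem fvec_add (p : ℂ × ℂ) (A B C A' B' C' : ℝ) : fvec p A B C + fvec p A' B' C' =
    fvec p (A + A') (B + B') (C + C') := by
  simp only [fvec, add_smul]; abel

theorem fvec_hasDerivAt (p : ℂ × ℂ) {A B C : ℝ → ℝ} {A' B' C' s : ℝ} (hA : HasDerivAt A A' s)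
    (hB : HasDerivAt B B' s) (hC : HasDerivAt C C' s) :
    HasDerivAt (fun s => fvec p (A s) (B s) (C s)) (fvec p A' B' C') s :=
  ((hA.smul_const _).add (hB.smul_const _)).add (hC.smul_const _)

/-- Conformal factor. -/
noncomputable def mu (z : ℂ) : ℝ := (1 + z.re ^ 2 + z.im ^ 2) / 2

theorem mu_pos (z : ℂ) : 0 < mu z := by unfold mu; positivity

/-- Stereographic chart centred at the first frame vector. -/
noncomputable def Phi (p : ℂ × ℂ) (z : ℂ) : EuclideanSpace ℝ (Fin 3) :=
  fvec p (1 / mu z - 1) (z.re / mu z) (z.im / mu z)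

theorem Phi_norm (p : ℂ × ℂ) (hp : pn p = 1) (z : ℂ) : ‖Phi p z‖ = 1 := by
  have h : ‖Phi p z‖ ^ 2 = 1 := by
    rw [Phi, fvec_norm_sq p hp]
    have := (mu_pos z).ne'
    field_simp
    unfold mu; ring
  nlinarith [norm_nonneg (Phi p z)]

/-- `ODE in the chart` implies the magnetic geodesic equation on the sphere. -/
theorem curve_eq (f : EuclideanSpace ℝ (Fin 3) → ℝ) (p : ℂ × ℂ) (hp : pn p = 1) (V : ℝ) (hV : 0 < V)
    (z : ℝ → ℂ) (θ : ℝ → ℝ)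
    (hz : ∀ s, HasDerivAt z (((V * mu (z s) : ℝ) : ℂ) * Complex.exp (θ s * Complex.I)) s)
    (hθ : ∀ s, HasDerivAt θ (f (Phi p (z s)) +
      V * ((z s).re * Real.sin (θ s) - (z s).im * Real.cos (θ s))) s) :
    ∃ T : ℝ → EuclideanSpace ℝ (Fin 3),
      (∀ s, HasDerivAt (fun s => Phi p (z s)) (T s) s) ∧ (∀ s, ‖T s‖ = V) ∧
      ∀ s, HasDerivAt T ((-(‖T s‖ ^ 2)) • Phi p (z s) + f (Phi p (z s)) • cross3 (Phi p (z s)) (T s)) s := by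
  let x : ℝ → ℝ := fun s => (z s).re
  let y : ℝ → ℝ := fun s => (z s).im
  let m : ℝ → ℝ := fun s => (1 + x s ^ 2 + y s ^ 2) / 2
  have hm : ∀ s, mu (z s) = m s := fun s => rfl
  have hm0 : ∀ s, m s ≠ 0 := fun s => (mu_pos (z s)).ne'
  let h : ℝ → ℝ := fun s => x s * Real.cos (θ s) + y s * Real.sin (θ s)
  have hx : ∀ s, HasDerivAt x (V * m s * Real.cos (θ s)) s := by
    intro s
    have := (Complex.reCLM.hasFDerivAt.comp_hasDerivAt s (hz s))
    refine this.congr_deriv ?_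
    simp [Complex.exp_ofReal_mul_I_re, hm]
  have hy : ∀ s, HasDerivAt y (V * m s * Real.sin (θ s)) s := by
    intro s
    have := (Complex.imCLM.hasFDerivAt.comp_hasDerivAt s (hz s))
    refine this.congr_deriv ?_
    simp [Complex.exp_ofReal_mul_I_im, hm]
  have hmd : ∀ s, HasDerivAt m (V * m s * h s) s := by
    intro s
    have := ((((hx s).pow 2).const_add 1).add ((hy s).pow 2)).div_const 2
    refine this.congr_deriv ?_
    simp only [h]; ring
  have hcos : ∀ s, HasDerivAt (fun s => Real.cos (θ s)) _ s := fun s => (hθ s).cos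
  have hsin : ∀ s, HasDerivAt (fun s => Real.sin (θ s)) _ s := fun s => (hθ s).sin
  have hh : ∀ s, HasDerivAt h (V * m s + f (Phi p (z s)) * (y s * Real.cos (θ s) - x s * Real.sin (θ s))
      - V * (x s * Real.sin (θ s) - y s * Real.cos (θ s)) ^ 2) s := by
    intro s
    have := ((hx s).mul (hcos s)).add ((hy s).mul (hsin s))
    refine this.congr_deriv ?_
    have e : (z s).re = x s := rfl
    have e' : (z s).im = y s := rfl
    rw [e, e']
    linear_combination (V * m s) * (Real.sin_sq_add_cos_sq (θ s))
  have hPhi : ∀ s, Phi p (z s) = fvec p (1 / m s - 1) (x s / m s) (y s / m s) := fun s => rfl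
  let T : ℝ → EuclideanSpace ℝ (Fin 3) := fun s => fvec p (V * (-(h s) / m s))
    (V * (Real.cos (θ s) - x s * h s / m s)) (V * (Real.sin (θ s) - y s * h s / m s))
  have hT : ∀ s, ‖T s‖ = V := by
    intro s
    have h1 : ‖T s‖ ^ 2 = V ^ 2 := by
      simp only [T]
      rw [fvec_norm_sq p hp]
      have h3 : h s ^ 2 / m s ^ 2 * (1 + x s ^ 2 + y s ^ 2) = 2 * h s ^ 2 / m s := by
        have : 1 + x s ^ 2 + y s ^ 2 = 2 * m s := by simp only [m]; ring
        rw [this]; have := hm0 s; field_simp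
      have h4 : x s * Real.cos (θ s) + y s * Real.sin (θ s) = h s := rfl
      have : (V * (-(h s) / m s)) ^ 2 + (V * (Real.cos (θ s) - x s * h s / m s)) ^ 2 +
        (V * (Real.sin (θ s) - y s * h s / m s)) ^ 2 = V ^ 2 * (h s ^ 2 / m s ^ 2 * (1 + x s ^ 2 + y s ^ 2)
          + (Real.sin (θ s) ^ 2 + Real.cos (θ s) ^ 2) - 2 * h s / m s *
          (x s * Real.cos (θ s) + y s * Real.sin (θ s))) := by
        ring
      rw [this, h3, Real.sin_sq_add_cos_sq, h4]; ring
    have := norm_nonneg (T s)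
    nlinarith
  refine ⟨T, ?_, hT, ?_⟩
  · intro s
    have := fvec_hasDerivAt p (((hmd s).inv (hm0 s)).sub_const 1) ((hx s).div (hmd s) (hm0 s))
      ((hy s).div (hmd s) (hm0 s))
    have e : (fun s => Phi p (z s)) = (fun s => fvec p ((m s)⁻¹ - 1) (x s / m s) (y s / m s)) := by
      funext s; rw [hPhi, one_div]
    rw [e]
    refine this.congr_deriv ?_
    have := hm0 s
    simp only [T]
    congr 1 <;> field_simp
  · intro s
    have hq := fvec_hasDerivAt p ((((hh s).neg).div (hmd s) (hm0 s)).const_mul V)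
      (((hcos s).sub (((hx s).mul (hh s)).div (hmd s) (hm0 s))).const_mul V)
      (((hsin s).sub (((hy s).mul (hh s)).div (hmd s) (hm0 s))).const_mul V)
    refine hq.congr_deriv ?_
    rw [hT, hPhi]
    generalize f (fvec p (1 / m s - 1) (x s / m s) (y s / m s)) = F
    simp only [T]
    rw [fvec_cross p hp, fvec_smul, fvec_smul, fvec_add]
    have e : (z s).re = x s := rfl
    have e' : (z s).im = y s := rfl
    rw [e, e']
    have hms : 1 + x s ^ 2 + y s ^ 2 = 2 * m s := by simp only [m]; ring
    have hhs : h s = x s * Real.cos (θ s) + y s * Real.sin (θ s) := rfl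
    have hm0 := hm0 s
    have hcs := Real.sin_sq_add_cos_sq (θ s)
    rw [hhs]
    generalize Real.cos (θ s) = c at *
    generalize Real.sin (θ s) = n at *
    generalize hX : x s = X at *
    generalize hY : y s = Y at *
    generalize hM : m s = M at *
    have hM' : M = (1 + X ^ 2 + Y ^ 2) / 2 := by linarith
    have hq2 : (X * c + Y * n) ^ 2 + (X * n - Y * c) ^ 2 = 2 * M - 1 := by
      linear_combination (X ^ 2 + Y ^ 2) * hcs + hms
    have hH : h s = X * c + Y * n := hhs
    congr 1
    · simp only [Pi.neg_apply, Pi.mul_apply, hH]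
      field_simp
      linear_combination M * (V * hq2)
    · simp only [Pi.neg_apply, Pi.mul_apply, hH, hX]
      field_simp
      linear_combination M * (V * X * hq2 - V * X * M * hcs + F * n * hms)
    · simp only [Pi.neg_apply, Pi.mul_apply, hH, hY]
      field_simp
      linear_combination M * (V * Y * hq2 - V * Y * M * hcs - F * c * hms)

theorem cross3_contDiff {n : WithTop ℕ∞} {a b : ℝ → EuclideanSpace ℝ (Fin 3)}
    (ha : ContDiff ℝ n a) (hb : ContDiff ℝ n b) : ContDiff ℝ n (fun s => cross3 (a s) (b s)) := by
  rw [contDiff_euclidean] at ha hb ⊢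
  intro i
  have h0 := ha 0
  have h1 := ha 1
  have h2 := ha 2
  have k0 := hb 0
  have k1 := hb 1
  have k2 := hb 2
  fin_cases i <;> simp [cross3] <;> fun_prop

theorem smooth_of_ode (f : EuclideanSpace ℝ (Fin 3) → ℝ) (hf : ContDiff ℝ (⊤ : ℕ∞) f) (V : ℝ)
    (γ T : ℝ → EuclideanSpace ℝ (Fin 3)) (h1 : ∀ s, HasDerivAt γ (T s) s)
    (h2 : ∀ s, HasDerivAt T ((-V) • γ s + f (γ s) • cross3 (γ s) (T s)) s) :
    ContDiff ℝ (⊤ : ℕ∞) γ := by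
  have d1 : deriv γ = T := funext fun s => (h1 s).deriv
  have d2 : deriv T = fun s => (-V) • γ s + f (γ s) • cross3 (γ s) (T s) :=
    funext fun s => (h2 s).deriv
  have key : ∀ n : ℕ, ContDiff ℝ n γ ∧ ContDiff ℝ n T := by
    intro n
    induction n with
    | zero =>
      constructor
      · simpa using (continuous_iff_continuousAt.2 fun s => (h1 s).continuousAt)
      · simpa using (continuous_iff_continuousAt.2 fun s => (h2 s).continuousAt)
    | succ n ih =>
      obtain ⟨i1, i2⟩ := ih
      constructor
      · push_cast
        rw [contDiff_succ_iff_deriv]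
        refine ⟨fun s => (h1 s).differentiableAt, by simp, ?_⟩
        rw [d1]; exact i2
      · push_cast
        rw [contDiff_succ_iff_deriv]
        refine ⟨fun s => (h2 s).differentiableAt, by simp, ?_⟩
        rw [d2]
        have hfn : ContDiff ℝ n f := hf.of_le (by exact_mod_cast le_top)
        exact (i1.const_smul (-V)).add ((hfn.comp i1).smul (cross3_contDiff i1 i2))
  rw [contDiff_infty]
  exact fun n => (key n).1

theorem time_change (D : ℝ → ℝ) (hD : Continuous D) (hp : Function.Periodic D (2 * Real.pi))
    (hpos : ∀ t, 0 < D t) : ∃ (T : ℝ) (θ : ℝ → ℝ), 0 < T ∧ (∀ s, HasDerivAt θ (D (θ s)) s) ∧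
      ∀ s, θ (s + T) = θ s + 2 * Real.pi := by
  have hpi := Real.two_pi_pos
  let g : ℝ → ℝ := fun t => (D t)⁻¹
  have hg : Continuous g := hD.inv₀ fun t => (hpos t).ne'
  have hgp : Function.Periodic g (2 * Real.pi) := fun t => by simp only [g, hp t]
  have hgpos : ∀ t, 0 < g t := fun t => inv_pos.2 (hpos t)
  have hgi : ∀ a b, IntervalIntegrable g volume a b := fun a b => hg.intervalIntegrable a b
  let τ : ℝ → ℝ := fun t => ∫ x in (0:ℝ)..t, g x
  have hτ : ∀ t, HasDerivAt τ (g t) t := fun t => (hg.integral_hasStrictDerivAt 0 t).hasDerivAt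
  have hmono : StrictMono τ := strictMono_of_hasDerivAt_pos hτ hgpos
  have htop : Filter.Tendsto τ Filter.atTop Filter.atTop :=
    hgp.tendsto_atTop_intervalIntegral_of_pos' (hgi _ _) hgpos hpi
  have hbot : Filter.Tendsto τ Filter.atBot Filter.atBot :=
    hgp.tendsto_atBot_intervalIntegral_of_pos' (hgi _ _) hgpos hpi
  have hcont : Continuous τ := continuous_iff_continuousAt.2 fun t => (hτ t).continuousAt
  have hsurj := hcont.surjective htop hbot
  let e := StrictMono.orderIsoOfSurjective τ hmono hsurj
  have he : ∀ t, e t = τ t := fun t => rfl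
  have hes : ∀ s, τ (e.symm s) = s := fun s => e.apply_symm_apply s
  refine ⟨τ (2 * Real.pi), fun s => e.symm s, ?_, ?_, ?_⟩
  · have := hmono hpi
    simpa [τ] using this
  · intro s
    have h1 := HasDerivAt.of_local_left_inverse (f := τ) (g := fun s => e.symm s) (a := s)
      (f' := g (e.symm s)) e.symm.continuous.continuousAt (hτ _) (hgpos _).ne'
      (Filter.Eventually.of_forall hes)
    simpa [g] using h1
  · intro s
    apply hmono.injective
    rw [hes]
    have : τ (e.symm s + 2 * Real.pi) = τ (e.symm s) + τ (2 * Real.pi) := by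
      simp only [τ]
      rw [← intervalIntegral.integral_add_adjacent_intervals (hgi 0 (e.symm s)) (hgi _ _),
        hgp.intervalIntegral_add_eq (e.symm s) 0, zero_add]
    rw [this, hes]

theorem closed_of_chart (f : EuclideanSpace ℝ (Fin 3) → ℝ) (hf : ContDiff ℝ (⊤ : ℕ∞) f)
    (p : ℂ × ℂ) (hp : pn p = 1) (V : ℝ) (hV : 0 < V) (Z : ℝ → ℂ)
    (hper : Function.Periodic Z (2 * Real.pi))
    (hpos : ∀ t, 0 < f (Phi p (Z t)) + V * ((Z t).re * Real.sin t - (Z t).im * Real.cos t))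
    (hZ : ∀ t, HasDerivAt Z (((V * (mu (Z t) /
      (f (Phi p (Z t)) + V * ((Z t).re * Real.sin t - (Z t).im * Real.cos t))) : ℝ) : ℂ) *
        Complex.exp (t * Complex.I)) t) :
    ∃ T : ℝ, 0 < T ∧
          ∃ γ : ℝ → EuclideanSpace ℝ (Fin 3),
            ContDiff ℝ (⊤ : ℕ∞) γ ∧ Function.Periodic γ T ∧
            (∃ s₁ s₂ : ℝ, γ s₁ ≠ γ s₂) ∧
            ∀ s : ℝ,
              ‖γ s‖ = 1 ∧
              deriv (deriv γ) s =
                (-(‖deriv γ s‖ ^ 2)) • γ s + f (γ s) • cross3 (γ s) (deriv γ s) ∧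
              (1 / 2) * ‖deriv γ s‖ ^ 2 = V ^ 2 / 2 := by
  have hZc : Continuous Z := continuous_iff_continuousAt.2 fun s => (hZ s).continuousAt
  have hre := Complex.continuous_re.comp hZc
  have him := Complex.continuous_im.comp hZc
  simp only [Function.comp_def] at hre him
  have hmuc : Continuous (fun t => mu (Z t)) := by unfold mu; fun_prop
  have hmu0 : ∀ t, mu (Z t) ≠ 0 := fun t => (mu_pos _).ne'
  have hPc : Continuous (fun t => Phi p (Z t)) := by
    unfold Phi fvec
    have h1 : Continuous (fun t => 1 / mu (Z t) - 1) := (continuous_const.div hmuc hmu0).sub continuous_const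
    have h2 : Continuous (fun t => (Z t).re / mu (Z t)) := hre.div hmuc hmu0
    have h3 : Continuous (fun t => (Z t).im / mu (Z t)) := him.div hmuc hmu0
    fun_prop
  have hfc := hf.continuous
  obtain ⟨T, θ, hT, hθ, hθT⟩ := time_change
    (fun t => f (Phi p (Z t)) + V * ((Z t).re * Real.sin t - (Z t).im * Real.cos t))
    (by fun_prop) (by intro t; simp only [hper t, Real.sin_add_two_pi, Real.cos_add_two_pi]) hpos
  have hz : ∀ s, HasDerivAt (fun s => Z (θ s))
      (((V * mu (Z (θ s)) : ℝ) : ℂ) * Complex.exp (θ s * Complex.I)) s := by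
    intro s
    have := (hZ (θ s)).scomp s (hθ s)
    refine this.congr_deriv ?_
    have h0 := (hpos (θ s)).ne'
    rw [Complex.real_smul, ← mul_assoc, ← Complex.ofReal_mul]
    congr 2
    field_simp
  obtain ⟨W, hW1, hW2, hW3⟩ := curve_eq f p hp V hV (fun s => Z (θ s)) θ hz hθ
  have dγ : deriv (fun s => Phi p (Z (θ s))) = W := funext fun s => (hW1 s).deriv
  refine ⟨T, hT, fun s => Phi p (Z (θ s)), ?_, ?_, ?_, ?_⟩
  · apply smooth_of_ode f hf (V ^ 2) _ W hW1
    intro s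
    have := hW3 s
    rwa [hW2] at this
  · intro s
    simp only [hθT, hper (θ s)]
  · by_contra hcon
    push Not at hcon
    have : (fun s => Phi p (Z (θ s))) = fun _ => Phi p (Z (θ 0)) := funext fun s => hcon s 0
    have h1 := hW1 0
    rw [this] at h1
    have h2 := h1.unique (hasDerivAt_const _ _)
    have h3 := hW2 0
    rw [h2, norm_zero] at h3
    exact hV.ne h3
  · intro s
    refine ⟨Phi_norm p hp _, ?_, ?_⟩
    · rw [dγ]; exact (hW3 s).deriv
    · rw [dγ, hW2]; ring

/-- Right-hand side of the chart equation (divided by the speed). -/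
noncomputable def Gf (f : EuclideanSpace ℝ (Fin 3) → ℝ) (q : ℝ × (ℂ × ℂ) × ℂ × ℂ) : ℂ :=
  ((mu q.2.2.2 / (f (Phi q.2.1 q.2.2.2) +
    q.1 * (q.2.2.2.re * q.2.2.1.im - q.2.2.2.im * q.2.2.1.re)) : ℝ) : ℂ) * q.2.2.1

theorem contDiff_re' {E : Type*} [NormedAddCommGroup E] [NormedSpace ℝ E] {n : WithTop ℕ∞} {g : E → ℂ}
    (hg : ContDiff ℝ n g) : ContDiff ℝ n (fun x => (g x).re) := Complex.reCLM.contDiff.comp hg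

theorem contDiff_im' {E : Type*} [NormedAddCommGroup E] [NormedSpace ℝ E] {n : WithTop ℕ∞} {g : E → ℂ}
    (hg : ContDiff ℝ n g) : ContDiff ℝ n (fun x => (g x).im) := Complex.imCLM.contDiff.comp hg

theorem Gf_contDiffAt (f : EuclideanSpace ℝ (Fin 3) → ℝ) (hf : ContDiff ℝ (⊤ : ℕ∞) f)
    (q : ℝ × (ℂ × ℂ) × ℂ × ℂ) (hq : f (Phi q.2.1 q.2.2.2) +
    q.1 * (q.2.2.2.re * q.2.2.1.im - q.2.2.2.im * q.2.2.1.re) ≠ 0) :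
    ContDiffAt ℝ 1 (Gf f) q := by
  have zr : ContDiff ℝ 1 (fun q : ℝ × (ℂ × ℂ) × ℂ × ℂ => q.2.2.2.re) := contDiff_re' (by fun_prop)
  have zi : ContDiff ℝ 1 (fun q : ℝ × (ℂ × ℂ) × ℂ × ℂ => q.2.2.2.im) := contDiff_im' (by fun_prop)
  have ur : ContDiff ℝ 1 (fun q : ℝ × (ℂ × ℂ) × ℂ × ℂ => q.2.2.1.re) := contDiff_re' (by fun_prop)
  have ui : ContDiff ℝ 1 (fun q : ℝ × (ℂ × ℂ) × ℂ × ℂ => q.2.2.1.im) := contDiff_im' (by fun_prop)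
  have ar : ContDiff ℝ 1 (fun q : ℝ × (ℂ × ℂ) × ℂ × ℂ => q.2.1.1.re) := contDiff_re' (by fun_prop)
  have ai : ContDiff ℝ 1 (fun q : ℝ × (ℂ × ℂ) × ℂ × ℂ => q.2.1.1.im) := contDiff_im' (by fun_prop)
  have br : ContDiff ℝ 1 (fun q : ℝ × (ℂ × ℂ) × ℂ × ℂ => q.2.1.2.re) := contDiff_re' (by fun_prop)
  have bi : ContDiff ℝ 1 (fun q : ℝ × (ℂ × ℂ) × ℂ × ℂ => q.2.1.2.im) := contDiff_im' (by fun_prop)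
  have hmu : ContDiff ℝ 1 (fun q : ℝ × (ℂ × ℂ) × ℂ × ℂ => mu q.2.2.2) := by
    unfold mu; fun_prop
  have hmu0 : ∀ q : ℝ × (ℂ × ℂ) × ℂ × ℂ, mu q.2.2.2 ≠ 0 := fun q => (mu_pos _).ne'
  have hPhi : ContDiff ℝ 1 (fun q : ℝ × (ℂ × ℂ) × ℂ × ℂ => Phi q.2.1 q.2.2.2) := by
    unfold Phi
    have c1 : ContDiff ℝ 1 (fun q : ℝ × (ℂ × ℂ) × ℂ × ℂ => 1 / mu q.2.2.2 - 1) :=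
      (contDiff_const.div hmu hmu0).sub contDiff_const
    have c2 : ContDiff ℝ 1 (fun q : ℝ × (ℂ × ℂ) × ℂ × ℂ => q.2.2.2.re / mu q.2.2.2) := zr.div hmu hmu0
    have c3 : ContDiff ℝ 1 (fun q : ℝ × (ℂ × ℂ) × ℂ × ℂ => q.2.2.2.im / mu q.2.2.2) := zi.div hmu hmu0
    rw [contDiff_euclidean]
    intro i
    fin_cases i <;> simp only [fvec] <;> simp <;> fun_prop
  have hf1 : ContDiff ℝ 1 f := hf.of_le (by exact_mod_cast le_top)
  have hden : ContDiff ℝ 1 (fun q : ℝ × (ℂ × ℂ) × ℂ × ℂ => f (Phi q.2.1 q.2.2.2) +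
    q.1 * (q.2.2.2.re * q.2.2.1.im - q.2.2.2.im * q.2.2.1.re)) :=
    (hf1.comp hPhi).add (by fun_prop)
  have hd := (hmu.contDiffAt (x := q)).div hden.contDiffAt hq
  have hd' := (Complex.ofRealCLM.contDiff (n := 1)).contDiffAt.comp q hd
  exact hd'.mul (by fun_prop)

theorem im_bound (z u : ℂ) (hz : ‖z‖ ≤ 1) (hu : ‖u‖ = 1) :
    -1 ≤ z.re * u.im - z.im * u.re := by
  have h1 : (starRingEnd ℂ z * u).im = z.re * u.im - z.im * u.re := by simp; ring
  rw [← h1]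
  have h2 := Complex.abs_im_le_norm (starRingEnd ℂ z * u)
  rw [norm_mul, Complex.norm_conj, hu, mul_one] at h2
  linarith [(abs_le.1 h2).1]

theorem compact_P : IsCompact {p : ℂ × ℂ | pn p = 1} := by
  apply Metric.isCompact_of_isClosed_isBounded
  · apply isClosed_eq _ continuous_const
    unfold pn
    have := Complex.continuous_re
    have := Complex.continuous_im
    fun_prop
  · apply (Metric.isBounded_closedBall (x := (0 : ℂ × ℂ)) (r := 1)).subset
    intro p hp
    have hp' : p.1.re ^ 2 + p.1.im ^ 2 + p.2.re ^ 2 + p.2.im ^ 2 = 1 := hp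
    rw [mem_closedBall_zero_iff, Prod.norm_def, max_le_iff]
    constructor
    · have := Complex.sq_norm p.1
      rw [Complex.normSq_apply] at this
      nlinarith [norm_nonneg p.1, sq_nonneg p.2.re, sq_nonneg p.2.im]
    · have := Complex.sq_norm p.2
      rw [Complex.normSq_apply] at this
      nlinarith [norm_nonneg p.2, sq_nonneg p.1.re, sq_nonneg p.1.im]

/-- The compact set on which we use uniform estimates. -/
def Kset (m : ℝ) : Set (ℝ × (ℂ × ℂ) × ℂ × ℂ) :=
  Set.Icc 0 (m / 2) ×ˢ {p : ℂ × ℂ | pn p = 1} ×ˢ Metric.sphere (0 : ℂ) 1 ×ˢ Metric.closedBall (0 : ℂ) 1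

theorem Kset_den (f : EuclideanSpace ℝ (Fin 3) → ℝ) (m : ℝ)
    (hm : ∀ q : EuclideanSpace ℝ (Fin 3), ‖q‖ = 1 → m ≤ f q) (h0 : 0 < m)
    (q : ℝ × (ℂ × ℂ) × ℂ × ℂ) (hq : q ∈ Kset m) : 0 < f (Phi q.2.1 q.2.2.2) +
    q.1 * (q.2.2.2.re * q.2.2.1.im - q.2.2.2.im * q.2.2.1.re) := by
  obtain ⟨⟨h1, h2⟩, h3, h4, h5⟩ := hq
  rw [mem_sphere_zero_iff_norm] at h4
  rw [mem_closedBall_zero_iff] at h5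
  have := im_bound _ _ h5 h4
  have := hm _ (Phi_norm _ h3 q.2.2.2)
  nlinarith

theorem Gf_bounds (f : EuclideanSpace ℝ (Fin 3) → ℝ) (hf : ContDiff ℝ (⊤ : ℕ∞) f) (m : ℝ)
    (hm : ∀ q : EuclideanSpace ℝ (Fin 3), ‖q‖ = 1 → m ≤ f q) (h0 : 0 < m) :
    ∃ L M : ℝ, 0 ≤ L ∧ 0 ≤ M ∧ (∀ q ∈ Kset m, ∀ q' ∈ Kset m, ‖Gf f q - Gf f q'‖ ≤ L * dist q q') ∧
      (∀ q ∈ Kset m, ‖Gf f q‖ ≤ M) ∧ ContinuousOn (Gf f) (Kset m) := by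
  have hK : IsCompact (Kset m) :=
    isCompact_Icc.prod (compact_P.prod ((isCompact_sphere _ _).prod (isCompact_closedBall _ _)))
  have hc : ∀ q ∈ Kset m, ContDiffAt ℝ 1 (Gf f) q := fun q hq =>
    Gf_contDiffAt f hf q (Kset_den f m hm h0 q hq).ne'
  have hcont : ContinuousOn (Gf f) (Kset m) := fun q hq => (hc q hq).continuousAt.continuousWithinAt
  have hloc : LocallyLipschitzOn (Kset m) (Gf f) := by
    intro q hq
    obtain ⟨K, t, ht, hKt⟩ := (hc q hq).exists_lipschitzOnWith
    exact ⟨K, t, mem_nhdsWithin_of_mem_nhds ht, hKt⟩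
  obtain ⟨L, hL⟩ := hloc.exists_lipschitzOnWith_of_compact hK
  obtain ⟨M, hM⟩ := hK.exists_bound_of_continuousOn hcont
  refine ⟨L, max M 0, L.2, le_max_right _ _, ?_, fun q hq => (hM q hq).trans (le_max_left _ _), hcont⟩
  intro q hq q' hq'
  rw [← dist_eq_norm]
  exact hL.dist_le_mul q hq q' hq'

/-- Radial retraction onto the unit disc. -/
noncomputable def rho (z : ℂ) : ℂ := ((max 1 ‖z‖)⁻¹ : ℝ) * z

theorem rho_norm (z : ℂ) : ‖rho z‖ ≤ 1 := by
  have h : 0 < max 1 ‖z‖ := by positivity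
  rw [rho, norm_mul, Complex.norm_real, Real.norm_eq_abs, abs_of_pos (by positivity),
    inv_mul_le_iff₀ h, mul_one]
  exact le_max_right _ _

theorem rho_eq (z : ℂ) (hz : ‖z‖ ≤ 1) : rho z = z := by
  rw [rho, max_eq_left hz]; simp

theorem rho_rot (k z : ℂ) (hk : ‖k‖ = 1) : rho (k * z) = k * rho z := by
  rw [rho, rho, norm_mul, hk, one_mul]; ring

theorem rho_lip (z w : ℂ) : ‖rho z - rho w‖ ≤ 2 * ‖z - w‖ := by
  have ha : 0 < max 1 ‖z‖ := by positivity
  have hb : 0 < max 1 ‖w‖ := by positivity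
  have ha1 : 1 ≤ max 1 ‖z‖ := le_max_left _ _
  have hwb : ‖w‖ ≤ max 1 ‖w‖ := le_max_right _ _
  have hab : |max 1 ‖w‖ - max 1 ‖z‖| ≤ ‖z - w‖ := by
    have h1 := abs_max_sub_max_le_abs ‖w‖ ‖z‖ 1
    rw [max_comm, max_comm ‖z‖] at h1
    refine h1.trans ?_
    rw [abs_sub_comm]
    exact abs_norm_sub_norm_le z w
  have e : rho z - rho w = ((max 1 ‖z‖)⁻¹ : ℝ) * (z - w) +
      (((max 1 ‖w‖ - max 1 ‖z‖) * ((max 1 ‖z‖)⁻¹ * (max 1 ‖w‖)⁻¹) : ℝ) : ℂ) * w := by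
    have : (max 1 ‖w‖ - max 1 ‖z‖) * ((max 1 ‖z‖)⁻¹ * (max 1 ‖w‖)⁻¹) =
      (max 1 ‖z‖)⁻¹ - (max 1 ‖w‖)⁻¹ := by field_simp
    rw [this, rho, rho]; push_cast; ring
  rw [e]
  refine (norm_add_le _ _).trans ?_
  rw [norm_mul, norm_mul, Complex.norm_real, Complex.norm_real, Real.norm_eq_abs, Real.norm_eq_abs,
    abs_mul, abs_of_pos (a := (max 1 ‖z‖)⁻¹) (by positivity),
    abs_of_pos (a := (max 1 ‖z‖)⁻¹ * (max 1 ‖w‖)⁻¹) (by positivity)]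
  have hi : (max 1 ‖z‖)⁻¹ ≤ 1 := inv_le_one_of_one_le₀ ha1
  have hi0 : 0 < (max 1 ‖z‖)⁻¹ := by positivity
  have hj : (max 1 ‖w‖)⁻¹ * ‖w‖ ≤ 1 := by rw [inv_mul_le_iff₀ hb, mul_one]; exact hwb
  have hj0 : 0 ≤ (max 1 ‖w‖)⁻¹ * ‖w‖ := by positivity
  have h3 : (max 1 ‖z‖)⁻¹ * ‖z - w‖ ≤ 1 * ‖z - w‖ := by gcongr
  have h4 : |max 1 ‖w‖ - max 1 ‖z‖| * ((max 1 ‖z‖)⁻¹ * (max 1 ‖w‖)⁻¹) * ‖w‖ ≤ ‖z - w‖ * (1 * 1) := by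
    rw [mul_assoc, mul_assoc]
    gcongr
  linarith

theorem rho_cont : Continuous rho := by
  unfold rho
  have h : ∀ z : ℂ, max 1 ‖z‖ ≠ 0 := fun z => by positivity
  have : Continuous fun z : ℂ => (max 1 ‖z‖)⁻¹ :=
    (continuous_const.max continuous_norm).inv₀ h
  fun_prop

theorem Phi_rot (l : ℂ) (hl : ‖l‖ = 1) (p : ℂ × ℂ) (z : ℂ) :
    Phi (l * p.1, l * p.2) z = Phi p ((starRingEnd ℂ l) ^ 2 * z) := by
  have hl2 : l.re ^ 2 + l.im ^ 2 = 1 := by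
    have := Complex.sq_norm l
    rw [hl, Complex.normSq_apply] at this
    linarith
  have hmu : mu ((starRingEnd ℂ l) ^ 2 * z) = mu z := by
    have : mu ((starRingEnd ℂ l) ^ 2 * z) =
        (1 + (l.re ^ 2 + l.im ^ 2) ^ 2 * (z.re ^ 2 + z.im ^ 2)) / 2 := by
      simp [mu, pow_two]; ring
    rw [this, hl2, mu]; ring
  have key : ∀ A B C : ℝ, fvec (l * p.1, l * p.2) A B C = fvec p ((l.re ^ 2 + l.im ^ 2) * A)
      ((l.re ^ 2 - l.im ^ 2) * B + 2 * l.re * l.im * C)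
      ((l.re ^ 2 - l.im ^ 2) * C - 2 * l.re * l.im * B) := by
    intro A B C
    ext i
    fin_cases i <;> simp [fvec] <;> ring
  unfold Phi
  rw [hmu, key, hl2, one_mul]
  congr 1
  · simp [pow_two]; ring
  · simp [pow_two]; ring

theorem Gf_rot (f : EuclideanSpace ℝ (Fin 3) → ℝ) (V : ℝ) (p p' : ℂ × ℂ) (k : ℂ) (hk : ‖k‖ = 1)
    (h : ∀ z, Phi p' (k * z) = Phi p z) (u z : ℂ) :
    Gf f (V, p', k * u, k * z) = k * Gf f (V, p, u, z) := by
  have hl2 : k.re ^ 2 + k.im ^ 2 = 1 := by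
    have := Complex.sq_norm k
    rw [hk, Complex.normSq_apply] at this
    linarith
  have hmu : mu (k * z) = mu z := by
    have : mu (k * z) = (1 + (k.re ^ 2 + k.im ^ 2) * (z.re ^ 2 + z.im ^ 2)) / 2 := by
      simp [mu]; ring
    rw [this, hl2, mu]; ring
  have him : (k * z).re * (k * u).im - (k * z).im * (k * u).re = z.re * u.im - z.im * u.re := by
    have : (k * z).re * (k * u).im - (k * z).im * (k * u).re =
      (k.re ^ 2 + k.im ^ 2) * (z.re * u.im - z.im * u.re) := by simp; ring
    rw [this, hl2, one_mul]
  simp only [Gf]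
  rw [hmu, him, h]
  ring

abbrev XP := {p : ℂ × ℂ // pn p = 1}

set_option maxHeartbeats 400000 in
open scoped BoundedContinuousFunction in
theorem main_pos (f : EuclideanSpace ℝ (Fin 3) → ℝ) (hf : ContDiff ℝ (⊤ : ℕ∞) f)
    (hf0 : ∀ q : EuclideanSpace ℝ (Fin 3), ‖q‖ = 1 → 0 < f q) :
    ∃ k₀ : ℝ, 0 < k₀ ∧
      ∀ k : ℝ, k ∈ Set.Ioo 0 k₀ →
        ∃ T : ℝ, 0 < T ∧
          ∃ γ : ℝ → EuclideanSpace ℝ (Fin 3),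
            ContDiff ℝ (⊤ : ℕ∞) γ ∧ Function.Periodic γ T ∧
            (∃ s₁ s₂ : ℝ, γ s₁ ≠ γ s₂) ∧
            ∀ s : ℝ,
              ‖γ s‖ = 1 ∧
              deriv (deriv γ) s =
                (-(‖deriv γ s‖ ^ 2)) • γ s + f (γ s) • cross3 (γ s) (deriv γ s) ∧
              (1 / 2) * ‖deriv γ s‖ ^ 2 = k := by
  have hpi := Real.pi_pos
  obtain ⟨m, hm0, hm⟩ : ∃ m : ℝ, 0 < m ∧ ∀ q : EuclideanSpace ℝ (Fin 3), ‖q‖ = 1 → m ≤ f q := by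
    obtain ⟨q, hq, hmin⟩ := (isCompact_sphere (0 : EuclideanSpace ℝ (Fin 3)) 1).exists_isMinOn
      ((NormedSpace.sphere_nonempty (x := (0 : EuclideanSpace ℝ (Fin 3)))).2 zero_le_one) hf.continuous.continuousOn
    exact ⟨f q, hf0 q (by simpa using hq), fun q' hq' => hmin (by simpa using hq')⟩
  obtain ⟨L, M, hL0, hM0, hL, hM, hGc⟩ := Gf_bounds f hf m hm hm0
  obtain ⟨V₀, hV₀, hVm, hVL, hVM⟩ : ∃ V₀ : ℝ, 0 < V₀ ∧ V₀ ≤ m / 2 ∧ V₀ * (8 * Real.pi * (L + 1)) ≤ 1 ∧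
      V₀ * (2 * Real.pi * (M + 1)) ≤ 1 := by
    refine ⟨min (m / 2) (min (1 / (8 * Real.pi * (L + 1))) (1 / (2 * Real.pi * (M + 1)))),
      by positivity, min_le_left _ _, ?_, ?_⟩
    · rw [← le_div_iff₀ (by positivity)]
      exact (min_le_right _ _).trans (min_le_left _ _)
    · rw [← le_div_iff₀ (by positivity)]
      exact (min_le_right _ _).trans (min_le_right _ _)
  refine ⟨V₀ ^ 2 / 2, by positivity, ?_⟩
  rintro k ⟨hk0, hk⟩
  obtain ⟨V, hV, hVV₀, hVk⟩ : ∃ V : ℝ, 0 < V ∧ V ≤ V₀ ∧ V ^ 2 / 2 = k := by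
    refine ⟨Real.sqrt (2 * k), by positivity, ?_, ?_⟩
    · rw [Real.sqrt_le_left hV₀.le]; linarith
    · rw [Real.sq_sqrt (by positivity)]; ring
  rw [← hVk]
  have hVL' : V * (8 * Real.pi * (L + 1)) ≤ 1 := by
    refine le_trans ?_ hVL; gcongr
  have hVM' : V * (2 * Real.pi * (M + 1)) ≤ 1 := by
    refine le_trans ?_ hVM; gcongr
  let g : XP → ℝ → ℂ → ℂ := fun p t z => V * Gf f (V, p.1, Complex.exp (t * Complex.I), rho z)
  have hmem : ∀ (p : XP) (t : ℝ) (z : ℂ),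
      ((V, p.1, Complex.exp (t * Complex.I), rho z) : ℝ × (ℂ × ℂ) × ℂ × ℂ) ∈ Kset m := by
    intro p t z
    refine ⟨⟨hV.le, hVV₀.trans hVm⟩, p.2, ?_, ?_⟩
    · simp [Complex.norm_exp_ofReal_mul_I]
    · simpa using rho_norm z
  have hgcont : ∀ x, Continuous (fun q : ℝ × ℂ => g x q.1 q.2) := by
    intro x
    refine continuous_const.mul (hGc.comp_continuous ?_ (fun q => hmem x q.1 q.2))
    have := rho_cont
    fun_prop
  have hgB : ∀ x t z, ‖g x t z‖ ≤ V * M := by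
    intro x t z
    simp only [g]
    rw [norm_mul, Complex.norm_real, Real.norm_eq_abs, abs_of_pos hV]
    gcongr
    exact hM _ (hmem x t z)
  have hgL : ∀ x y t z w, ‖g x t z - g y t w‖ ≤ (2 * V * L) * (dist x y + ‖z - w‖) := by
    intro x y t z w
    simp only [g]
    rw [← mul_sub, norm_mul, Complex.norm_real, Real.norm_eq_abs, abs_of_pos hV]
    have h1 := hL _ (hmem x t z) _ (hmem y t w)
    have h2 : dist ((V, x.1, Complex.exp (t * Complex.I), rho z) : ℝ × (ℂ × ℂ) × ℂ × ℂ)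
        (V, y.1, Complex.exp (t * Complex.I), rho w) ≤ 2 * (dist x y + ‖z - w‖) := by
      have h3 := rho_lip z w
      have h4 : dist x.1 y.1 = dist x y := rfl
      have h5 := dist_nonneg (x := x) (y := y)
      have h6 := norm_nonneg (z - w)
      change max (dist V V) (max (dist x.1 y.1) (max (dist (Complex.exp (t * Complex.I))
        (Complex.exp (t * Complex.I))) (dist (rho z) (rho w)))) ≤ _
      rw [dist_self, dist_self, h4, dist_eq_norm (rho z)]
      refine max_le (by positivity) (max_le (by linarith) (max_le (by positivity) (by linarith)))
    calc V * ‖Gf f (V, x.1, Complex.exp (t * Complex.I), rho z) -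
          Gf f (V, y.1, Complex.exp (t * Complex.I), rho w)‖
        ≤ V * (L * (2 * (dist x y + ‖z - w‖))) := by
          gcongr
          exact h1.trans (by gcongr)
      _ = _ := by ring
  obtain ⟨Z, hZ, hZu, hZb, hZd⟩ := ls_fixed g (2 * V * L) (V * M) (by positivity)
    (by nlinarith) hgL hgB hgcont
  have hZ1 : ∀ x θ, ‖Z x θ‖ ≤ 1 := fun x θ => (hZb x θ).trans (by nlinarith)
  -- equivariance
  have hrot : ∀ (p p' : XP) (φ : ℝ), (∀ z, Phi p'.1 (Complex.exp (-(φ * Complex.I)) * z) = Phi p.1 z) →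
      (∀ t z, g p' t (Complex.exp (-(φ * Complex.I)) * z) =
        Complex.exp (-(φ * Complex.I)) * g p (t + φ) z) ∧
      ∀ t, Z p' t = Complex.exp (-(φ * Complex.I)) * Z p (t + φ) := by
    intro p p' φ h
    have hk : ‖Complex.exp (-(φ * Complex.I))‖ = 1 := by
      have := Complex.norm_exp_ofReal_mul_I (-φ)
      push_cast at this
      rwa [neg_mul] at this
    have h1 : ∀ t z, g p' t (Complex.exp (-(φ * Complex.I)) * z) =
        Complex.exp (-(φ * Complex.I)) * g p (t + φ) z := by
      intro t z
      simp only [g]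
      rw [rho_rot _ _ hk]
      have e : Complex.exp (t * Complex.I) = Complex.exp (-(φ * Complex.I)) *
          Complex.exp ((t + φ : ℝ) * Complex.I) := by
        rw [← Complex.exp_add]; congr 1; push_cast; ring
      rw [e, Gf_rot f V p.1 p'.1 _ hk h]
      ring
    refine ⟨h1, ?_⟩
    let y : ℝ →ᵇ ℂ := Complex.exp (-(φ * Complex.I)) •
      (Z p).compContinuous ⟨fun t => t + φ, by fun_prop⟩
    have hy : ∀ t, y t = Complex.exp (-(φ * Complex.I)) * Z p (t + φ) := fun t => rfl
    have hyZ : y = Z p' := by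
      apply hZu
      intro θ
      simp_rw [hy]
      rw [hZ p (θ + φ), ← intervalIntegral.integral_const_mul]
      congr 1
      funext τ
      rw [h1, add_right_comm]
      ring
    intro t
    rw [← hyZ, hy]
  have hper : ∀ p : XP, Function.Periodic (Z p) (2 * Real.pi) := by
    intro p t
    have := (hrot p p (2 * Real.pi) (by
      intro z; push_cast; rw [Complex.exp_neg, Complex.exp_two_pi_mul_I]; simp)).2 t
    push_cast at this
    rw [Complex.exp_neg, Complex.exp_two_pi_mul_I] at this
    simpa using this.symm
  have hhc : ∀ p : XP, Continuous (fun t => g p t (Z p t)) := by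
    intro p
    have h1 : Continuous (fun t : ℝ => ((t, Z p t) : ℝ × ℂ)) :=
      continuous_id.prodMk (Z p).continuous
    have h2 := hgcont p
    generalize g p = gp at h2 ⊢
    exact h2.comp h1
  have hhper : ∀ p : XP, Function.Periodic (fun t => g p t (Z p t)) (2 * Real.pi) := by
    intro p t
    have e : Complex.exp (((t + 2 * Real.pi : ℝ) : ℂ) * Complex.I) = Complex.exp (t * Complex.I) := by
      push_cast
      rw [add_mul, Complex.exp_add, Complex.exp_two_pi_mul_I, mul_one]
    simp only [g]
    rw [hper p t, e]
  let b : XP → ℂ := fun p => ∫ t in (0:ℝ)..(2 * Real.pi), g p t (Z p t)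
  have hbc : Continuous b := by
    have hlip : ∀ x y, dist (b x) (b y) ≤ (2 * V * L * 2 * (2 * Real.pi)) * dist x y := by
      intro x y
      simp only [b]
      rw [dist_eq_norm, ← intervalIntegral.integral_sub ((hhc x).intervalIntegrable _ _)
        ((hhc y).intervalIntegrable _ _)]
      have := intervalIntegral.norm_integral_le_of_norm_le_const (a := 0) (b := 2 * Real.pi)
        (C := 2 * V * L * (2 * dist x y)) (f := fun t => g x t (Z x t) - g y t (Z y t)) (by
          intro t _
          refine (hgL _ _ _ _ _).trans ?_
          gcongr
          have h1 := BoundedContinuousFunction.dist_coe_le_dist (f := Z x) (g := Z y) t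
          rw [dist_eq_norm] at h1
          linarith [hZd x y])
      rw [sub_zero, abs_of_pos (by positivity)] at this
      refine this.trans (le_of_eq (by ring))
    exact (LipschitzWith.of_dist_le_mul (K := (2 * V * L * 2 * (2 * Real.pi)).toNNReal) (by
      intro x y
      rw [Real.coe_toNNReal _ (by positivity)]
      exact hlip x y)).continuous
  have hbrot : ∀ (p p' : XP) (φ : ℝ), (∀ z, Phi p'.1 (Complex.exp (-(φ * Complex.I)) * z) = Phi p.1 z) →
      b p' = Complex.exp (-(φ * Complex.I)) * b p := by
    intro p p' φ h
    obtain ⟨h1, h2⟩ := hrot p p' φ h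
    simp only [b]
    simp_rw [h2, h1]
    rw [intervalIntegral.integral_const_mul]
    congr 1
    have e := intervalIntegral.integral_comp_add_right (a := 0) (b := 2 * Real.pi)
      (fun t => g p t (Z p t)) φ
    rw [e, zero_add, add_comm (2 * Real.pi) φ, (hhper p).intervalIntegral_add_eq φ 0, zero_add]
  -- existence of a zero of `b`
  obtain ⟨p, hp⟩ : ∃ p, b p = 0 := by
    have hs : ∀ w : ℂ, 0 < 1 + ‖w‖ ^ 2 := fun w => by positivity
    let r : ℂ → ℝ := fun w => (Real.sqrt (1 + ‖w‖ ^ 2))⁻¹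
    have hrc : Continuous r := by
      apply Continuous.inv₀ (by fun_prop)
      intro w; have := hs w; positivity
    have hr2 : ∀ w, r w ^ 2 * (1 + ‖w‖ ^ 2) = 1 := by
      intro w
      simp only [r]
      rw [inv_pow, Real.sq_sqrt (hs w).le, inv_mul_cancel₀ (hs w).ne']
    let pN : ℂ → XP := fun w => ⟨((r w : ℂ), (r w : ℂ) * w), by
      have := hr2 w
      rw [Complex.sq_norm, Complex.normSq_apply] at this
      simp [pn]
      linarith⟩
    let pS : ℂ → XP := fun w => ⟨((r w : ℂ) * w, (r w : ℂ)), by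
      have := hr2 w
      rw [Complex.sq_norm, Complex.normSq_apply] at this
      simp [pn]
      linarith⟩
    have hpN : Continuous pN := by
      apply Continuous.subtype_mk; fun_prop
    have hpS : Continuous pS := by
      apply Continuous.subtype_mk; fun_prop
    have := hairy (fun w => b (pN w)) (fun w => b (pS w)) (hbc.comp hpN) (hbc.comp hpS) (by
      intro s
      have hr := hbrot (pS (Complex.exp (-(s * Complex.I)))) (pN (Complex.exp (s * Complex.I))) (-2 * s) (by
        intro z
        have n1 := Complex.norm_exp_ofReal_mul_I s
        have n2 : ‖Complex.exp (-(s * Complex.I))‖ = 1 := by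
          have := Complex.norm_exp_ofReal_mul_I (-s)
          push_cast at this
          rwa [neg_mul] at this
        have hcj : (starRingEnd ℂ) (Complex.exp (s * Complex.I)) = Complex.exp (-(s * Complex.I)) := by
          rw [← Complex.exp_conj]; simp
        have hinv : Complex.exp (s * Complex.I) * Complex.exp (-(s * Complex.I)) = 1 := by
          rw [← Complex.exp_add]; simp
        have h1 : r (Complex.exp (s * Complex.I)) = r (Complex.exp (-(s * Complex.I))) := by
          simp only [r, n1, n2]
        have h2 : (pN (Complex.exp (s * Complex.I))).1 =
            (Complex.exp (s * Complex.I) * (pS (Complex.exp (-(s * Complex.I)))).1.1,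
             Complex.exp (s * Complex.I) * (pS (Complex.exp (-(s * Complex.I)))).1.2) := by
          simp only [pN, pS]
          rw [h1]
          refine Prod.ext ?_ ?_
          · simp only
            linear_combination (-(r (Complex.exp (-(s * Complex.I))) : ℂ)) * hinv
          · simp only
            ring
        rw [h2, Phi_rot _ n1, hcj]
        congr 1
        rw [← mul_assoc, ← Complex.exp_nat_mul, ← Complex.exp_add]
        have : ((2 : ℕ) : ℂ) * -(s * Complex.I) + -(((-2 * s : ℝ) : ℂ) * Complex.I) = 0 := by
          push_cast; ring
        rw [this]; simp)
      rw [hr]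
      congr 1
      rw [← Complex.exp_nat_mul]
      congr 1
      push_cast; ring)
    rcases this with ⟨w, hw⟩ | ⟨w, hw⟩
    · exact ⟨_, hw⟩
    · exact ⟨_, hw⟩
  have hder : ∀ t, HasDerivAt (Z p) (g p t (Z p t)) t := by
    intro t
    have h1 := ls_deriv (fun t => g p t (Z p t)) (hhc p) (hhper p) hp t
    have e : (Z p : ℝ → ℂ) = fun θ => ∫ τ in (0:ℝ)..(2 * Real.pi),
        ((τ / (2 * Real.pi) : ℝ) : ℂ) * g p (θ + τ) (Z p (θ + τ)) := funext fun θ => hZ p θ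
    exact h1.congr_of_eventuallyEq (Filter.Eventually.of_forall fun θ => hZ p θ)
  refine closed_of_chart f hf p.1 p.2 V hV (Z p) (hper p) ?_ ?_
  · intro t
    have := Kset_den f m hm hm0 _ (hmem p t (Z p t))
    rw [rho_eq _ (hZ1 p t)] at this
    simpa [Complex.exp_ofReal_mul_I_re, Complex.exp_ofReal_mul_I_im] using this
  · intro t
    refine (hder t).congr_deriv ?_
    simp only [g, Gf]
    rw [rho_eq _ (hZ1 p t), Complex.exp_ofReal_mul_I_re, Complex.exp_ofReal_mul_I_im]
    push_cast; ring

/-- For smooth `f : ℝ³ → ℝ` which is nowhere zero on the unit sphere, there is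
`k₀ > 0` such that for every `k ∈ (0, k₀)` there is a closed magnetic geodesic
with energy `k` on the round `S²`. -/
theorem closed_magnetic_geodesic_on_sphere_low_energy
    (f : EuclideanSpace ℝ (Fin 3) → ℝ) (hf : ContDiff ℝ (⊤ : ℕ∞) f)
    (hf0 : ∀ q : EuclideanSpace ℝ (Fin 3), ‖q‖ = 1 → f q ≠ 0) :
    ∃ k₀ : ℝ, 0 < k₀ ∧
      ∀ k : ℝ, k ∈ Set.Ioo 0 k₀ →
        ∃ T : ℝ, 0 < T ∧
          ∃ γ : ℝ → EuclideanSpace ℝ (Fin 3),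
            ContDiff ℝ (⊤ : ℕ∞) γ ∧ Function.Periodic γ T ∧
            (∃ s₁ s₂ : ℝ, γ s₁ ≠ γ s₂) ∧
            ∀ s : ℝ,
              ‖γ s‖ = 1 ∧
              deriv (deriv γ) s =
                (-(‖deriv γ s‖ ^ 2)) • γ s + f (γ s) • cross3 (γ s) (deriv γ s) ∧
              (1 / 2) * ‖deriv γ s‖ ^ 2 = k := by
  have hconn : IsPreconnected (Metric.sphere (0 : EuclideanSpace ℝ (Fin 3)) 1) := by
    apply isPreconnected_sphere
    rw [← Module.finrank_eq_rank, finrank_euclideanSpace_fin]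
    norm_num
  by_cases hneg : ∃ q : EuclideanSpace ℝ (Fin 3), ‖q‖ = 1 ∧ f q < 0
  · obtain ⟨q₀, hq₀, hfq₀⟩ := hneg
    have hall : ∀ q : EuclideanSpace ℝ (Fin 3), ‖q‖ = 1 → 0 < -f q := by
      intro q hq
      by_contra hcon
      have h1 : 0 ≤ f q := by linarith
      obtain ⟨x, hx, hx0⟩ := hconn.intermediate_value (a := q₀) (b := q) (by simpa using hq₀)
        (by simpa using hq) hf.continuous.continuousOn ⟨hfq₀.le, h1⟩
      exact hf0 x (by simpa using hx) hx0
    obtain ⟨k₀, hk₀, h⟩ := main_pos (fun q => -f q) hf.neg hall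
    refine ⟨k₀, hk₀, fun k hk => ?_⟩
    obtain ⟨T, hT, γ, h1, h2, ⟨s₁, s₂, h3⟩, h4⟩ := h k hk
    have d1 : deriv (fun s => γ (-s)) = fun s => -deriv γ (-s) := funext fun s => deriv_comp_neg γ s
    have d2 : ∀ s, deriv (deriv (fun s => γ (-s))) s = deriv (deriv γ) (-s) := by
      intro s
      rw [d1, deriv.fun_neg, deriv_comp_neg, neg_neg]
    refine ⟨T, hT, fun s => γ (-s), h1.comp contDiff_neg, ?_, ⟨-s₁, -s₂, by simpa using h3⟩, ?_⟩
    · intro s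
      have := h2 (-s - T)
      simp only [sub_add_cancel] at this
      simp only [neg_add']
      exact this.symm
    · intro s
      obtain ⟨a1, a2, a3⟩ := h4 (-s)
      refine ⟨a1, ?_, ?_⟩
      · rw [d2, a2, d1]
        simp only [norm_neg]
        congr 1
        ext i
        fin_cases i <;> simp [cross3] <;> ring
      · rw [d1]; simpa using a3
  · push Not at hneg
    exact main_pos f hf fun q hq => lt_of_le_of_ne (hneg q hq) (hf0 q hq).symm
end

section
/- Let f : ℝ² → ℝ be smooth with f(q+m) = f(q) for all m ∈ ℤ² and f(q) ≠ 0 for all q. Then there exists k₀ > 0 such that for every k ∈ (0, k₀) there exist T > 0 and a nonconstant smooth T-periodic curve γ : ℝ → ℝ² satisfying γ''(s) = f(γ(s))·J γ'(s) and ½‖γ'(s)‖² = k for all s ∈ ℝ, where J : ℝ² → ℝ² is the rotation by π/2, J(x,y) = (−y,x). -/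
open MeasureTheory

/-- Rotation by `π/2` on ℝ² (identified with `EuclideanSpace ℝ (Fin 2)`):
`J(x, y) = (-y, x)`. -/
noncomputable def rotJ (v : EuclideanSpace ℝ (Fin 2)) : EuclideanSpace ℝ (Fin 2) :=
  (EuclideanSpace.equiv (Fin 2) ℝ).symm ![-(v 1), v 0]

namespace MagTorus

lemma exists_red {β : Type*} (h : ℂ → β) (h1 : Function.Periodic h 1)
    (hI : Function.Periodic h Complex.I) (z : ℂ) :
    ∃ w ∈ (Set.Icc (0:ℝ) 1) ×ℂ (Set.Icc (0:ℝ) 1), h w = h z := by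
  refine ⟨z + ((-⌊z.re⌋ : ℤ) : ℂ) * 1 + ((-⌊z.im⌋ : ℤ) : ℂ) * Complex.I, ?_, ?_⟩
  · rw [Complex.mem_reProdIm]
    simp only [Set.mem_Icc]
    have a1 := Int.floor_le z.re
    have a2 := (Int.lt_floor_add_one z.re).le
    have b1 := Int.floor_le z.im
    have b2 := (Int.lt_floor_add_one z.im).le
    simp
    refine ⟨⟨?_, ?_⟩, ?_, ?_⟩ <;> linarith
  · rw [(hI.int_mul _) _, (h1.int_mul _) _]

lemma exists_max (h : ℂ → ℝ) (hc : Continuous h) (h1 : Function.Periodic h 1)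
    (hI : Function.Periodic h Complex.I) : ∃ z, ∀ w, h w ≤ h z := by
  have hK : IsCompact ((Set.Icc (0:ℝ) 1) ×ℂ (Set.Icc (0:ℝ) 1)) :=
    isCompact_Icc.reProdIm isCompact_Icc
  obtain ⟨w0, hw0, -⟩ := exists_red h h1 hI 0
  obtain ⟨z, -, hz⟩ := hK.exists_isMaxOn ⟨w0, hw0⟩ hc.continuousOn
  refine ⟨z, fun w => ?_⟩
  obtain ⟨w', hw', e⟩ := exists_red h h1 hI w
  rw [← e]
  exact hz hw'

lemma par_int_hasFDerivAt {G : Type*} [NormedAddCommGroup G] [NormedSpace ℝ G]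
    (F : ℂ → ℝ → G) (hF : ContDiff ℝ 1 (Function.uncurry F)) (z : ℂ) :
    HasFDerivAt (fun z => ∫ t in (0:ℝ)..1, F z t)
      (∫ t in (0:ℝ)..1, fderiv ℝ (fun z => F z t) z) z := by
  have hc : Continuous (fun p : ℂ × ℝ => fderiv ℝ (fun z => F z p.2) p.1) := by
    have : ContDiff ℝ 0 (fun p : ℂ × ℝ => fderiv ℝ (fun z => F z p.2) p.1) := by
      refine ContDiff.fderiv (m := 1) (f := fun (p : ℂ × ℝ) z => F z p.2) ?_ contDiff_fst (by simp)
      exact hF.comp (contDiff_snd.prodMk (contDiff_snd.comp contDiff_fst))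
    exact this.continuous
  have hFc : Continuous (Function.uncurry F) := hF.continuous
  have hK : IsCompact ((Metric.closedBall z 1) ×ˢ (Set.Icc (0:ℝ) 1)) :=
    (isCompact_closedBall z 1).prod isCompact_Icc
  obtain ⟨C, hC⟩ := hK.exists_bound_of_continuousOn hc.continuousOn
  refine intervalIntegral.hasFDerivAt_integral_of_dominated_of_fderiv_le (𝕜 := ℝ)
    (s := Metric.closedBall z 1) (bound := fun _ => C)
    (F := F) (F' := fun z t => fderiv ℝ (fun z => F z t) z)
    (Metric.closedBall_mem_nhds z one_pos) ?_ ?_ ?_ ?_ ?_ ?_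
  · refine Filter.Eventually.of_forall fun x => ?_
    exact (hFc.comp (continuous_const.prodMk continuous_id)).aestronglyMeasurable
  · exact (hFc.comp (continuous_const.prodMk continuous_id)).intervalIntegrable _ _
  · exact (hc.comp (continuous_const.prodMk continuous_id)).aestronglyMeasurable
  · refine Filter.Eventually.of_forall fun t ht x hx => ?_
    rw [Set.uIoc_of_le zero_le_one] at ht
    exact hC (x, t) ⟨hx, ⟨ht.1.le, ht.2⟩⟩
  · simp
  · refine Filter.Eventually.of_forall fun t ht x hx => ?_
    have : Differentiable ℝ (fun z => F z t) :=
      (hF.comp (contDiff_id.prodMk contDiff_const)).differentiable (by simp)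
    exact (this x).hasFDerivAt

lemma par_int_contDiff_two (F : ℂ → ℝ → ℝ) (hF : ContDiff ℝ 2 (Function.uncurry F)) :
    ContDiff ℝ 2 (fun z => ∫ t in (0:ℝ)..1, F z t) := by
  have h1 : ContDiff ℝ 1 (Function.uncurry F) := hF.of_le (by norm_num)
  have hd : ContDiff ℝ 1 (fun p : ℂ × ℝ => fderiv ℝ (fun z => F z p.2) p.1) := by
    refine ContDiff.fderiv (m := 2) (f := fun (p : ℂ × ℝ) z => F z p.2) ?_ contDiff_fst
      (by norm_num)
    exact hF.comp (contDiff_snd.prodMk (contDiff_snd.comp contDiff_fst))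
  have e1 : (2 : WithTop ℕ∞) = 1 + 1 := by norm_num
  rw [e1, contDiff_succ_iff_fderiv]
  refine ⟨fun z => (par_int_hasFDerivAt F h1 z).differentiableAt, by simp, ?_⟩
  have e2 : fderiv ℝ (fun z => ∫ t in (0:ℝ)..1, F z t) =
      fun z => ∫ t in (0:ℝ)..1, fderiv ℝ (fun z => F z t) z := by
    ext1 z
    exact (par_int_hasFDerivAt F h1 z).fderiv
  rw [e2, contDiff_one_iff_fderiv]
  have h2 := fun z => par_int_hasFDerivAt (fun z t => fderiv ℝ (fun z => F z t) z) hd z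
  refine ⟨fun z => (h2 z).differentiableAt, ?_⟩
  have e3 : fderiv ℝ (fun z => ∫ t in (0:ℝ)..1, fderiv ℝ (fun z => F z t) z) =
      fun z => ∫ t in (0:ℝ)..1, fderiv ℝ (fun z => fderiv ℝ (fun z => F z t) z) z := by
    ext1 z
    exact (h2 z).fderiv
  rw [e3]
  apply intervalIntegral.continuous_parametric_intervalIntegral_of_continuous'
  have : ContDiff ℝ 0 (fun p : ℂ × ℝ => fderiv ℝ (fun z => fderiv ℝ (fun z => F z p.2) z) p.1) := by
    refine ContDiff.fderiv (m := 1) (f := fun (p : ℂ × ℝ) z => fderiv ℝ (fun z => F z p.2) z) ?_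
      contDiff_fst (by simp)
    exact hd.comp (contDiff_snd.prodMk (contDiff_snd.comp contDiff_fst))
  exact this.continuous

lemma exists_primitive (f : ℂ → ℝ) (hf : ContDiff ℝ (⊤ : ℕ∞) f)
    (h1 : Function.Periodic f 1) (hI : Function.Periodic f Complex.I) :
    ∃ A : ℂ → ℝ, ContDiff ℝ 2 A ∧ (∀ z, fderiv ℝ A z 1 = f z) ∧
      (∀ z, A (z + Complex.I) = A z) ∧
      ∃ B : ℝ → ℝ, Continuous B ∧ ∀ z, A (z + 1) = A z + B z.im := by
  have hfc : Continuous f := hf.continuous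
  set A : ℂ → ℝ := fun z => ∫ t in (0:ℝ)..1, z.re * f (t * z.re + z.im * Complex.I) with hA
  have hA' : ∀ z, A z = ∫ s in (0:ℝ)..z.re, f (s + z.im * Complex.I) := by
    intro z
    have := intervalIntegral.mul_integral_comp_mul_right (a := 0) (b := 1)
      (f := fun s : ℝ => f (s + z.im * Complex.I)) z.re
    simp only [hA, intervalIntegral.integral_const_mul]
    simpa using this
  have hfy : ∀ y : ℝ, Continuous (fun s : ℝ => f (s + y * Complex.I)) := by
    intro y
    exact hfc.comp (by fun_prop)
  have hA2 : ContDiff ℝ 2 A := by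
    apply par_int_contDiff_two (fun z t => z.re * f (t * z.re + z.im * Complex.I))
    have hre : ContDiff ℝ 2 (fun p : ℂ × ℝ => p.1.re) := Complex.reCLM.contDiff.comp contDiff_fst
    have him : ContDiff ℝ 2 (fun p : ℂ × ℝ => p.1.im) := Complex.imCLM.contDiff.comp contDiff_fst
    have ho : ∀ {u : ℂ × ℝ → ℝ}, ContDiff ℝ 2 u → ContDiff ℝ 2 (fun p => (u p : ℂ)) :=
      fun hu => Complex.ofRealCLM.contDiff.comp hu
    refine hre.mul (((contDiff_infty.1 hf 2)).comp ?_)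
    exact ((ho contDiff_snd).mul (ho hre)).add ((ho him).mul contDiff_const)
  refine ⟨A, hA2, ?_, ?_, fun y => ∫ s in (0:ℝ)..1, f (s + y * Complex.I), ?_, ?_⟩
  · intro z
    have d1 : HasDerivAt (fun x : ℝ => A (x + z.im * Complex.I)) (f z) z.re := by
      have e : (fun x : ℝ => A (x + z.im * Complex.I)) =
          fun x : ℝ => ∫ s in (0:ℝ)..x, f (s + z.im * Complex.I) := by
        ext x
        rw [hA']
        simp
      rw [e]
      have := intervalIntegral.integral_hasDerivAt_right ((hfy z.im).intervalIntegrable 0 z.re)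
        ((hfy z.im).stronglyMeasurableAtFilter _ _) (hfy z.im).continuousAt
      simpa using this
    have d2 : HasDerivAt (fun x : ℝ => (x + z.im * Complex.I : ℂ)) 1 z.re := by
      simpa using (Complex.ofRealCLM.hasDerivAt (x := z.re)).add_const (z.im * Complex.I)
    have d3 : HasFDerivAt A (fderiv ℝ A z) ((z.re : ℂ) + z.im * Complex.I) := by
      rw [Complex.re_add_im]
      exact ((hA2.differentiable (by norm_num)) z).hasFDerivAt
    have d4 : HasDerivAt (fun x : ℝ => A (x + z.im * Complex.I)) (fderiv ℝ A z 1) z.re :=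
      HasFDerivAt.comp_hasDerivAt (l := A) (f := fun x : ℝ => (x + z.im * Complex.I : ℂ)) z.re d3 d2
    exact d4.unique d1
  · intro z
    rw [hA', hA']
    simp only [Complex.add_re, Complex.I_re, add_zero, Complex.add_im, Complex.I_im]
    congr 1
    ext s
    rw [← hI (s + z.im * Complex.I)]
    congr 1
    push_cast
    ring
  · apply intervalIntegral.continuous_parametric_intervalIntegral_of_continuous'
    exact hfc.comp (by fun_prop)
  · intro z
    rw [hA', hA']
    simp only [Complex.add_re, Complex.one_re, Complex.add_im, Complex.one_im, add_zero]
    rw [← intervalIntegral.integral_add_adjacent_intervals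
      ((hfy z.im).intervalIntegrable 0 z.re) ((hfy z.im).intervalIntegrable z.re (z.re + 1))]
    congr 1
    have hp : Function.Periodic (fun s : ℝ => f (s + z.im * Complex.I)) 1 := by
      intro s
      simp only
      rw [← h1 (s + z.im * Complex.I)]
      congr 1
      push_cast
      ring
    simpa using hp.intervalIntegral_add_eq z.re 0

end MagTorus
namespace MagTorus

/-- the unit vector of angle `t` -/
noncomputable def ee (t : ℝ) : ℂ := Complex.exp (t * Complex.I)

lemma ee_norm (t : ℝ) : ‖ee t‖ = 1 := Complex.norm_exp_ofReal_mul_I t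

lemma ee_re (t : ℝ) : (ee t).re = Real.cos t := Complex.exp_ofReal_mul_I_re t

lemma ee_im (t : ℝ) : (ee t).im = Real.sin t := Complex.exp_ofReal_mul_I_im t

lemma ee_cont : Continuous ee := by unfold ee; fun_prop

lemma ee_per : Function.Periodic ee (2 * Real.pi) := by
  intro t
  unfold ee
  push_cast
  rw [add_mul, Complex.exp_periodic]

/-- the Lagrange multiplier -/
noncomputable def lam (g : ℂ → ℝ) (v : ℝ) (q : ℝ → ℂ) : ℂ :=
  -(v : ℂ) * (∫ t in (0:ℝ)..(2 * Real.pi), (g (q t) : ℂ) * ee t) /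
    ((∫ t in (0:ℝ)..(2 * Real.pi), g (q t) : ℝ) : ℂ)

/-- the velocity -/
noncomputable def vel (g : ℂ → ℝ) (v : ℝ) (q : ℝ → ℂ) (t : ℝ) : ℂ :=
  (g (q t) : ℂ) * (v * ee t + lam g v q)

section
variable {g : ℂ → ℝ} {m M L v : ℝ}

lemma den_ge (hg : Continuous g) (hm : ∀ z, m ≤ g z) {q : ℝ → ℂ} (hq : Continuous q) :
    2 * Real.pi * m ≤ ∫ t in (0:ℝ)..(2 * Real.pi), g (q t) := by
  have h := intervalIntegral.integral_mono_on (μ := volume) (a := 0) (b := 2 * Real.pi)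
    (f := fun _ => m) (g := fun t => g (q t)) (by positivity) (by simp)
    ((hg.comp hq).intervalIntegrable _ _) (fun t _ => hm _)
  simpa using h

lemma num_le (hg : Continuous g) (h0 : ∀ z, 0 ≤ g z) {q : ℝ → ℂ} (hq : Continuous q) :
    ‖∫ t in (0:ℝ)..(2 * Real.pi), (g (q t) : ℂ) * ee t‖ ≤
      ∫ t in (0:ℝ)..(2 * Real.pi), g (q t) := by
  refine intervalIntegral.norm_integral_le_of_norm_le (by positivity) ?_
    ((hg.comp hq).intervalIntegrable _ _)
  refine Filter.Eventually.of_forall fun t _ => ?_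
  rw [norm_mul, ee_norm, mul_one, Complex.norm_real, Real.norm_of_nonneg (h0 _)]

lemma lam_norm (hg : Continuous g) (hm0 : 0 < m) (hm : ∀ z, m ≤ g z) (hv : 0 < v)
    {q : ℝ → ℂ} (hq : Continuous q) : ‖lam g v q‖ ≤ v := by
  have hd := den_ge hg hm hq
  have hn := num_le hg (fun z => hm0.le.trans (hm z)) hq
  have hp := Real.pi_pos
  have hd0 : 0 < ∫ t in (0:ℝ)..(2 * Real.pi), g (q t) := lt_of_lt_of_le (by positivity) hd
  unfold lam
  rw [norm_div, norm_mul, norm_neg, Complex.norm_real, Complex.norm_real,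
    Real.norm_of_nonneg hv.le, Real.norm_of_nonneg hd0.le, div_le_iff₀ hd0]
  gcongr

lemma vel_cont (hg : Continuous g) {q : ℝ → ℂ} (hq : Continuous q) :
    Continuous (vel g v q) := by
  have := ee_cont
  unfold vel
  fun_prop

lemma vel_per {q : ℝ → ℂ} (hq : Function.Periodic q (2 * Real.pi)) :
    Function.Periodic (vel g v q) (2 * Real.pi) := by
  intro t
  unfold vel
  rw [hq, ee_per]

lemma vel_mean (hg : Continuous g) (hm0 : 0 < m) (hm : ∀ z, m ≤ g z)
    {q : ℝ → ℂ} (hq : Continuous q) :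
    ∫ t in (0:ℝ)..(2 * Real.pi), vel g v q t = 0 := by
  have hd := den_ge hg hm hq
  have hp := Real.pi_pos
  have hd0 : 0 < ∫ t in (0:ℝ)..(2 * Real.pi), g (q t) := lt_of_lt_of_le (by positivity) hd
  have hgq : Continuous (fun t => (g (q t) : ℂ)) := by fun_prop
  have e : ∀ t, vel g v q t = (v : ℂ) * ((g (q t) : ℂ) * ee t) + (g (q t) : ℂ) * lam g v q := by
    intro t
    unfold vel
    ring
  simp_rw [e]
  have c1 : Continuous (fun t => (v : ℂ) * ((g (q t) : ℂ) * ee t)) :=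
    continuous_const.mul (hgq.mul ee_cont)
  have c2 : Continuous (fun t => (g (q t) : ℂ) * lam g v q) := hgq.mul continuous_const
  rw [intervalIntegral.integral_add (c1.intervalIntegrable _ _) (c2.intervalIntegrable _ _),
    intervalIntegral.integral_const_mul, intervalIntegral.integral_mul_const,
    intervalIntegral.integral_ofReal]
  unfold lam
  have : ((∫ t in (0:ℝ)..(2 * Real.pi), g (q t) : ℝ) : ℂ) ≠ 0 := by exact_mod_cast hd0.ne'
  field_simp
  ring

lemma lam_lip (hg : Continuous g) (hm0 : 0 < m) (hm : ∀ z, m ≤ g z) (hv : 0 < v)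
    (hL : ∀ z w, |g z - g w| ≤ L * ‖z - w‖) (hL0 : 0 ≤ L)
    {q p : ℝ → ℂ} (hq : Continuous q) (hp : Continuous p) {D : ℝ}
    (hD : ∀ t, ‖q t - p t‖ ≤ D) : ‖lam g v q - lam g v p‖ ≤ v * (2 * L / m) * D := by
  have hpi := Real.pi_pos
  have hd := den_ge hg hm hq
  have hd' := den_ge hg hm hp
  have hn := num_le hg (fun z => hm0.le.trans (hm z)) hp
  have hgq : Continuous (fun t => (g (q t) : ℂ)) := by fun_prop
  have hgp : Continuous (fun t => (g (p t) : ℂ)) := by fun_prop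
  have hgqp : ∀ t, |g (q t) - g (p t)| ≤ L * D := fun t =>
    (hL _ _).trans (mul_le_mul_of_nonneg_left (hD t) hL0)
  have hdd : |(∫ t in (0:ℝ)..(2 * Real.pi), g (q t)) - ∫ t in (0:ℝ)..(2 * Real.pi), g (p t)|
      ≤ L * D * (2 * Real.pi) := by
    have c1 : Continuous (fun t => g (q t)) := hg.comp hq
    have c2 : Continuous (fun t => g (p t)) := hg.comp hp
    rw [← intervalIntegral.integral_sub (c1.intervalIntegrable _ _) (c2.intervalIntegrable _ _)]
    have := intervalIntegral.norm_integral_le_of_norm_le_const (a := 0) (b := 2 * Real.pi)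
      (f := fun t => g (q t) - g (p t)) (C := L * D) (fun t _ => hgqp t)
    rwa [sub_zero, abs_of_pos (by positivity : 0 < 2 * Real.pi)] at this
  have hnn : ‖(∫ t in (0:ℝ)..(2 * Real.pi), (g (q t) : ℂ) * ee t) -
      ∫ t in (0:ℝ)..(2 * Real.pi), (g (p t) : ℂ) * ee t‖ ≤ L * D * (2 * Real.pi) := by
    have c1 : Continuous (fun t => (g (q t) : ℂ) * ee t) := hgq.mul ee_cont
    have c2 : Continuous (fun t => (g (p t) : ℂ) * ee t) := hgp.mul ee_cont
    rw [← intervalIntegral.integral_sub (c1.intervalIntegrable _ _) (c2.intervalIntegrable _ _)]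
    have := intervalIntegral.norm_integral_le_of_norm_le_const (a := 0) (b := 2 * Real.pi)
      (f := fun t => (g (q t) : ℂ) * ee t - (g (p t) : ℂ) * ee t) (C := L * D) (fun t _ => by
        rw [← sub_mul, norm_mul, ee_norm, mul_one, ← Complex.ofReal_sub, Complex.norm_real]
        exact hgqp t)
    rwa [sub_zero, abs_of_pos (by positivity : 0 < 2 * Real.pi)] at this
  unfold lam
  generalize (∫ t in (0:ℝ)..(2 * Real.pi), (g (q t) : ℂ) * ee t) = n1 at *
  generalize (∫ t in (0:ℝ)..(2 * Real.pi), (g (p t) : ℂ) * ee t) = n2 at *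
  generalize (∫ t in (0:ℝ)..(2 * Real.pi), g (q t)) = d1 at *
  generalize (∫ t in (0:ℝ)..(2 * Real.pi), g (p t)) = d2 at *
  have h1 : 0 < d1 := lt_of_lt_of_le (by positivity) hd
  have h2 : 0 < d2 := lt_of_lt_of_le (by positivity) hd'
  have h1c : (d1 : ℂ) ≠ 0 := by exact_mod_cast h1.ne'
  have h2c : (d2 : ℂ) ≠ 0 := by exact_mod_cast h2.ne'
  have e : -(v : ℂ) * n1 / d1 - -(v : ℂ) * n2 / d2 =
      -(v : ℂ) * ((n1 - n2) - n2 / d2 * ((d1 - d2 : ℝ) : ℂ)) / d1 := by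
    push_cast
    field_simp
    ring
  have hr : ‖n2 / d2‖ ≤ 1 := by
    rw [norm_div, Complex.norm_real, Real.norm_of_nonneg h2.le, div_le_one h2]
    exact hn
  have hD0 : 0 ≤ D := (norm_nonneg _).trans (hD 0)
  have hX : ‖(n1 - n2) - n2 / d2 * ((d1 - d2 : ℝ) : ℂ)‖ ≤ 2 * (L * D * (2 * Real.pi)) := by
    refine (norm_sub_le _ _).trans ?_
    rw [norm_mul, Complex.norm_real, Real.norm_eq_abs]
    have : ‖n2 / d2‖ * |d1 - d2| ≤ 1 * (L * D * (2 * Real.pi)) :=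
      mul_le_mul hr hdd (abs_nonneg _) zero_le_one
    linarith
  rw [e, norm_div, norm_mul, norm_neg, Complex.norm_real, Complex.norm_real,
    Real.norm_of_nonneg hv.le, Real.norm_of_nonneg h1.le, div_le_iff₀ h1]
  calc v * ‖(n1 - n2) - n2 / d2 * ((d1 - d2 : ℝ) : ℂ)‖ ≤ v * (2 * (L * D * (2 * Real.pi))) := by
        gcongr
    _ = v * (2 * L / m) * D * (2 * Real.pi * m) := by field_simp
    _ ≤ v * (2 * L / m) * D * d1 := by gcongr

lemma vel_lip (hg : Continuous g) (hm0 : 0 < m) (hm : ∀ z, m ≤ g z) (hM : ∀ z, g z ≤ M)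
    (hv : 0 < v) (hL : ∀ z w, |g z - g w| ≤ L * ‖z - w‖) (hL0 : 0 ≤ L)
    {q p : ℝ → ℂ} (hq : Continuous q) (hp : Continuous p) {D : ℝ}
    (hD : ∀ t, ‖q t - p t‖ ≤ D) (t : ℝ) :
    ‖vel g v q t - vel g v p t‖ ≤ v * (2 * L + M * (2 * L / m)) * D := by
  have h1 := lam_lip hg hm0 hm hv hL hL0 hq hp hD
  have h2 := lam_norm hg hm0 hm hv hq
  have hD0 : 0 ≤ D := (norm_nonneg _).trans (hD 0)
  have e : vel g v q t - vel g v p t =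
      ((g (q t) - g (p t) : ℝ) : ℂ) * (v * ee t + lam g v q) +
      (g (p t) : ℂ) * (lam g v q - lam g v p) := by
    unfold vel
    push_cast
    ring
  rw [e]
  refine (norm_add_le _ _).trans ?_
  rw [norm_mul, norm_mul, Complex.norm_real, Complex.norm_real, Real.norm_eq_abs,
    Real.norm_of_nonneg (hm0.le.trans (hm _))]
  have h3 : ‖v * ee t + lam g v q‖ ≤ 2 * v := by
    refine (norm_add_le _ _).trans ?_
    rw [norm_mul, ee_norm, Complex.norm_real, Real.norm_of_nonneg hv.le]
    linarith
  have h4 : |g (q t) - g (p t)| ≤ L * D :=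
    (hL _ _).trans (mul_le_mul_of_nonneg_left (hD t) hL0)
  have h5 : |g (q t) - g (p t)| * ‖v * ee t + lam g v q‖ ≤ L * D * (2 * v) := by gcongr
  have h6 : g (p t) * ‖lam g v q - lam g v p‖ ≤ M * (v * (2 * L / m) * D) := by
    have := hM (p t)
    have hM0 : 0 ≤ M := hm0.le.trans ((hm 0).trans (hM 0))
    gcongr
  calc _ ≤ L * D * (2 * v) + M * (v * (2 * L / m) * D) := add_le_add h5 h6
    _ = _ := by ring

/-- the fixed point operator -/
noncomputable def Phi (g : ℂ → ℝ) (v : ℝ) (c : ℂ) (q : ℝ → ℂ) (t : ℝ) : ℂ :=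
  c + (∫ s in (0:ℝ)..t, vel g v q s) -
    (1 / (2 * Real.pi) : ℂ) * ∫ u in (0:ℝ)..(2 * Real.pi), ∫ s in (0:ℝ)..u, vel g v q s

lemma Phi_hasDerivAt (hg : Continuous g) {q : ℝ → ℂ} (hq : Continuous q) (c : ℂ) (t : ℝ) :
    HasDerivAt (Phi g v c q) (vel g v q t) t := by
  have hc := vel_cont (v := v) hg hq
  have := intervalIntegral.integral_hasDerivAt_right (hc.intervalIntegrable 0 t)
    (hc.stronglyMeasurableAtFilter _ _) hc.continuousAt
  exact (this.const_add c).sub_const _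

lemma Phi_cont (hg : Continuous g) {q : ℝ → ℂ} (hq : Continuous q) (c : ℂ) :
    Continuous (Phi g v c q) :=
  continuous_iff_continuousAt.2 fun t => (Phi_hasDerivAt hg hq c t).continuousAt

lemma Phi_per (hg : Continuous g) (hm0 : 0 < m) (hm : ∀ z, m ≤ g z)
    {q : ℝ → ℂ} (hq : Continuous q) (hqp : Function.Periodic q (2 * Real.pi)) (c : ℂ) :
    Function.Periodic (Phi g v c q) (2 * Real.pi) := by
  intro t
  have hc := vel_cont (v := v) hg hq
  unfold Phi
  rw [← intervalIntegral.integral_add_adjacent_intervals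
      (hc.intervalIntegrable 0 t) (hc.intervalIntegrable t (t + 2 * Real.pi)),
    (vel_per hqp).intervalIntegral_add_eq t 0, zero_add, vel_mean hg hm0 hm hq, add_zero]

lemma Phi_mean (hg : Continuous g) {q : ℝ → ℂ} (hq : Continuous q) (c : ℂ) :
    ∫ t in (0:ℝ)..(2 * Real.pi), Phi g v c q t = 2 * Real.pi * c := by
  have hc := vel_cont (v := v) hg hq
  have hi : Continuous (fun t => ∫ s in (0:ℝ)..t, vel g v q s) :=
    intervalIntegral.continuous_primitive (fun a b => hc.intervalIntegrable a b) 0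
  have hpi : (Real.pi : ℂ) ≠ 0 := by exact_mod_cast Real.pi_ne_zero
  unfold Phi
  have c1 : Continuous (fun t => c + ∫ s in (0:ℝ)..t, vel g v q s) := continuous_const.add hi
  rw [intervalIntegral.integral_sub (c1.intervalIntegrable _ _) (by simp),
    intervalIntegral.integral_add (by simp) (hi.intervalIntegrable _ _)]
  simp only [intervalIntegral.integral_const, sub_zero, Complex.real_smul]
  push_cast
  field_simp
  ring

lemma Phi_lip (hg : Continuous g) (hm0 : 0 < m) (hm : ∀ z, m ≤ g z) (hM : ∀ z, g z ≤ M)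
    (hv : 0 < v) (hL : ∀ z w, |g z - g w| ≤ L * ‖z - w‖) (hL0 : 0 ≤ L)
    (hsm : v * (2 * L + M * (2 * L / m)) * (4 * Real.pi) ≤ 1 / 2)
    {q p : ℝ → ℂ} (hq : Continuous q) (hp : Continuous p)
    (hqp : Function.Periodic q (2 * Real.pi)) (hpp : Function.Periodic p (2 * Real.pi)) {D : ℝ}
    (hD : ∀ t, ‖q t - p t‖ ≤ D) (c : ℂ) (t : ℝ) :
    ‖Phi g v c q t - Phi g v c p t‖ ≤ 1 / 2 * D := by
  have hpi := Real.pi_pos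
  have hD0 : 0 ≤ D := (norm_nonneg _).trans (hD 0)
  have hper : Function.Periodic (fun t => Phi g v c q t - Phi g v c p t) (2 * Real.pi) := by
    intro t
    simp only
    rw [Phi_per hg hm0 hm hq hqp, Phi_per hg hm0 hm hp hpp]
  obtain ⟨s, hs, e⟩ := hper.exists_mem_Ico₀ (by positivity) t
  rw [e]
  set R := v * (2 * L + M * (2 * L / m)) * D with hR
  have hR0 : 0 ≤ R := by
    have hM0 : 0 ≤ M := hm0.le.trans ((hm 0).trans (hM 0))
    positivity
  have hw := fun t => vel_lip hg hm0 hm hM hv hL hL0 hq hp hD t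
  have hcq := vel_cont (v := v) hg hq
  have hcp := vel_cont (v := v) hg hp
  have k1 : ∀ u ∈ Set.Icc 0 (2 * Real.pi), ‖(∫ s in (0:ℝ)..u, vel g v q s) -
      ∫ s in (0:ℝ)..u, vel g v p s‖ ≤ R * (2 * Real.pi) := by
    intro u hu
    rw [← intervalIntegral.integral_sub (hcq.intervalIntegrable _ _) (hcp.intervalIntegrable _ _)]
    refine (intervalIntegral.norm_integral_le_of_norm_le_const (fun t _ => hw t)).trans ?_
    rw [sub_zero, abs_of_nonneg hu.1]
    exact mul_le_mul_of_nonneg_left hu.2 hR0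
  have hiq : Continuous (fun t => ∫ s in (0:ℝ)..t, vel g v q s) :=
    intervalIntegral.continuous_primitive (fun a b => hcq.intervalIntegrable a b) 0
  have hip : Continuous (fun t => ∫ s in (0:ℝ)..t, vel g v p s) :=
    intervalIntegral.continuous_primitive (fun a b => hcp.intervalIntegrable a b) 0
  have k2 : ‖(∫ u in (0:ℝ)..(2 * Real.pi), ∫ s in (0:ℝ)..u, vel g v q s) -
      ∫ u in (0:ℝ)..(2 * Real.pi), ∫ s in (0:ℝ)..u, vel g v p s‖ ≤
      R * (2 * Real.pi) * (2 * Real.pi) := by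
    rw [← intervalIntegral.integral_sub (hiq.intervalIntegrable _ _) (hip.intervalIntegrable _ _)]
    refine (intervalIntegral.norm_integral_le_of_norm_le_const (C := R * (2 * Real.pi))
      (fun t ht => ?_)).trans ?_
    · rw [Set.uIoc_of_le (by positivity)] at ht
      exact k1 t ⟨ht.1.le, ht.2⟩
    · rw [sub_zero, abs_of_pos (by positivity : 0 < 2 * Real.pi)]
  have k3 := k1 s ⟨hs.1, hs.2.le⟩
  have e2 : Phi g v c q s - Phi g v c p s =
    ((∫ s in (0:ℝ)..s, vel g v q s) - ∫ s in (0:ℝ)..s, vel g v p s) -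
    (1 / (2 * Real.pi) : ℂ) * ((∫ u in (0:ℝ)..(2 * Real.pi), ∫ s in (0:ℝ)..u, vel g v q s) -
      ∫ u in (0:ℝ)..(2 * Real.pi), ∫ s in (0:ℝ)..u, vel g v p s) := by
    unfold Phi
    ring
  rw [e2]
  refine (norm_sub_le _ _).trans ?_
  rw [norm_mul]
  have e3 : ‖(1 / (2 * Real.pi) : ℂ)‖ = 1 / (2 * Real.pi) := by
    have : (1 / (2 * Real.pi) : ℂ) = ((1 / (2 * Real.pi) : ℝ) : ℂ) := by push_cast; rfl
    rw [this, Complex.norm_real, Real.norm_of_nonneg (by positivity)]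
  rw [e3]
  calc _ ≤ R * (2 * Real.pi) + 1 / (2 * Real.pi) * (R * (2 * Real.pi) * (2 * Real.pi)) := by
        gcongr
    _ = v * (2 * L + M * (2 * L / m)) * (4 * Real.pi) * D := by
        rw [hR]
        field_simp
        ring
    _ ≤ 1 / 2 * D := by gcongr

open BoundedContinuousFunction in
lemma exists_fixed (hg : Continuous g) (hm0 : 0 < m) (hm : ∀ z, m ≤ g z) (hM : ∀ z, g z ≤ M)
    (hv : 0 < v) (hL : ∀ z w, |g z - g w| ≤ L * ‖z - w‖) (hL0 : 0 ≤ L)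
    (hsm : v * (2 * L + M * (2 * L / m)) * (4 * Real.pi) ≤ 1 / 2) (c : ℂ) :
    ∃ q : ℝ → ℂ, Continuous q ∧ Function.Periodic q (2 * Real.pi) ∧ q = Phi g v c q := by
  have hpi := Real.pi_pos
  let S : Set (ℝ →ᵇ ℂ) := {q | ∀ t, q (t + 2 * Real.pi) = q t}
  have hS : IsClosed S := by
    simp only [S, Set.ofPred_forall]
    exact isClosed_iInter fun t => isClosed_eq (continuous_eval_const _) (continuous_eval_const _)
  have : CompleteSpace S := hS.completeSpace_coe
  have : Nonempty S := ⟨⟨0, fun t => rfl⟩⟩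
  have hb : ∀ q : S, ∃ C, ∀ t, ‖Phi g v c q.1 t‖ ≤ C := by
    intro q
    have := (Phi_per (v := v) hg hm0 hm q.1.continuous q.2 c).isBounded_of_continuous
      (by positivity) (Phi_cont hg q.1.continuous c)
    obtain ⟨C, hC⟩ := this.exists_norm_le
    exact ⟨C, fun t => hC _ ⟨t, rfl⟩⟩
  choose C hC using hb
  let F : S → S := fun q => ⟨BoundedContinuousFunction.ofNormedAddCommGroup
    (Phi g v c q.1) (Phi_cont hg q.1.continuous c) (C q) (hC q),
    Phi_per (v := v) hg hm0 hm q.1.continuous q.2 c⟩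
  have hF : ContractingWith (1 / 2) F := by
    refine ⟨by norm_num, LipschitzWith.of_dist_le_mul fun q p => ?_⟩
    rw [Subtype.dist_eq, BoundedContinuousFunction.dist_le (by positivity)]
    intro t
    rw [dist_eq_norm]
    refine (Phi_lip hg hm0 hm hM hv hL hL0 hsm q.1.continuous p.1.continuous q.2 p.2
      (D := dist q p) (fun t => ?_) c t).trans ?_
    · rw [← dist_eq_norm]
      exact BoundedContinuousFunction.dist_coe_le_dist t
    · simp
  have hfix := hF.fixedPoint_isFixedPt
  refine ⟨(hF.fixedPoint F).1, (hF.fixedPoint F).1.continuous, (hF.fixedPoint F).2, ?_⟩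
  have h2 : ((F (hF.fixedPoint F)).1 : ℝ → ℂ) = (hF.fixedPoint F).1 := by rw [hfix]
  exact h2.symm

lemma fixed_lip (hg : Continuous g) (hm0 : 0 < m) (hm : ∀ z, m ≤ g z) (hM : ∀ z, g z ≤ M)
    (hv : 0 < v) (hL : ∀ z w, |g z - g w| ≤ L * ‖z - w‖) (hL0 : 0 ≤ L)
    (hsm : v * (2 * L + M * (2 * L / m)) * (4 * Real.pi) ≤ 1 / 2)
    {q p : ℝ → ℂ} (hq : Continuous q) (hp : Continuous p)
    (hqp : Function.Periodic q (2 * Real.pi)) (hpp : Function.Periodic p (2 * Real.pi))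
    {c d : ℂ} (eq : q = Phi g v c q) (ep : p = Phi g v d p) (t : ℝ) :
    ‖q t - p t‖ ≤ 2 * ‖c - d‖ := by
  have hpi := Real.pi_pos
  have hper : Function.Periodic (fun t => q t - p t) (2 * Real.pi) := by
    intro t
    simp only
    rw [hqp, hpp]
  obtain ⟨s, -, hs⟩ := isCompact_Icc.exists_isMaxOn (s := Set.Icc 0 (2 * Real.pi))
    ⟨0, by simp; positivity⟩ (hq.sub hp).norm.continuousOn
  have hmax : ∀ u, ‖q u - p u‖ ≤ ‖q s - p s‖ := by
    intro u
    obtain ⟨u', hu', e⟩ := hper.exists_mem_Ico₀ (by positivity) u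
    rw [e]
    exact hs ⟨hu'.1, hu'.2.le⟩
  have h1 := Phi_lip hg hm0 hm hM hv hL hL0 hsm hq hp hqp hpp hmax c s
  have e : q s - p s = (Phi g v c q s - Phi g v c p s) + (c - d) := by
    have a1 : q s = Phi g v c q s := congrFun eq s
    have a2 : p s = Phi g v d p s := congrFun ep s
    have a3 : Phi g v d p s = Phi g v c p s + (d - c) := by
      unfold Phi
      ring
    rw [a3] at a2
    linear_combination a1 - a2
  have h2 := norm_add_le (Phi g v c q s - Phi g v c p s) (c - d)
  rw [← e] at h2
  have := hmax t
  linarith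

end

/-- Lyapunov-Schmidt reduction: the family of solutions up to a constant multiplier. -/
lemma reduction {g : ℂ → ℝ} {m M L : ℝ} (hg : Continuous g) (hm0 : 0 < m) (hm : ∀ z, m ≤ g z)
    (hM : ∀ z, g z ≤ M) (hL : ∀ z w, |g z - g w| ≤ L * ‖z - w‖) (hL0 : 0 ≤ L) :
    ∃ v₀ : ℝ, 0 < v₀ ∧ ∀ v ∈ Set.Ioo 0 v₀, ∃ (q W : ℂ → ℝ → ℂ) (l : ℂ → ℂ),
      (∀ c t, HasDerivAt (q c) (W c t) t) ∧
      (∀ c t, W c t = (g (q c t) : ℂ) * (v * ee t + l c)) ∧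
      (∀ c, Continuous (W c)) ∧
      (∀ c, Function.Periodic (q c) (2 * Real.pi)) ∧
      (∀ c, ∫ t in (0:ℝ)..(2 * Real.pi), q c t = 2 * Real.pi * c) ∧
      (∀ c d t, ‖q c t - q d t‖ ≤ 2 * ‖c - d‖) ∧
      (∀ c d t, ‖W c t - W d t‖ ≤ ‖c - d‖) ∧
      (∀ p, Function.Periodic g p → ∀ c t, q (c + p) t = q c t + p ∧ W (c + p) t = W c t) := by
  have hpi := Real.pi_gt_three
  have hM0 : 0 ≤ M := hm0.le.trans ((hm 0).trans (hM 0))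
  set Q := 2 * L + M * (2 * L / m) with hQ
  have hQ0 : 0 ≤ Q := by positivity
  refine ⟨1 / (2 * (Q + 1) * (4 * Real.pi)), by positivity, ?_⟩
  rintro v ⟨hv, hv'⟩
  have hsm : v * Q * (4 * Real.pi) ≤ 1 / 2 := by
    rw [lt_div_iff₀ (by positivity)] at hv'
    have : 0 ≤ v * (4 * Real.pi) := by positivity
    nlinarith
  choose q hqc hqp hq using exists_fixed hg hm0 hm hM hv hL hL0 hsm
  have hlip : ∀ c d t, ‖q c t - q d t‖ ≤ 2 * ‖c - d‖ := fun c d t =>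
    fixed_lip hg hm0 hm hM hv hL hL0 hsm (hqc c) (hqc d) (hqp c) (hqp d) (hq c) (hq d) t
  refine ⟨q, fun c => vel g v (q c), fun c => lam g v (q c), ?_, ?_, ?_, hqp, ?_, hlip, ?_, ?_⟩
  · intro c t
    have := Phi_hasDerivAt (v := v) hg (hqc c) c t
    rwa [← hq c] at this
  · intro c t
    rfl
  · intro c
    exact vel_cont hg (hqc c)
  · intro c
    have := Phi_mean (v := v) hg (hqc c) c
    rwa [← hq c] at this
  · intro c d t
    refine (vel_lip hg hm0 hm hM hv hL hL0 (hqc c) (hqc d) (hlip c d) t).trans ?_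
    rw [← hQ]
    have h1 : v * Q * 2 ≤ 1 := by
      have : 0 ≤ v * Q := by positivity
      nlinarith
    have := mul_le_mul_of_nonneg_right h1 (norm_nonneg (c - d))
    linarith
  · intro p hp c
    have hl : lam g v (fun t => q c t + p) = lam g v (q c) := by
      unfold lam
      simp_rw [hp (q c _)]
    have hvel : vel g v (fun t => q c t + p) = vel g v (q c) := by
      ext t
      unfold vel
      rw [hl, hp]
    have hphi : (fun t => q c t + p) = Phi g v (c + p) (fun t => q c t + p) := by
      ext t
      have a1 : q c t = Phi g v c (q c) t := congrFun (hq c) t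
      rw [a1]
      unfold Phi
      rw [hvel]
      ring
    have key : ∀ t, q (c + p) t = q c t + p := by
      intro t
      have := fixed_lip hg hm0 hm hM hv hL hL0 hsm (hqc (c + p)) ((hqc c).add continuous_const)
        (hqp (c + p)) (fun t => by rw [Pi.add_apply, hqp]; rfl) (hq (c + p)) hphi t
      rw [sub_self, norm_zero, mul_zero] at this
      exact sub_eq_zero.1 (norm_le_zero_iff.1 this)
    intro t
    refine ⟨key t, ?_⟩
    have e : q (c + p) = fun t => q c t + p := funext key
    simp only
    rw [e, hvel]

end MagTorus
namespace MagTorus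

lemma integral_re_im {δ : ℝ → ℂ} (hδ : Continuous δ) {h : ℂ}
    (hi : ∫ t in (0:ℝ)..(2 * Real.pi), δ t = 2 * Real.pi * h) :
    (∫ t in (0:ℝ)..(2 * Real.pi), (δ t).re = 2 * Real.pi * h.re) ∧
    (∫ t in (0:ℝ)..(2 * Real.pi), (δ t).im = 2 * Real.pi * h.im) := by
  have h1 := Complex.reCLM.intervalIntegral_comp_comm
    (hδ.intervalIntegrable (μ := volume) 0 (2 * Real.pi))
  have h2 := Complex.imCLM.intervalIntegral_comp_comm
    (hδ.intervalIntegrable (μ := volume) 0 (2 * Real.pi))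
  rw [hi] at h1 h2
  simp only [Complex.reCLM_apply, Complex.imCLM_apply] at h1 h2
  rw [h1, h2]
  simp

lemma taylor {A : ℂ → ℝ} (hA : ContDiff ℝ 2 A) (R : ℝ) :
    ∃ C₁ C₂ : ℝ, 0 ≤ C₁ ∧ 0 ≤ C₂ ∧ ∀ z z' : ℂ, ‖z‖ ≤ R → ‖z'‖ ≤ R →
      |A z' - A z - fderiv ℝ A z (z' - z)| ≤ C₁ * ‖z' - z‖ ^ 2 ∧ ‖fderiv ℝ A z‖ ≤ C₂ := by
  have hd : ContDiff ℝ 1 (fderiv ℝ A) := hA.fderiv_right (by norm_num)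
  have hK : IsCompact (Metric.closedBall (0:ℂ) R) := isCompact_closedBall _ _
  obtain ⟨C₁, h1⟩ := hd.contDiffOn.exists_lipschitzOnWith (by norm_num)
    (convex_closedBall (0:ℂ) R) hK
  obtain ⟨C₂, h2⟩ := hK.exists_bound_of_continuousOn hd.continuous.continuousOn
  refine ⟨C₁, |C₂|, C₁.2, abs_nonneg _, fun z z' hz hz' => ⟨?_, ?_⟩⟩
  · have := Convex.norm_image_sub_le_of_norm_fderiv_le' (𝕜 := ℝ) (f := A) (φ := fderiv ℝ A z)
      (C := C₁ * ‖z' - z‖) (x := z) (y := z')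
      (s := Metric.closedBall (0:ℂ) R ∩ Metric.closedBall z ‖z' - z‖)
      (fun x _ => (hA.differentiable (by norm_num)) x) ?_
      ((convex_closedBall _ _).inter (convex_closedBall _ _)) ?_ ?_
    · rw [Real.norm_eq_abs] at this
      refine this.trans (le_of_eq ?_)
      ring
    · rintro x ⟨hx, hx'⟩
      have := h1.dist_le_mul x hx z (by simpa using hz)
      rw [dist_eq_norm] at this
      refine this.trans ?_
      gcongr
      exact hx'
    · simpa using hz
    · simpa [dist_eq_norm] using hz'
  · exact (h2 z (by simpa using hz)).trans (le_abs_self _)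

/-- the reduced action -/
noncomputable def act (A : ℂ → ℝ) (v : ℝ) (q W : ℝ → ℂ) : ℝ :=
  ∫ t in (0:ℝ)..(2 * Real.pi),
    (A (q t) * (W t).im - v * ((q t).re * Real.sin t - (q t).im * Real.cos t))

lemma first_variation {f g A : ℂ → ℝ} (hfg : ∀ z, f z * g z = 1) (hA : ContDiff ℝ 2 A)
    (hAf : ∀ z, fderiv ℝ A z 1 = f z) {v : ℝ} {q W : ℂ → ℝ → ℂ} {l : ℂ → ℂ}
    (hq : ∀ c t, HasDerivAt (q c) (W c t) t)
    (hW : ∀ c t, W c t = (g (q c t) : ℂ) * (v * ee t + l c))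
    (hWc : ∀ c, Continuous (W c))
    (hqp : ∀ c, Function.Periodic (q c) (2 * Real.pi))
    (hmean : ∀ c, ∫ t in (0:ℝ)..(2 * Real.pi), q c t = 2 * Real.pi * c)
    (hql : ∀ c d t, ‖q c t - q d t‖ ≤ 2 * ‖c - d‖)
    (hWl : ∀ c d t, ‖W c t - W d t‖ ≤ ‖c - d‖) (c : ℂ) :
    ∃ C : ℝ, ∀ h : ℂ, ‖h‖ ≤ 1 →
      |act A v (q (c + h)) (W (c + h)) - act A v (q c) (W c) -
        2 * Real.pi * (h.re * (l c).im - h.im * (l c).re)| ≤ C * ‖h‖ ^ 2 := by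
  have hpi := Real.pi_pos
  have hqc : ∀ c, Continuous (q c) := fun c =>
    continuous_iff_continuousAt.2 fun t => (hq c t).continuousAt
  have hAc : Continuous A := hA.continuous
  have hdA : Continuous (fderiv ℝ A) := (hA.fderiv_right (m := 1) (by norm_num)).continuous
  have hI : IsCompact (Set.Icc 0 (2 * Real.pi)) := isCompact_Icc
  obtain ⟨R0, hR0⟩ := hI.exists_bound_of_continuousOn (hqc c).continuousOn
  obtain ⟨R1, hR1⟩ := hI.exists_bound_of_continuousOn (hWc c).continuousOn
  have hR1' : 0 ≤ R1 := (norm_nonneg _).trans (hR1 0 (by simp; positivity))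
  obtain ⟨C₁, C₂, hC1, hC2, hT⟩ := taylor hA (R0 + 2)
  refine ⟨(C₁ * 4 * (R1 + 1) + C₂ * 2) * (2 * Real.pi), fun h hh => ?_⟩
  set δ : ℝ → ℂ := fun t => q (c + h) t - q c t with hδ
  set w : ℝ → ℂ := fun t => W (c + h) t - W c t with hw
  have hδd : ∀ t, HasDerivAt δ (w t) t := fun t => (hq _ t).sub (hq _ t)
  have hδc : Continuous δ := (hqc _).sub (hqc _)
  have hwc : Continuous w := (hWc _).sub (hWc _)
  have hδn : ∀ t, ‖δ t‖ ≤ 2 * ‖h‖ := by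
    intro t
    simpa using hql (c + h) c t
  have hwn : ∀ t, ‖w t‖ ≤ ‖h‖ := by
    intro t
    simpa using hWl (c + h) c t
  have hδi : ∫ t in (0:ℝ)..(2 * Real.pi), δ t = 2 * Real.pi * h := by
    simp only [hδ]
    rw [intervalIntegral.integral_sub ((hqc _).intervalIntegrable _ _)
      ((hqc _).intervalIntegrable _ _), hmean, hmean]
    ring
  obtain ⟨hre, him⟩ := integral_re_im hδc hδi
  set Z : ℝ → ℝ := fun t => fderiv ℝ A (q c t) (W c t) * (δ t).im + A (q c t) * (w t).im with hZ
  have hZc : Continuous Z := by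
    have h1 : Continuous (fun t => fderiv ℝ A (q c t) (W c t)) :=
      (hdA.comp (hqc c)).clm_apply (hWc c)
    have := hqc c
    have := hWc c
    fun_prop
  have hZi : ∫ t in (0:ℝ)..(2 * Real.pi), Z t = 0 := by
    have hd : ∀ t, HasDerivAt (fun t => A (q c t) * (δ t).im) (Z t) t := by
      intro t
      have d1 : HasDerivAt (fun t => A (q c t)) (fderiv ℝ A (q c t) (W c t)) t :=
        HasFDerivAt.comp_hasDerivAt (l := A) (f := q c) t
          ((hA.differentiable (by norm_num)) _).hasFDerivAt (hq c t)
      have d2 : HasDerivAt (fun t => (δ t).im) (w t).im t :=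
        HasFDerivAt.comp_hasDerivAt (l := Complex.imCLM) (f := δ) t
          Complex.imCLM.hasFDerivAt (hδd t)
      exact d1.mul d2
    rw [intervalIntegral.integral_eq_sub_of_hasDerivAt (fun t _ => hd t)
      (hZc.intervalIntegrable _ _)]
    have e1 : q c (2 * Real.pi) = q c 0 := by simpa using hqp c 0
    have e2 : q (c + h) (2 * Real.pi) = q (c + h) 0 := by simpa using hqp (c + h) 0
    simp only [hδ, e1, e2, sub_self]
  set a1 : ℝ → ℝ := fun t => A (q (c + h) t) * (W (c + h) t).im -
    v * ((q (c + h) t).re * Real.sin t - (q (c + h) t).im * Real.cos t) with ha1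
  set a0 : ℝ → ℝ := fun t => A (q c t) * (W c t).im -
    v * ((q c t).re * Real.sin t - (q c t).im * Real.cos t) with ha0
  have ha1c : Continuous a1 := by
    have := hqc (c + h)
    have := hWc (c + h)
    fun_prop
  have ha0c : Continuous a0 := by
    have := hqc c
    have := hWc c
    fun_prop
  set b : ℝ → ℝ := fun t => (δ t).re * (l c).im - (δ t).im * (l c).re with hb
  have hbc : Continuous b := by fun_prop
  have hbi : ∫ t in (0:ℝ)..(2 * Real.pi), b t =
      2 * Real.pi * (h.re * (l c).im - h.im * (l c).re) := by
    have c1 : Continuous (fun t => (δ t).re * (l c).im) := by fun_prop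
    have c2 : Continuous (fun t => (δ t).im * (l c).re) := by fun_prop
    simp only [hb]
    rw [intervalIntegral.integral_sub (c1.intervalIntegrable _ _) (c2.intervalIntegrable _ _),
      intervalIntegral.integral_mul_const, intervalIntegral.integral_mul_const, hre, him]
    ring
  have hX : ∫ t in (0:ℝ)..(2 * Real.pi), (a1 t - a0 t - b t - Z t) =
      act A v (q (c + h)) (W (c + h)) - act A v (q c) (W c) -
        2 * Real.pi * (h.re * (l c).im - h.im * (l c).re) := by
    have c1 : Continuous (fun t => a1 t - a0 t) := ha1c.sub ha0c
    have c2 : Continuous (fun t => a1 t - a0 t - b t) := c1.sub hbc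
    rw [intervalIntegral.integral_sub (c2.intervalIntegrable _ _) (hZc.intervalIntegrable _ _),
      intervalIntegral.integral_sub (c1.intervalIntegrable _ _) (hbc.intervalIntegrable _ _),
      intervalIntegral.integral_sub (ha1c.intervalIntegrable _ _) (ha0c.intervalIntegrable _ _),
      hZi, hbi, sub_zero]
    rfl
  rw [← hX]
  have hbound : ∀ t ∈ Set.uIoc 0 (2 * Real.pi), ‖a1 t - a0 t - b t - Z t‖ ≤
      (C₁ * 4 * (R1 + 1) + C₂ * 2) * ‖h‖ ^ 2 := by
    intro t ht
    rw [Set.uIoc_of_le (by positivity)] at ht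
    have ht' : t ∈ Set.Icc 0 (2 * Real.pi) := ⟨ht.1.le, ht.2⟩
    have k0 := hR0 t ht'
    have k1 := hR1 t ht'
    have kd := hδn t
    have kw := hwn t
    have eq' : q (c + h) t = q c t + δ t := by simp [hδ]
    have eW' : W (c + h) t = W c t + w t := by simp [hw]
    have k2 : ‖q (c + h) t‖ ≤ R0 + 2 := by
      rw [eq']
      refine (norm_add_le _ _).trans ?_
      linarith
    obtain ⟨T1, T2⟩ := hT (q c t) (q (c + h) t) (by linarith) k2
    have ed : q (c + h) t - q c t = δ t := rfl
    rw [ed] at T1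
    have hlin : ∀ ξ : ℂ, fderiv ℝ A (q c t) ξ =
        f (q c t) * ξ.re + fderiv ℝ A (q c t) Complex.I * ξ.im := by
      intro ξ
      have e : ξ = ξ.re • (1:ℂ) + ξ.im • Complex.I := by
        simp [Complex.re_add_im]
      conv_lhs => rw [e]
      rw [map_add, map_smul, map_smul, hAf]
      simp only [smul_eq_mul]
      ring
    have hWt : ((f (q c t) : ℝ) : ℂ) * W c t = v * ee t + l c := by
      rw [hW, ← mul_assoc, ← Complex.ofReal_mul, hfg]
      simp
    have hWre : f (q c t) * (W c t).re = v * Real.cos t + (l c).re := by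
      have := congrArg Complex.re hWt
      simpa [ee_re] using this
    have hWim : f (q c t) * (W c t).im = v * Real.sin t + (l c).im := by
      have := congrArg Complex.im hWt
      simpa [ee_im] using this
    have ident : a1 t - a0 t - b t - Z t =
        (A (q (c + h) t) - A (q c t) - fderiv ℝ A (q c t) (δ t)) * (W c t + w t).im +
          fderiv ℝ A (q c t) (δ t) * (w t).im := by
      simp only [ha1, ha0, hb, hZ]
      rw [eW', hlin (δ t), hlin (W c t)]
      rw [eq']
      simp only [Complex.add_re, Complex.add_im]
      linear_combination (δ t).re * hWim - (δ t).im * hWre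
    rw [ident, Real.norm_eq_abs]
    refine (abs_add_le _ _).trans ?_
    rw [abs_mul, abs_mul]
    have m1 : |(W c t + w t).im| ≤ R1 + 1 := by
      refine (Complex.abs_im_le_norm _).trans ((norm_add_le _ _).trans ?_)
      linarith
    have m2 : |(w t).im| ≤ ‖h‖ := (Complex.abs_im_le_norm _).trans kw
    have m3 : |fderiv ℝ A (q c t) (δ t)| ≤ C₂ * (2 * ‖h‖) := by
      rw [← Real.norm_eq_abs]
      refine (ContinuousLinearMap.le_opNorm _ _).trans ?_
      gcongr
    have m4 : |A (q (c + h) t) - A (q c t) - fderiv ℝ A (q c t) (δ t)| ≤ C₁ * (2 * ‖h‖) ^ 2 := by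
      refine T1.trans ?_
      gcongr
    calc _ ≤ C₁ * (2 * ‖h‖) ^ 2 * (R1 + 1) + C₂ * (2 * ‖h‖) * ‖h‖ := by gcongr
      _ = _ := by ring
  have := intervalIntegral.norm_integral_le_of_norm_le_const hbound
  rw [sub_zero, abs_of_pos (by positivity : 0 < 2 * Real.pi), Real.norm_eq_abs] at this
  refine this.trans (le_of_eq ?_)
  ring

lemma act_shift {A : ℂ → ℝ} (hAc : Continuous A) {B : ℝ → ℝ} (hB : Continuous B) {p : ℂ}
    (hAB : ∀ z, A (z + p) = A z + B z.im) {v : ℝ} {q W q' W' : ℝ → ℂ}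
    (hq : ∀ t, HasDerivAt q (W t) t) (hWc : Continuous W)
    (hqp : Function.Periodic q (2 * Real.pi))
    (h1 : ∀ t, q' t = q t + p) (h2 : ∀ t, W' t = W t) :
    act A v q' W' = act A v q W := by
  have hqc : Continuous q := continuous_iff_continuousAt.2 fun t => (hq t).continuousAt
  have e : act A v q' W' = ∫ t in (0:ℝ)..(2 * Real.pi),
      ((A (q t) * (W t).im - v * ((q t).re * Real.sin t - (q t).im * Real.cos t)) +
        ((B ∘ fun t => (q t).im) t * (W t).im + (p.im * v * Real.cos t - p.re * v * Real.sin t)))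
      := by
    unfold act
    congr 1
    ext t
    rw [h1, h2, hAB]
    simp only [Complex.add_re, Complex.add_im, Function.comp]
    ring
  have i1 : ∫ t in (0:ℝ)..(2 * Real.pi), (B ∘ fun t => (q t).im) t * (W t).im = 0 := by
    rw [intervalIntegral.integral_comp_mul_deriv (f := fun t => (q t).im)
      (f' := fun t => (W t).im) (g := B) ?_ (by fun_prop) hB]
    · have e1 : q (2 * Real.pi) = q 0 := by simpa using hqp 0
      simp [e1]
    · intro t _
      exact HasFDerivAt.comp_hasDerivAt (l := Complex.imCLM) (f := q) t
          Complex.imCLM.hasFDerivAt (hq t)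
  have i2 : ∫ t in (0:ℝ)..(2 * Real.pi), (p.im * v * Real.cos t - p.re * v * Real.sin t) = 0 := by
    rw [intervalIntegral.integral_sub (Continuous.intervalIntegrable (by fun_prop) _ _)
      (Continuous.intervalIntegrable (by fun_prop) _ _)]
    simp
  have c1 : Continuous (fun t => (B ∘ fun t => (q t).im) t * (W t).im) := by
    simp only [Function.comp]
    fun_prop
  have c2 : Continuous (fun t => p.im * v * Real.cos t - p.re * v * Real.sin t) := by fun_prop
  have c3 : Continuous (fun t => A (q t) * (W t).im -
    v * ((q t).re * Real.sin t - (q t).im * Real.cos t)) := by fun_prop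
  have c4 : Continuous (fun t => (B ∘ fun t => (q t).im) t * (W t).im +
    (p.im * v * Real.cos t - p.re * v * Real.sin t)) := c1.add c2
  rw [e, intervalIntegral.integral_add (c3.intervalIntegrable _ _) (c4.intervalIntegrable _ _),
    intervalIntegral.integral_add (c1.intervalIntegrable _ _) (c2.intervalIntegrable _ _), i1, i2]
  simp [act]

/-- existence of periodic solutions of the ODE in the angle variable -/
lemma exists_periodic (f : ℂ → ℝ) (hf : ContDiff ℝ (⊤ : ℕ∞) f) (hpos : ∀ z, 0 < f z)
    (h1 : Function.Periodic f 1) (hI : Function.Periodic f Complex.I) :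
    ∃ v₀ : ℝ, 0 < v₀ ∧ ∀ v ∈ Set.Ioo 0 v₀, ∃ q : ℝ → ℂ,
      Function.Periodic q (2 * Real.pi) ∧
      ∀ t, HasDerivAt q (((f (q t))⁻¹ : ℝ) * (v * ee t)) t := by
  set g : ℂ → ℝ := fun z => (f z)⁻¹ with hgdef
  have hfg : ∀ z, f z * g z = 1 := fun z => mul_inv_cancel₀ (hpos z).ne'
  have hgs : ContDiff ℝ (⊤ : ℕ∞) g := hf.inv fun z => (hpos z).ne'
  have hg : Continuous g := hgs.continuous
  have hgpos : ∀ z, 0 < g z := fun z => inv_pos.2 (hpos z)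
  have hg1 : Function.Periodic g 1 := fun z => by simp only [hgdef, h1 z]
  have hgI : Function.Periodic g Complex.I := fun z => by simp only [hgdef, hI z]
  obtain ⟨zM, hM⟩ := exists_max g hg hg1 hgI
  obtain ⟨zm, hm⟩ := exists_max (fun z => - g z) hg.neg
    (fun z => by simp only [hg1 z]) (fun z => by simp only [hgI z])
  have hdg : Continuous (fderiv ℝ g) := hgs.continuous_fderiv (by simp)
  have hdper : ∀ p, Function.Periodic g p → Function.Periodic (fderiv ℝ g) p := by
    intro p hp z
    rw [← fderiv_comp_add_right]
    congr 1
    ext w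
    exact hp w
  obtain ⟨zL, hL⟩ := exists_max (fun z => ‖fderiv ℝ g z‖) hdg.norm
    (fun z => by simp only [hdper 1 hg1 z]) (fun z => by simp only [hdper _ hgI z])
  have hLip : ∀ z w, |g z - g w| ≤ ‖fderiv ℝ g zL‖ * ‖z - w‖ := by
    intro z w
    exact Convex.norm_image_sub_le_of_norm_fderiv_le (𝕜 := ℝ) (s := Set.univ)
      (fun x _ => (hgs.differentiable (by simp)) x) (fun x _ => hL x) convex_univ
      (Set.mem_univ w) (Set.mem_univ z)
  obtain ⟨v₀, hv₀, H⟩ := reduction hg (hgpos zm) (fun z => by simpa using hm z) hM hLip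
    (norm_nonneg _)
  obtain ⟨A, hA, hAf, hAI, B, hB, hA1⟩ := exists_primitive f hf h1 hI
  refine ⟨v₀, hv₀, fun v hv => ?_⟩
  obtain ⟨q, W, l, hq, hW, hWc, hqp, hmean, hql, hWl, hsh⟩ := H v hv
  have hfv := first_variation hfg hA hAf hq hW hWc hqp hmean hql hWl
  set a : ℂ → ℝ := fun c => act A v (q c) (W c) with ha
  let D : ℂ → (ℂ →L[ℝ] ℝ) := fun c =>
    (2 * Real.pi) • ((l c).im • Complex.reCLM - (l c).re • Complex.imCLM)
  have hD : ∀ c, HasFDerivAt a (D c) c := by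
    intro c
    obtain ⟨C, hC⟩ := hfv c
    rw [hasFDerivAt_iff_isLittleO_nhds_zero]
    have hO : (fun h => a (c + h) - a c - D c h) =O[nhds 0] fun h : ℂ => ‖h‖ ^ 2 := by
      refine Asymptotics.IsBigO.of_bound C ?_
      filter_upwards [Metric.closedBall_mem_nhds (0:ℂ) one_pos] with h hh
      have := hC h (by simpa using hh)
      rw [Real.norm_eq_abs, norm_pow, norm_norm]
      convert this using 3
      simp [D]
      ring
    refine hO.trans_isLittleO ?_
    have := Asymptotics.isLittleO_norm_pow_id (E' := ℂ) one_lt_two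
    exact this
  have hac : Continuous a := continuous_iff_continuousAt.2 fun c => (hD c).continuousAt
  have ha1 : Function.Periodic a 1 := fun c =>
    act_shift hA.continuous hB hA1 (hq c) (hWc c) (hqp c) (fun t => (hsh 1 hg1 c t).1)
      (fun t => (hsh 1 hg1 c t).2)
  have haI : Function.Periodic a Complex.I := fun c =>
    act_shift hA.continuous (B := fun _ => 0) continuous_const (fun z => by simp [hAI])
      (hq c) (hWc c) (hqp c) (fun t => (hsh _ hgI c t).1) (fun t => (hsh _ hgI c t).2)
  obtain ⟨c, hc⟩ := exists_max a hac ha1 haI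
  have hloc : IsLocalMax a c := Filter.Eventually.of_forall hc
  have hz := hloc.hasFDerivAt_eq_zero (hD c)
  have hl : l c = 0 := by
    have e1 := DFunLike.congr_fun hz 1
    have e2 := DFunLike.congr_fun hz Complex.I
    have hpi := Real.pi_ne_zero
    simp [D, hpi] at e1 e2
    exact Complex.ext e2 e1
  refine ⟨q c, hqp c, fun t => ?_⟩
  have := hq c t
  rwa [hW, hl, add_zero] at this

end MagTorus
namespace MagTorus

lemma ee_hasDerivAt (t : ℝ) : HasDerivAt ee (Complex.I * ee t) t := by
  have h1 : HasDerivAt (fun t : ℝ => (t : ℂ) * Complex.I) (1 * Complex.I) t :=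
    (Complex.ofRealCLM.hasDerivAt (x := t)).mul_const Complex.I
  have := h1.cexp
  have e : Complex.exp (t * Complex.I) * (1 * Complex.I) = Complex.I * ee t := by
    unfold ee
    ring
  rw [e] at this
  exact this

lemma ee_contDiff {n : WithTop ℕ∞} : ContDiff ℝ n ee := by
  unfold ee
  exact ((Complex.ofRealCLM.contDiff).mul contDiff_const).cexp

lemma curve_pos (f : ℂ → ℝ) (hf : ContDiff ℝ (⊤ : ℕ∞) f) (hpos : ∀ z, 0 < f z)
    {M : ℝ} (hM : ∀ z, f z ≤ M) {v : ℝ} (hv : 0 < v) {q : ℝ → ℂ}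
    (hqp : Function.Periodic q (2 * Real.pi))
    (hq : ∀ t, HasDerivAt q (((f (q t))⁻¹ : ℝ) * (v * ee t)) t) :
    ∃ T : ℝ, 0 < T ∧ ∃ γ : ℝ → ℂ, ContDiff ℝ (⊤ : ℕ∞) γ ∧ Function.Periodic γ T ∧
      ∀ s, deriv (deriv γ) s = f (γ s) * (Complex.I * deriv γ s) ∧ ‖deriv γ s‖ = v := by
  have hpi := Real.pi_pos
  have hfc := hf.continuous
  have hqc : Continuous q := continuous_iff_continuousAt.2 fun t => (hq t).continuousAt
  set r : ℝ → ℝ := fun t => (f (q t))⁻¹ with hr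
  have hrc : Continuous r := (hfc.comp hqc).inv₀ fun t => (hpos _).ne'
  have hrpos : ∀ t, 0 < r t := fun t => inv_pos.2 (hpos _)
  have hM0 : 0 < M := (hpos 0).trans_le (hM 0)
  have hrM : ∀ t, M⁻¹ ≤ r t := fun t => inv_anti₀ (hpos _) (hM _)
  have hrp : Function.Periodic r (2 * Real.pi) := fun t => by simp only [hr, hqp t]
  set τ : ℝ → ℝ := fun x => ∫ t in (0:ℝ)..x, r t with hτ
  have hτd : ∀ x, HasDerivAt τ (r x) x := fun x =>
    intervalIntegral.integral_hasDerivAt_right (hrc.intervalIntegrable 0 x)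
      (hrc.stronglyMeasurableAtFilter _ _) hrc.continuousAt
  have hτc : Continuous τ := continuous_iff_continuousAt.2 fun t => (hτd t).continuousAt
  have hτm : StrictMono τ := strictMono_of_hasDerivAt_pos hτd hrpos
  have hτ0 : τ 0 = 0 := by simp [hτ]
  have hmono : Monotone (fun x => τ x - M⁻¹ * x) := by
    have hd : ∀ x, HasDerivAt (fun x => τ x - M⁻¹ * x) (r x - M⁻¹ * 1) x := fun x =>
      (hτd x).sub ((hasDerivAt_id x).const_mul M⁻¹)
    refine monotone_of_deriv_nonneg (fun x => (hd x).differentiableAt) fun x => ?_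
    rw [(hd x).deriv]
    have := hrM x
    linarith
  have hsurj : Function.Surjective τ := by
    refine hτc.surjective ?_ ?_
    · refine Filter.tendsto_atTop_mono' _ ?_
        (Filter.tendsto_id.const_mul_atTop (inv_pos.2 hM0))
      filter_upwards [Filter.eventually_ge_atTop 0] with x hx
      have := hmono hx
      simp only [hτ0] at this
      simp only [id]
      linarith
    · refine Filter.tendsto_atBot_mono' _ ?_
        (Filter.tendsto_id.const_mul_atBot (inv_pos.2 hM0))
      filter_upwards [Filter.eventually_le_atBot 0] with x hx
      have := hmono hx
      simp only [hτ0] at this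
      simp only [id]
      linarith
  set e := hτm.orderIsoOfSurjective τ hsurj with he
  set Θ : ℝ → ℝ := fun s => e.symm s with hΘ
  have hτΘ : ∀ s, τ (Θ s) = s := fun s => e.apply_symm_apply s
  have hΘc : Continuous Θ := e.symm.continuous
  have hΘd : ∀ s, HasDerivAt Θ (f (q (Θ s))) s := by
    intro s
    have := HasDerivAt.of_local_left_inverse hΘc.continuousAt (hτd (Θ s)) (hrpos _).ne'
      (Filter.Eventually.of_forall hτΘ)
    simpa [hr] using this
  have hτper : ∀ x, τ (x + 2 * Real.pi) = τ x + τ (2 * Real.pi) := by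
    intro x
    simp only [hτ]
    rw [← intervalIntegral.integral_add_adjacent_intervals
      (hrc.intervalIntegrable 0 x) (hrc.intervalIntegrable x (x + 2 * Real.pi)),
      hrp.intervalIntegral_add_eq x 0, zero_add]
  have hΘper : ∀ s, Θ (s + τ (2 * Real.pi)) = Θ s + 2 * Real.pi := by
    intro s
    apply hτm.injective
    rw [hτΘ, hτper, hτΘ]
  set γ : ℝ → ℂ := fun s => q (Θ s) with hγ
  have hγd : ∀ s, HasDerivAt γ (v * ee (Θ s)) s := by
    intro s
    have h := HasDerivAt.scomp (g₁ := q) (h := Θ) s (hq (Θ s)) (hΘd s)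
    have hne : (f (q (Θ s)) : ℂ) ≠ 0 := by exact_mod_cast (hpos _).ne'
    have e3 : f (q (Θ s)) • (((f (q (Θ s)))⁻¹ : ℝ) * (v * ee (Θ s)) : ℂ) = v * ee (Θ s) := by
      rw [Complex.real_smul]
      push_cast
      field_simp
    rw [e3] at h
    exact h
  have hγ' : deriv γ = fun s => v * ee (Θ s) := funext fun s => (hγd s).deriv
  have hΘ' : deriv Θ = fun s => f (γ s) := funext fun s => (hΘd s).deriv
  have hsm : ∀ n : ℕ, ContDiff ℝ n γ ∧ ContDiff ℝ n Θ := by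
    intro n
    induction n with
    | zero =>
      refine ⟨?_, ?_⟩
      · exact contDiff_zero.2 (hqc.comp hΘc)
      · exact contDiff_zero.2 hΘc
    | succ n ih =>
      obtain ⟨i1, i2⟩ := ih
      push_cast
      rw [contDiff_succ_iff_deriv, contDiff_succ_iff_deriv]
      refine ⟨⟨fun s => (hγd s).differentiableAt, by simp, ?_⟩,
        fun s => (hΘd s).differentiableAt, by simp, ?_⟩
      · rw [hγ']
        exact contDiff_const.mul (ee_contDiff.comp i2)
      · rw [hΘ']
        exact (contDiff_infty.1 hf n).comp i1
  refine ⟨τ (2 * Real.pi), ?_, γ, contDiff_infty.2 fun n => (hsm n).1, ?_, fun s => ⟨?_, ?_⟩⟩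
  · rw [← hτ0]
    exact hτm (by positivity)
  · intro s
    simp only [hγ, hΘper, hqp (Θ s)]
  · rw [hγ']
    have h := (HasDerivAt.scomp (g₁ := ee) (h := Θ) s (ee_hasDerivAt (Θ s)) (hΘd s)).const_mul
      (v : ℂ)
    have e2 : deriv (fun s => v * ee (Θ s)) s = v * (f (q (Θ s)) • (Complex.I * ee (Θ s))) :=
      h.deriv
    rw [e2, Complex.real_smul]
    simp only [hγ]
    ring
  · rw [hγ']
    simp only [norm_mul, ee_norm, Complex.norm_real, Real.norm_of_nonneg hv.le, mul_one]

lemma complex_pos (f : ℂ → ℝ) (hf : ContDiff ℝ (⊤ : ℕ∞) f) (hpos : ∀ z, 0 < f z)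
    (h1 : Function.Periodic f 1) (hI : Function.Periodic f Complex.I) :
    ∃ v₀ : ℝ, 0 < v₀ ∧ ∀ v ∈ Set.Ioo 0 v₀,
      ∃ T : ℝ, 0 < T ∧ ∃ γ : ℝ → ℂ, ContDiff ℝ (⊤ : ℕ∞) γ ∧ Function.Periodic γ T ∧
      ∀ s, deriv (deriv γ) s = f (γ s) * (Complex.I * deriv γ s) ∧ ‖deriv γ s‖ = v := by
  obtain ⟨v₀, hv₀, H⟩ := exists_periodic f hf hpos h1 hI
  obtain ⟨zM, hM⟩ := exists_max f hf.continuous h1 hI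
  refine ⟨v₀, hv₀, fun v hv => ?_⟩
  obtain ⟨q, hqp, hq⟩ := H v hv
  exact curve_pos f hf hpos hM hv.1 hqp hq

lemma complex_main (f : ℂ → ℝ) (hf : ContDiff ℝ (⊤ : ℕ∞) f) (h0 : ∀ z, f z ≠ 0)
    (h1 : Function.Periodic f 1) (hI : Function.Periodic f Complex.I) :
    ∃ v₀ : ℝ, 0 < v₀ ∧ ∀ v ∈ Set.Ioo 0 v₀,
      ∃ T : ℝ, 0 < T ∧ ∃ γ : ℝ → ℂ, ContDiff ℝ (⊤ : ℕ∞) γ ∧ Function.Periodic γ T ∧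
      ∀ s, deriv (deriv γ) s = f (γ s) * (Complex.I * deriv γ s) ∧ ‖deriv γ s‖ = v := by
  have hsign : (∀ z, 0 < f z) ∨ (∀ z, f z < 0) := by
    by_contra hcon
    push Not at hcon
    obtain ⟨⟨a, ha⟩, b, hb⟩ := hcon
    obtain ⟨z, hz⟩ := mem_range_of_exists_le_of_exists_ge hf.continuous ⟨a, ha⟩ ⟨b, hb⟩
    exact h0 z hz
  rcases hsign with hpos | hneg
  · exact complex_pos f hf hpos h1 hI
  · obtain ⟨v₀, hv₀, H⟩ := complex_pos (fun z => - f z) hf.neg (fun z => by linarith [hneg z])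
      (fun z => by simp only [h1 z]) (fun z => by simp only [hI z])
    refine ⟨v₀, hv₀, fun v hv => ?_⟩
    obtain ⟨T, hT, γ, hγ, hper, heq⟩ := H v hv
    refine ⟨T, hT, fun s => γ (-s), hγ.comp contDiff_neg, ?_, ?_⟩
    · intro s
      have := hper (-(s + T))
      simp only
      rw [← this]
      congr 1
      ring
    · intro s
      have d1 : deriv (fun s => γ (-s)) = fun s => - deriv γ (-s) :=
        funext fun s => deriv_comp_neg γ s
      have d2 : deriv (fun s => - deriv γ (-s)) s = deriv (deriv γ) (-s) := by
        rw [deriv.fun_neg, deriv_comp_neg, neg_neg]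
      rw [d1, d2]
      obtain ⟨a1, a2⟩ := heq (-s)
      refine ⟨?_, by simpa using a2⟩
      rw [a1]
      push_cast
      ring

end MagTorus

/-- For a smooth ℤ²-periodic nowhere-vanishing `f : ℝ² → ℝ` (a symplectic
magnetic form on the flat two-torus), there is `k₀ > 0` such that every energy
level `k ∈ (0, k₀)` carries a contractible closed magnetic geodesic, i.e. a
nonconstant smooth periodic solution `γ : ℝ → ℝ²` of `γ'' = f(γ) · Jγ'` with
`½‖γ'‖² = k`. -/
theorem contractible_closed_magnetic_geodesic_on_torus_low_energy
    (f : EuclideanSpace ℝ (Fin 2) → ℝ) (hf : ContDiff ℝ (⊤ : ℕ∞) f)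
    (hfper : ∀ (m : Fin 2 → ℤ) (q : EuclideanSpace ℝ (Fin 2)),
      f (q + (EuclideanSpace.equiv (Fin 2) ℝ).symm (fun i => (m i : ℝ))) = f q)
    (hf0 : ∀ q : EuclideanSpace ℝ (Fin 2), f q ≠ 0) :
    ∃ k₀ : ℝ, 0 < k₀ ∧
      ∀ k : ℝ, k ∈ Set.Ioo 0 k₀ →
        ∃ T : ℝ, 0 < T ∧
          ∃ γ : ℝ → EuclideanSpace ℝ (Fin 2),
            ContDiff ℝ (⊤ : ℕ∞) γ ∧ Function.Periodic γ T ∧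
            (∃ s₁ s₂ : ℝ, γ s₁ ≠ γ s₂) ∧
            ∀ s : ℝ,
              deriv (deriv γ) s = f (γ s) • rotJ (deriv γ s) ∧
              (1 / 2) * ‖deriv γ s‖ ^ 2 = k := by
  set Φ := Complex.orthonormalBasisOneI.repr with hΦ
  have hΦ0 : ∀ z, Φ z 0 = z.re := fun z => by simp [hΦ]
  have hΦ1 : ∀ z, Φ z 1 = z.im := fun z => by simp [hΦ]
  have hper : ∀ (m : Fin 2 → ℤ) (z : ℂ), f (Φ (z + ((m 0 : ℂ) + (m 1 : ℂ) * Complex.I))) = f (Φ z) := by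
    intro m z
    rw [← hfper m (Φ z), map_add]
    congr 2
    ext i
    fin_cases i
    · simp [hΦ0]
    · simp [hΦ1]
  have hJ : ∀ z, rotJ (Φ z) = Φ (Complex.I * z) := by
    intro z
    ext i
    fin_cases i
    · simp [rotJ, hΦ0, hΦ1]
    · simp [rotJ, hΦ0, hΦ1]
  obtain ⟨v₀, hv₀, H⟩ := MagTorus.complex_main (fun z => f (Φ z))
    (hf.comp Φ.toContinuousLinearEquiv.contDiff) (fun z => hf0 _)
    (fun z => by simpa using hper ![1, 0] z) (fun z => by simpa using hper ![0, 1] z)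
  refine ⟨v₀ ^ 2 / 2, by positivity, ?_⟩
  rintro k ⟨hk0, hk1⟩
  have hv : Real.sqrt (2 * k) ∈ Set.Ioo 0 v₀ := by
    refine ⟨Real.sqrt_pos.2 (by linarith), ?_⟩
    rw [Real.sqrt_lt' hv₀]
    linarith
  obtain ⟨T, hT, γ, hγ, hγp, heq⟩ := H _ hv
  have hd : ∀ u : ℝ → ℂ, Differentiable ℝ u →
      deriv (fun s => Φ (u s)) = fun s => Φ (deriv u s) := by
    intro u hu
    ext1 s
    exact (HasFDerivAt.comp_hasDerivAt (l := Φ) (f := u) s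
      Φ.toContinuousLinearEquiv.hasFDerivAt (hu s).hasDerivAt).deriv
  have hγ1 : Differentiable ℝ γ := hγ.differentiable (by simp)
  have hγ2 : Differentiable ℝ (deriv γ) :=
    ((contDiff_succ_iff_deriv (n := 1)).1 ((contDiff_infty.1 hγ 2).of_le
      (by norm_num))).2.2.differentiable (by simp)
  refine ⟨T, hT, fun s => Φ (γ s), Φ.toContinuousLinearEquiv.contDiff.comp hγ,
    fun s => by simp only [hγp s], ?_, ?_⟩
  · by_contra hcon
    push Not at hcon
    have hc : γ = fun _ => γ 0 := funext fun s => Φ.injective (hcon s 0)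
    have h2 := (heq 0).2
    rw [hc] at h2
    simp only [deriv_const, norm_zero] at h2
    exact hv.1.ne h2
  · intro s
    rw [hd γ hγ1, hd _ hγ2]
    obtain ⟨a1, a2⟩ := heq s
    refine ⟨?_, ?_⟩
    · simp only
      rw [hJ, a1, ← Complex.real_smul, map_smul]
    · simp only
      rw [Φ.norm_map, a2, Real.sq_sqrt (by linarith)]
      ring
end
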